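/- Let S be a finite set of points in the plane, let B ⊆ S with |B| = 3, and suppose there exists a simple polygon P whose interior contains S, with S together with the vertices of P in strong general position, such that E_P(S) = B. Then B is separable from S \ B. -/

import Mathlib

open scoped RealInnerProductSpace ENNReal Classical

noncomputable section

/-- Points of the Euclidean plane. -/
abbrev Pt : Type := EuclideanSpace ℝ (Fin 2)

/-- The planar determinant `det (u, v)` of two vectors. -/
def det2 (u v : Pt) : ℝ := u 0 * v 1 - u 1 * v 0

/-- No three of the points of `S` are collinear. -/
def NoThreeCollinear (S : Set Pt) : Prop :=
  ∀ p ∈ S, ∀ q ∈ S, ∀ r ∈ S, p ≠ q → p ≠ r → q ≠ r → det2 (q - p) (r - p) ≠ 0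

/-- `S` is in strong general position: no three points are collinear and for any four
distinct points `p₁ p₂ p₃ p₄` the line through `p₁,p₂` is not parallel to the line
through `p₃,p₄`. -/
def StrongGenPos (S : Set Pt) : Prop :=
  NoThreeCollinear S ∧
    ∀ p₁ ∈ S, ∀ p₂ ∈ S, ∀ p₃ ∈ S, ∀ p₄ ∈ S,
      p₁ ≠ p₂ → p₁ ≠ p₃ → p₁ ≠ p₄ → p₂ ≠ p₃ → p₂ ≠ p₄ → p₃ ≠ p₄ →
        det2 (p₂ - p₁) (p₄ - p₃) ≠ 0

/-- A simple polygon, given by a cyclic sequence of `n ≥ 3` distinct vertices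
(encoded as an `n`-periodic function `ℕ → Pt`), such that no point of the plane lies on
more than two closed edges, and the only points lying on exactly two edges are vertices. -/
structure SimplePolygon where
  n : ℕ
  three_le : 3 ≤ n
  vtx : ℕ → Pt
  periodic : ∀ i, vtx (i + n) = vtx i
  inj : ∀ i < n, ∀ j < n, vtx i = vtx j → i = j
  simple : ∀ x : Pt, {i | i < n ∧ x ∈ segment ℝ (vtx i) (vtx (i + 1))}.ncard ≤ 2
  vtx_of_two : ∀ x : Pt,
    {i | i < n ∧ x ∈ segment ℝ (vtx i) (vtx (i + 1))}.ncard = 2 → ∃ i < n, x = vtx i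

namespace SimplePolygon

/-- The boundary of a simple polygon: the union of its closed edges. -/
def boundary (P : SimplePolygon) : Set Pt :=
  ⋃ i ∈ Finset.range P.n, segment ℝ (P.vtx i) (P.vtx (i + 1))

/-- The interior of a simple polygon: the union of the bounded connected components of the
complement of the boundary. -/
def interior (P : SimplePolygon) : Set Pt :=
  {x | x ∉ P.boundary ∧ Bornology.IsBounded (connectedComponentIn P.boundaryᶜ x)}

/-- A simple polygon, regarded as a point set: boundary together with interior. -/
def region (P : SimplePolygon) : Set Pt := P.boundary ∪ P.interior

/-- The set of vertices of the polygon. -/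
def vertexSet (P : SimplePolygon) : Set Pt := {x | ∃ i < P.n, x = P.vtx i}

/-- Twice the shoelace signed area. -/
def shoelace (P : SimplePolygon) : ℝ := ∑ i ∈ Finset.range P.n, det2 (P.vtx i) (P.vtx (i + 1))

/-- The vertices are listed in counterclockwise order (positive shoelace signed area). -/
def CCW (P : SimplePolygon) : Prop := 0 < P.shoelace

/-- The vertex `vtx (i+1)` is a convex vertex:
`det (v_{i+1} − v_i, v_{i+2} − v_{i+1}) > 0` (vertices listed counterclockwise). -/
def ConvexAt (P : SimplePolygon) (i : ℕ) : Prop :=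
  0 < det2 (P.vtx (i + 1) - P.vtx i) (P.vtx (i + 2) - P.vtx (i + 1))

/-- The number of convex vertices of the polygon. -/
def numConvex (P : SimplePolygon) : ℕ := {i | i < P.n ∧ P.ConvexAt i}.ncard

/-- Continuous paths from `s` to `t` staying inside the polygon. -/
def pathsIn (P : SimplePolygon) (s t : Pt) : Set (ℝ → Pt) :=
  {γ | ContinuousOn γ (Set.Icc 0 1) ∧ γ 0 = s ∧ γ 1 = t ∧ γ '' Set.Icc (0 : ℝ) 1 ⊆ P.region}

/-- The geodesic distance between `s` and `t` inside the polygon: the infimum of the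
lengths (total variations) of continuous paths in the polygon from `s` to `t`. -/
def geodDist (P : SimplePolygon) (s t : Pt) : ℝ≥0∞ :=
  ⨅ γ ∈ P.pathsIn s t, eVariationOn γ (Set.Icc 0 1)

end SimplePolygon

/-- Length of a polygonal path through a list of points. -/
def polylineLen : List Pt → ℝ
  | [] => 0
  | [_] => 0
  | a :: b :: l => dist a b + polylineLen (b :: l)

/-- The polygonal path through a list of points, as a point set. -/
def polylineSet : List Pt → Set Pt
  | [] => ∅
  | [a] => {a}
  | a :: b :: l => segment ℝ a b ∪ polylineSet (b :: l)

/-- `L` is the vertex sequence of the geodesic from `s` to `t` inside the polygon `P`: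
a polygonal path inside `P` from `s` to `t`, with consecutive vertices distinct, with no
three consecutive vertices collinear, whose length realizes the geodesic distance. -/
def SimplePolygon.IsGeodesicChain (P : SimplePolygon) (s t : Pt) (L : List Pt) : Prop :=
  L.head? = some s ∧ L.getLast? = some t ∧ List.Chain' (· ≠ ·) L ∧
  (∀ i, i + 2 < L.length →
      det2 (L.getD (i + 1) 0 - L.getD i 0) (L.getD (i + 2) 0 - L.getD i 0) ≠ 0) ∧
  polylineSet L ⊆ P.region ∧
  ENNReal.ofReal (polylineLen L) = P.geodDist s t

/-- The triple `(p,q,r)` is in geodesic counterclockwise order with respect to `P`: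
writing the geodesics `π(p,q) = ⟨p = v₀, …, v_k = q⟩` and `π(p,r) = ⟨p = u₀, …, u_{k'} = r⟩`
and taking the smallest index `i > 0` with `v_i ≠ u_i`, we have
`det (v_i − v_{i−1}, u_i − v_{i−1}) > 0`. -/
def geodesicCCW (P : SimplePolygon) (p q r : Pt) : Prop :=
  ∃ L M : List Pt, P.IsGeodesicChain p q L ∧ P.IsGeodesicChain p r M ∧
    ∃ i : ℕ, 0 < i ∧ (∀ j < i, L[j]? = M[j]?) ∧ L[i]? ≠ M[i]? ∧
      ∃ a b c : Pt, L[i - 1]? = some a ∧ L[i]? = some b ∧ M[i]? = some c ∧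
        0 < det2 (b - a) (c - a)

/-- The triple `(p,q,r)` is in geodesic clockwise order with respect to `P`. -/
def geodesicCW (P : SimplePolygon) (p q r : Pt) : Prop :=
  ∃ L M : List Pt, P.IsGeodesicChain p q L ∧ P.IsGeodesicChain p r M ∧
    ∃ i : ℕ, 0 < i ∧ (∀ j < i, L[j]? = M[j]?) ∧ L[i]? ≠ M[i]? ∧
      ∃ a b c : Pt, L[i - 1]? = some a ∧ L[i]? = some b ∧ M[i]? = some c ∧
        det2 (b - a) (c - a) < 0

/-- `C ⊆ P` is geodesically convex: for all `p, q ∈ C` the geodesic connecting them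
stays inside `C`. -/
def GeodesicallyConvex (P : SimplePolygon) (C : Set Pt) : Prop :=
  C ⊆ P.region ∧ ∀ p ∈ C, ∀ q ∈ C, ∀ L, P.IsGeodesicChain p q L → polylineSet L ⊆ C

/-- The geodesic hull `CH_P(U)`: the intersection of all geodesically convex subsets of `P`
containing `U`. -/
def geodesicHull (P : SimplePolygon) (U : Set Pt) : Set Pt :=
  ⋂₀ {C | GeodesicallyConvex P C ∧ U ⊆ C}

/-- `E_P(S)`: the set of points of `S` lying on the (topological) boundary of the geodesic
hull of `S` with respect to `P`. -/
def extremeSet (P : SimplePolygon) (S : Set Pt) : Set Pt :=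
  {x ∈ S | x ∈ frontier (geodesicHull P S)}

/-- `B` is separable from `R`: there is a simple polygon with at most `|B|` convex vertices
whose interior contains all points of `R` and which contains no point of `B`. -/
def Separable (B R : Finset Pt) : Prop :=
  ∃ P : SimplePolygon, P.CCW ∧ P.numConvex ≤ B.card ∧
    (∀ r ∈ R, r ∈ P.interior) ∧ ∀ b ∈ B, b ∉ P.region

/-- The planar scalar product in coordinates. -/
def dot2 (u v : Pt) : ℝ := u 0 * v 0 + u 1 * v 1

/-- Counterclockwise rotation by a right angle. -/
def rotJ (u : Pt) : Pt := !₂[-u 1, u 0]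

lemma pt_ext {p q : Pt} (h0 : p 0 = q 0) (h1 : p 1 = q 1) : p = q := by
  ext i; fin_cases i <;> assumption

@[simp] lemma rotJ_zero (u : Pt) : rotJ u 0 = -u 1 := by simp [rotJ]
@[simp] lemma rotJ_one (u : Pt) : rotJ u 1 = u 0 := by simp [rotJ]

@[simp] lemma det2_self (u : Pt) : det2 u u = 0 := by simp [det2]; ring
@[simp] lemma det2_zero_left (u : Pt) : det2 0 u = 0 := by simp [det2]
@[simp] lemma det2_zero_right (u : Pt) : det2 u 0 = 0 := by simp [det2]
lemma det2_add_left (u v w : Pt) : det2 (u + v) w = det2 u w + det2 v w := by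
  simp [det2]; ring
lemma det2_add_right (u v w : Pt) : det2 u (v + w) = det2 u v + det2 u w := by
  simp [det2]; ring
lemma det2_sub_right (u v w : Pt) : det2 u (v - w) = det2 u v - det2 u w := by
  simp [det2]; ring
lemma det2_smul_left (s : ℝ) (u v : Pt) : det2 (s • u) v = s * det2 u v := by
  simp [det2]; ring
lemma det2_smul_right (s : ℝ) (u v : Pt) : det2 u (s • v) = s * det2 u v := by
  simp [det2]; ring
lemma det2_neg_left (u v : Pt) : det2 (-u) v = -det2 u v := by
  simp [det2]; ring
lemma det2_neg_right (u v : Pt) : det2 u (-v) = -det2 u v := by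
  simp [det2]; ring
lemma det2_swap (u v : Pt) : det2 u v = -det2 v u := by
  simp [det2]; ring

lemma dot2_self_pos {u : Pt} (hu : u ≠ 0) : 0 < dot2 u u := by
  by_contra h
  apply hu
  have h1 : u 0 = 0 ∧ u 1 = 0 := by
    simp only [dot2] at h
    constructor <;> nlinarith [mul_self_nonneg (u 0), mul_self_nonneg (u 1)]
  exact pt_ext h1.1 h1.2

lemma det2_rotJ_self (u : Pt) : det2 u (rotJ u) = dot2 u u := by
  simp [det2, dot2]

lemma det2_rotJ_pos {u : Pt} (hu : u ≠ 0) : 0 < det2 u (rotJ u) := by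
  rw [det2_rotJ_self]; exact dot2_self_pos hu

@[fun_prop] lemma continuous_det2 {X : Type*} [TopologicalSpace X] {f g : X → Pt}
    (hf : Continuous f) (hg : Continuous g) : Continuous fun x => det2 (f x) (g x) := by
  unfold det2; fun_prop

@[fun_prop] lemma continuous_dot2 {X : Type*} [TopologicalSpace X] {f g : X → Pt}
    (hf : Continuous f) (hg : Continuous g) : Continuous fun x => dot2 (f x) (g x) := by
  unfold dot2; fun_prop

/-- `det2` as a continuous linear functional in its second argument. -/
def det2L (u : Pt) : Pt →L[ℝ] ℝ :=
  LinearMap.toContinuousLinearMap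
    { toFun := det2 u
      map_add' := det2_add_right u
      map_smul' := fun s v => by simp [det2_smul_right] }

@[simp] lemma det2L_apply (u v : Pt) : det2L u v = det2 u v := rfl

lemma exists_det2_eq (f : Pt →L[ℝ] ℝ) : ∃ u : Pt, ∀ x, f x = det2 u x := by
  refine ⟨!₂[f !₂[0, 1], -f !₂[1, 0]], fun x => ?_⟩
  have hx : x = x 0 • !₂[1, 0] + x 1 • !₂[0, 1] := by
    apply pt_ext <;> simp
  conv_lhs => rw [hx]
  simp only [map_add, map_smul, det2]
  simp
  ring

/-- A point outside a closed convex set is strictly separated from it. -/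
lemma exists_det2_pos {K : Set Pt} (hK : Convex ℝ K) (hc : IsClosed K) {z : Pt} (hz : z ∉ K) :
    ∃ u : Pt, ∀ x ∈ K, 0 < det2 u (x - z) := by
  obtain ⟨f, c, h1, h2⟩ := geometric_hahn_banach_point_closed hK hc hz
  obtain ⟨u, hu⟩ := exists_det2_eq f
  refine ⟨u, fun x hx => ?_⟩
  rw [det2_sub_right, ← hu, ← hu]
  linarith [h2 x hx]

/-- The complex number `conj (a - z) * (b - z)`. -/
def angNum (z a b : Pt) : ℂ := ⟨dot2 (a - z) (b - z), det2 (a - z) (b - z)⟩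

/-- The oriented angle, in `(-π, π]`, under which `z` sees the segment from `a` to `b`. -/
def ang (z a b : Pt) : ℝ := (angNum z a b).arg

/-- The complex number representing a vector. -/
def cx (u : Pt) : ℂ := ⟨u 0, u 1⟩

lemma cx_ne_zero {u : Pt} (hu : u ≠ 0) : cx u ≠ 0 := by
  intro h
  apply hu
  have := congrArg Complex.re h
  have h' := congrArg Complex.im h
  simp only [cx, Complex.zero_re, Complex.zero_im] at this h'
  exact pt_ext this h'

lemma angNum_eq (z a b : Pt) : angNum z a b = (starRingEnd ℂ) (cx (a - z)) * cx (b - z) := by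
  apply Complex.ext <;> simp [angNum, cx, dot2, det2] <;> ring

lemma ang_coe {z a b : Pt} (ha : a ≠ z) (hb : b ≠ z) :
    (ang z a b : Real.Angle) = ((cx (b - z)).arg : Real.Angle) - (cx (a - z)).arg := by
  rw [ang, angNum_eq, Complex.arg_mul_coe_angle, Complex.arg_conj_coe_angle]
  · abel
  · simpa using cx_ne_zero (sub_ne_zero.2 ha)
  · exact cx_ne_zero (sub_ne_zero.2 hb)

lemma angNum_mem_slitPlane {z a b : Pt} (h : z ∉ segment ℝ a b) :
    angNum z a b ∈ Complex.slitPlane := by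
  rw [Complex.mem_slitPlane_iff]
  by_contra hcon
  push Not at hcon
  obtain ⟨h1, h2⟩ := hcon
  simp only [angNum] at h1 h2
  have ha : a ≠ z := by rintro rfl; exact h (left_mem_segment ℝ _ _)
  have hpos := dot2_self_pos (sub_ne_zero.2 ha)
  apply h
  -- `b - z = k • (a - z)` with `k ≤ 0`
  set k := dot2 (a - z) (b - z) / dot2 (a - z) (a - z) with hk
  have hk0 : k ≤ 0 := div_nonpos_of_nonpos_of_nonneg h1 hpos.le
  have e0 : b 0 - z 0 = k * (a 0 - z 0) := by
    rw [hk, div_mul_eq_mul_div, eq_div_iff hpos.ne']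
    simp only [dot2, det2, PiLp.sub_apply] at h2 ⊢
    linear_combination (z 1 - a 1) * h2
  have e1 : b 1 - z 1 = k * (a 1 - z 1) := by
    rw [hk, div_mul_eq_mul_div, eq_div_iff hpos.ne']
    simp only [dot2, det2, PiLp.sub_apply] at h2 ⊢
    linear_combination (a 0 - z 0) * h2
  have h1k : 0 < 1 - k := by linarith
  refine ⟨-k / (1 - k), 1 / (1 - k), div_nonneg (by linarith) h1k.le, by positivity, by
    field_simp; ring, ?_⟩
  apply pt_ext
  · simp; field_simp; linarith
  · simp; field_simp; linarith

lemma continuous_angNum (a b : Pt) : Continuous fun z => angNum z a b := by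
  have : (fun z => angNum z a b) =
      fun z => (dot2 (a - z) (b - z) : ℂ) + (det2 (a - z) (b - z) : ℂ) * Complex.I := by
    funext z; apply Complex.ext <;> simp [angNum]
  rw [this]; fun_prop

lemma continuousAt_ang {z a b : Pt} (h : z ∉ segment ℝ a b) :
    ContinuousAt (fun z => ang z a b) z :=
  ContinuousAt.comp (g := Complex.arg) (Complex.continuousAt_arg (angNum_mem_slitPlane h))
    (continuous_angNum a b).continuousAt

/-- In an open half-plane seen from `z`, angles are differences of a potential. -/
lemma ang_eq_sub {z u a b : Pt} (ha : 0 < det2 u (a - z)) (hb : 0 < det2 u (b - z)) :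
    ang z a b = Complex.arg ⟨det2 u (b - z), -dot2 u (b - z)⟩ -
      Complex.arg ⟨det2 u (a - z), -dot2 u (a - z)⟩ := by
  have hu : u ≠ 0 := by rintro rfl; simp at ha
  have key : ∀ c : Pt, 0 < det2 u (c - z) → ∃ hc : c ≠ z,
      |Complex.arg ⟨det2 u (c - z), -dot2 u (c - z)⟩| < Real.pi / 2 ∧
      (Complex.arg ⟨det2 u (c - z), -dot2 u (c - z)⟩ : Real.Angle) =
        (cx (c - z)).arg + (Complex.arg (-Complex.I * (starRingEnd ℂ) (cx u)) : ℝ) := by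
    intro c hc
    have hcz : c ≠ z := by rintro rfl; simp at hc
    refine ⟨hcz, ?_, ?_⟩
    · rw [Complex.abs_arg_lt_pi_div_two_iff]; exact Or.inl hc
    · rw [← Complex.arg_mul_coe_angle (cx_ne_zero (sub_ne_zero.2 hcz))]
      · congr 2
        apply Complex.ext <;> simp [cx, det2, dot2] <;> ring
      · simp [cx_ne_zero hu]
  obtain ⟨haz, ha1, ha2⟩ := key a ha
  obtain ⟨hbz, hb1, hb2⟩ := key b hb
  have h1 := ang_coe haz hbz
  have h2 : (ang z a b : Real.Angle) = ((Complex.arg ⟨det2 u (b - z), -dot2 u (b - z)⟩ -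
      Complex.arg ⟨det2 u (a - z), -dot2 u (a - z)⟩ : ℝ) : Real.Angle) := by
    rw [Real.Angle.coe_sub, ha2, hb2, h1]; abel
  have h3 := congrArg Real.Angle.toReal h2
  rw [abs_lt] at ha1 hb1
  have h4 : (ang z a b : Real.Angle).toReal = ang z a b :=
    Real.Angle.toReal_coe_eq_self_iff.2 ⟨Complex.neg_pi_lt_arg _, Complex.arg_le_pi _⟩
  rwa [h4, Real.Angle.toReal_coe_eq_self_iff.2 ⟨by linarith, by linarith⟩] at h3

/-- Additivity of angles inside a closed convex set not containing the viewpoint. -/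
lemma ang_add {K : Set Pt} (hK : Convex ℝ K) (hc : IsClosed K) {z a b c : Pt} (hz : z ∉ K)
    (ha : a ∈ K) (hb : b ∈ K) (hcK : c ∈ K) : ang z a c + ang z c b = ang z a b := by
  obtain ⟨u, hu⟩ := exists_det2_pos hK hc hz
  rw [ang_eq_sub (hu a ha) (hu c hcK), ang_eq_sub (hu c hcK) (hu b hb),
    ang_eq_sub (hu a ha) (hu b hb)]
  ring

lemma isClosed_segment (a b : Pt) : IsClosed (segment ℝ a b) := by
  rw [segment_eq_image]
  exact (isCompact_Icc.image (by fun_prop)).isClosed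

lemma ang_split {z a b c : Pt} (hz : z ∉ segment ℝ a b) (hc : c ∈ segment ℝ a b) :
    ang z a c + ang z c b = ang z a b :=
  ang_add (convex_segment a b) (isClosed_segment a b) hz (left_mem_segment ℝ _ _)
    (right_mem_segment ℝ _ _) hc

lemma ang_self {z a : Pt} (h : a ≠ z) : ang z a a = 0 := by
  have hp := dot2_self_pos (sub_ne_zero.2 h)
  have : angNum z a a = ((dot2 (a - z) (a - z) : ℝ) : ℂ) := by
    apply Complex.ext <;> simp [angNum]
  rw [ang, this, Complex.arg_ofReal_of_nonneg hp.le]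

lemma ang_swap_add {z a b : Pt} (hz : z ∉ segment ℝ a b) : ang z a b + ang z b a = 0 := by
  rw [ang_add (convex_segment a b) (isClosed_segment a b) hz (left_mem_segment ℝ _ _)
    (left_mem_segment ℝ _ _) (right_mem_segment ℝ _ _), ang_self]
  rintro rfl; exact hz (left_mem_segment ℝ _ _)

lemma angNum_im (z a b : Pt) : (angNum z a b).im = det2 (b - a) (z - a) := by
  simp [angNum, det2]; ring

lemma eq_add_two_pi_of_coe {x y : ℝ} (hx : (x : Real.Angle) = 0) (hy : (y : Real.Angle) = 0)
    (h1 : 0 < x - y) (h2 : x - y < 4 * Real.pi) : x = y + 2 * Real.pi := by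
  obtain ⟨m, hm⟩ := Real.Angle.coe_eq_zero_iff.1 hx
  obtain ⟨k, hk⟩ := Real.Angle.coe_eq_zero_iff.1 hy
  rw [zsmul_eq_mul] at hm hk
  have hp := Real.pi_pos
  have h3 : (k : ℝ) < m := by nlinarith
  have h4 : (m : ℝ) < k + 2 := by nlinarith
  have h5 : m = k + 1 := by
    have h3' : k < m := by exact_mod_cast h3
    have h4' : m < k + 2 := by exact_mod_cast h4
    omega
  rw [← hm, ← hk, h5]; push_cast; ring

/-- Crossing an edge of a closed chain from right to left raises the winding by `2π`. -/
lemma wind_jump {F : Pt → ℝ} {a b z₀ : Pt} (hz₀ : z₀ ∈ openSegment ℝ a b) (hab : a ≠ b)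
    (hF : ContinuousAt F z₀)
    (hint : ∀ᶠ z in nhds z₀, z ∉ segment ℝ a b → ((ang z a b + F z : ℝ) : Real.Angle) = 0) :
    ∃ ε > 0, ∀ z ∈ Metric.ball z₀ ε, ∀ z' ∈ Metric.ball z₀ ε, 0 < det2 (b - a) (z - a) →
      det2 (b - a) (z' - a) < 0 → ang z a b + F z = ang z' a b + F z' + 2 * Real.pi := by
  have hp := Real.pi_pos
  have hre : ∀ᶠ z in nhds z₀, (angNum z a b).re < 0 := by
    have hc : Continuous fun z => (angNum z a b).re :=
      Complex.continuous_re.comp (continuous_angNum a b)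
    refine hc.continuousAt.eventually_lt continuousAt_const ?_
    obtain ⟨s, t, hs, ht, hst, rfl⟩ := hz₀
    have hd := dot2_self_pos (sub_ne_zero.2 hab)
    have : (angNum (s • a + t • b) a b).re = -(s * t * dot2 (a - b) (a - b)) := by
      have hs' : s = 1 - t := by linarith
      subst hs'
      simp [angNum, dot2]; ring
    rw [this]
    have : 0 < s * t * dot2 (a - b) (a - b) := by positivity
    linarith
  have hF' : ∀ᶠ z in nhds z₀, |F z - F z₀| < Real.pi / 4 := by
    have := (hF.sub_const (F z₀)).abs
    simp only [sub_self, abs_zero] at this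
    exact this.eventually_lt_const (by positivity)
  obtain ⟨ε, hε, hball⟩ := Metric.eventually_nhds_iff_ball.1 (hre.and (hF'.and hint))
  refine ⟨ε, hε, fun z hz z' hz' h1 h2 => ?_⟩
  have hne : ∀ w : Pt, det2 (b - a) (w - a) ≠ 0 → w ∉ segment ℝ a b := by
    rintro w hw ⟨s, t, hs, ht, hst, rfl⟩
    apply hw
    have hs' : s = 1 - t := by linarith
    subst hs'
    simp [det2]; ring
  obtain ⟨r1, f1, i1⟩ := hball z hz
  obtain ⟨r2, f2, i2⟩ := hball z' hz'
  rw [← angNum_im] at h1 h2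
  have a1 := Complex.arg_le_pi (angNum z a b)
  have a2 := Complex.neg_pi_lt_arg (angNum z' a b)
  have b1 : Real.pi / 2 < ang z a b := by
    have := mt Complex.abs_arg_le_pi_div_two_iff.1 (not_le.2 r1)
    have h0 := Complex.arg_nonneg_iff.2 h1.le
    rw [abs_of_nonneg h0, not_le] at this
    exact this
  have b2 : ang z' a b < -(Real.pi / 2) := by
    have := mt Complex.abs_arg_le_pi_div_two_iff.1 (not_le.2 r2)
    have h0 := Complex.arg_neg_iff.2 h2
    rw [abs_of_neg h0, not_le] at this
    show Complex.arg _ < _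
    linarith
  rw [abs_lt] at f1 f2
  change ang z a b ≤ _ at a1
  change _ < ang z' a b at a2
  refine eq_add_two_pi_of_coe (i1 (hne z ?_)) (i2 (hne z' ?_)) (by linarith) (by linarith)
  · rw [← angNum_im]; exact h1.ne'
  · rw [← angNum_im]; exact h2.ne

lemma ang_pos {z a b : Pt} (h : 0 < det2 (b - a) (z - a)) :
    0 < ang z a b ∧ ang z a b < Real.pi := by
  rw [← angNum_im] at h
  have h0 := Complex.arg_nonneg_iff.2 h.le
  have h1 := Complex.arg_le_pi (angNum z a b)
  refine ⟨lt_of_le_of_ne h0 fun h2 => ?_, lt_of_le_of_ne h1 fun h2 => ?_⟩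
  · exact h.ne' (Complex.arg_eq_zero_iff.1 h2.symm).2
  · exact h.ne' (Complex.arg_eq_pi_iff.1 h2).2

lemma ang_triangle_inside {z a b c : Pt} (h1 : 0 < det2 (b - a) (z - a))
    (h2 : 0 < det2 (c - b) (z - b)) (h3 : 0 < det2 (a - c) (z - c)) :
    ang z a b + ang z b c + ang z c a = 2 * Real.pi := by
  have ha : a ≠ z := by rintro rfl; simp at h1
  have hb : b ≠ z := by rintro rfl; simp at h2
  have hc : c ≠ z := by rintro rfl; simp at h3
  obtain ⟨p1, q1⟩ := ang_pos h1
  obtain ⟨p2, q2⟩ := ang_pos h2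
  obtain ⟨p3, q3⟩ := ang_pos h3
  have := eq_add_two_pi_of_coe (x := ang z a b + ang z b c + ang z c a) (y := 0)
    (by simp only [Real.Angle.coe_add, ang_coe ha hb, ang_coe hb hc, ang_coe hc ha]; abel)
    (by simp) (by linarith) (by linarith)
  linarith

/-- A continuous function with values in `2πℤ` is constant on a preconnected set. -/
lemma const_of_coe_eq_zero {X : Type*} [TopologicalSpace X] {f : X → ℝ} {s : Set X}
    (hs : IsPreconnected s) (hf : ContinuousOn f s)
    (h0 : ∀ x ∈ s, (f x : Real.Angle) = 0) {x y : X} (hx : x ∈ s) (hy : y ∈ s) : f x = f y := by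
  wlog hlt : f x < f y generalizing x y
  · rcases eq_or_lt_of_le (not_lt.1 hlt) with h | h
    · exact h.symm
    · exact (this hy hx h).symm
  exfalso
  have hp := Real.pi_pos
  by_cases h4 : f y - f x < 4 * Real.pi
  · have h := eq_add_two_pi_of_coe (h0 y hy) (h0 x hx) (by linarith) h4
    obtain ⟨w, hw, hw'⟩ := hs.intermediate_value hx hy hf
      (show f x + Real.pi ∈ Set.Icc _ _ from ⟨by linarith, by linarith⟩)
    have := h0 w hw
    rw [hw', Real.Angle.coe_add, h0 x hx, zero_add] at this
    exact Real.Angle.pi_ne_zero this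
  · obtain ⟨w, hw, hw'⟩ := hs.intermediate_value hx hy hf
      (show f x + Real.pi ∈ Set.Icc _ _ from ⟨by linarith, by linarith⟩)
    have := h0 w hw
    rw [hw', Real.Angle.coe_add, h0 x hx, zero_add] at this
    exact Real.Angle.pi_ne_zero this

lemma sum_ang_coe (v : ℕ → Pt) (z : Pt) {m n : ℕ} (hmn : m ≤ n)
    (h : ∀ i, m ≤ i → i ≤ n → v i ≠ z) :
    ((∑ i ∈ Finset.Ico m n, ang z (v i) (v (i + 1)) : ℝ) : Real.Angle) =
      ((cx (v n - z)).arg : Real.Angle) - (cx (v m - z)).arg := by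
  induction n, hmn using Nat.le_induction with
  | base => simp
  | succ n hmn ih =>
    rw [Finset.sum_Ico_succ_top hmn, Real.Angle.coe_add,
      ih fun i hi hi' => h i hi (by omega), ang_coe (h n hmn (by omega)) (h _ (by omega) le_rfl)]
    abel

/-- The total angle under which `z` sees the chain `v 0, …, v n`. -/
def wind (v : ℕ → Pt) (n : ℕ) (z : Pt) : ℝ := ∑ i ∈ Finset.range n, ang z (v i) (v (i + 1))

lemma ne_of_notMem_segment {z a b : Pt} (h : z ∉ segment ℝ a b) : a ≠ z ∧ b ≠ z :=
  ⟨fun e => h (e ▸ left_mem_segment ℝ a b), fun e => h (e ▸ right_mem_segment ℝ a b)⟩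

lemma wind_coe {v : ℕ → Pt} {n : ℕ} (hv : v n = v 0) {z : Pt} (h : ∀ i ≤ n, v i ≠ z) :
    (wind v n z : Real.Angle) = 0 := by
  rw [wind, ← Nat.Ico_zero_eq_range, sum_ang_coe v z (Nat.zero_le n) fun i _ hi => h i hi, hv,
    sub_self]

lemma continuousAt_wind {v : ℕ → Pt} {n : ℕ} {z : Pt}
    (h : ∀ i < n, z ∉ segment ℝ (v i) (v (i + 1))) : ContinuousAt (wind v n) z := by
  unfold wind
  exact tendsto_finsetSum _ fun i hi => continuousAt_ang (h i (Finset.mem_range.1 hi))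

lemma ne_of_notMem_edges {v : ℕ → Pt} {n : ℕ} (hn : 0 < n) {z : Pt}
    (h : ∀ i < n, z ∉ segment ℝ (v i) (v (i + 1))) : ∀ i ≤ n, v i ≠ z := by
  intro i hi
  rcases Nat.lt_or_ge i n with h1 | h1
  · exact (ne_of_notMem_segment (h i h1)).1
  · have := (ne_of_notMem_segment (h (n - 1) (by omega))).2
    rwa [show n - 1 + 1 = i by omega] at this

lemma wind_const {v : ℕ → Pt} {n : ℕ} (hn : 0 < n) (hv : v n = v 0) {s : Set Pt}
    (hs : IsPreconnected s) (h : ∀ z ∈ s, ∀ i < n, z ∉ segment ℝ (v i) (v (i + 1))) {x y : Pt}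
    (hx : x ∈ s) (hy : y ∈ s) : wind v n x = wind v n y :=
  const_of_coe_eq_zero hs (fun z hz => (continuousAt_wind (h z hz)).continuousWithinAt)
    (fun z hz => wind_coe hv (ne_of_notMem_edges hn (h z hz))) hx hy

/-- The chain winds zero times around points outside a closed convex set containing it. -/
lemma wind_eq_zero_of_convex {v : ℕ → Pt} {n : ℕ} (hv : v n = v 0) {K : Set Pt}
    (hK : Convex ℝ K) (hc : IsClosed K) (h : ∀ i ≤ n, v i ∈ K) {z : Pt} (hz : z ∉ K) :
    wind v n z = 0 := by
  obtain ⟨u, hu⟩ := exists_det2_pos hK hc hz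
  set g : Pt → ℝ := fun a => Complex.arg ⟨det2 u (a - z), -dot2 u (a - z)⟩
  have : wind v n z = ∑ i ∈ Finset.range n, (g (v (i + 1)) - g (v i)) :=
    Finset.sum_congr rfl fun i hi => ang_eq_sub (hu _ (h i (Finset.mem_range.1 hi).le))
      (hu _ (h (i + 1) (Finset.mem_range.1 hi)))
  rw [this, Finset.sum_range_sub (fun i => g (v i)), hv, sub_self]

namespace SimplePolygon
variable (P : SimplePolygon)

/-- The `i`-th closed edge. -/
def edge (i : ℕ) : Set Pt := segment ℝ (P.vtx i) (P.vtx (i + 1))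

lemma vtx_mod (i : ℕ) : P.vtx (i % P.n) = P.vtx i :=
  Function.Periodic.map_mod_nat P.periodic i

lemma n_pos : 0 < P.n := by have := P.three_le; omega

lemma vtx_eq_iff {i j : ℕ} : P.vtx i = P.vtx j ↔ i % P.n = j % P.n := by
  rw [← P.vtx_mod i, ← P.vtx_mod j]
  exact ⟨P.inj _ (Nat.mod_lt _ P.n_pos) _ (Nat.mod_lt _ P.n_pos), fun h => by rw [h]⟩

lemma edge_mod (i : ℕ) : P.edge (i % P.n) = P.edge i := by
  have : P.vtx (i % P.n + 1) = P.vtx (i + 1) := by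
    rw [P.vtx_eq_iff]; simp
  rw [edge, edge, this, vtx_mod]

lemma edge_subset_boundary (i : ℕ) : P.edge i ⊆ P.boundary := by
  intro x hx
  rw [← P.edge_mod] at hx
  simp only [boundary, Set.mem_iUnion, Finset.mem_range]
  exact ⟨_, Nat.mod_lt _ P.n_pos, hx⟩

lemma mem_boundary {x : Pt} : x ∈ P.boundary ↔ ∃ i < P.n, x ∈ P.edge i := by
  simp [boundary, edge]

lemma vtx_mem_edge (i : ℕ) : P.vtx i ∈ P.edge i := left_mem_segment ℝ _ _
lemma vtx_succ_mem_edge (i : ℕ) : P.vtx (i + 1) ∈ P.edge i := right_mem_segment ℝ _ _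

lemma isClosed_edge (i : ℕ) : IsClosed (P.edge i) := isClosed_segment _ _

lemma isClosed_boundary : IsClosed P.boundary := by
  unfold boundary
  exact (Finset.range P.n).finite_toSet.isClosed_biUnion fun i _ => isClosed_segment _ _

lemma isBounded_boundary : Bornology.IsBounded P.boundary := by
  unfold boundary
  refine (Bornology.isBounded_biUnion (Finset.range P.n).finite_toSet).2 fun i _ => ?_
  rw [segment_eq_image]
  exact (isCompact_Icc.image (by fun_prop)).isBounded

lemma succ_mod_ne (i : ℕ) : i % P.n ≠ (i + 1) % P.n := by
  have := P.three_le
  intro h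
  have : i ≡ i + 1 [MOD P.n] := h
  have h2 := (Nat.modEq_iff_dvd' (Nat.le_succ i)).1 this
  have := Nat.le_of_dvd (by omega) h2
  omega

lemma vtx_ne_succ (i : ℕ) : P.vtx i ≠ P.vtx (i + 1) := by
  rw [Ne, vtx_eq_iff]; exact P.succ_mod_ne i

/-- Two different edges through a common point are the two edges at a vertex. -/
lemma exists_vtx_of_mem_edges {x : Pt} {i j : ℕ} (hi : x ∈ P.edge i) (hj : x ∈ P.edge j)
    (hij : i % P.n ≠ j % P.n) : ∃ k, x = P.vtx (k + 1) ∧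
      (i % P.n = k % P.n ∧ j % P.n = (k + 1) % P.n ∨
        j % P.n = k % P.n ∧ i % P.n = (k + 1) % P.n) := by
  set N : Set ℕ := {i | i < P.n ∧ x ∈ segment ℝ (P.vtx i) (P.vtx (i + 1))} with hN
  have hfin : N.Finite := (Set.finite_lt_nat P.n).subset fun i hi => hi.1
  have hmem : ∀ i, x ∈ P.edge i → i % P.n ∈ N := fun i hi =>
    ⟨Nat.mod_lt _ P.n_pos, by rw [← P.edge_mod] at hi; exact hi⟩
  have hpair : ∀ {a b}, a ∈ N → b ∈ N → a ≠ b → N = {a, b} ∧ N.ncard = 2 := by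
    intro a b ha hb hab
    have h2 : ({a, b} : Set ℕ).ncard = 2 := Set.ncard_pair hab
    have hsub : ({a, b} : Set ℕ) ⊆ N := by
      rintro c (rfl | rfl) <;> assumption
    have := Set.eq_of_subset_of_ncard_le hsub (by rw [h2]; exact P.simple x) hfin
    exact ⟨this.symm, by rw [← this, h2]⟩
  obtain ⟨hN1, hN2⟩ := hpair (hmem i hi) (hmem j hj) hij
  obtain ⟨l, hl, hx⟩ := P.vtx_of_two x hN2
  refine ⟨l + P.n - 1, ?_, ?_⟩
  · rw [show l + P.n - 1 + 1 = l + P.n by omega, P.periodic, hx]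
  have e1 : x ∈ P.edge (l + P.n - 1) := by
    rw [hx, ← P.periodic, show l + P.n = l + P.n - 1 + 1 by omega]
    exact P.vtx_succ_mem_edge _
  have e2 : x ∈ P.edge (l + P.n - 1 + 1) := by
    rw [hx, ← P.periodic, show l + P.n = l + P.n - 1 + 1 by omega]
    exact P.vtx_mem_edge _
  have m1 := hmem _ e1
  have m2 := hmem _ e2
  have := P.succ_mod_ne (l + P.n - 1)
  rw [hN1] at m1 m2
  rcases m1 with m1 | m1 <;> rcases m2 with m2 | m2 <;> simp_all

lemma vtx_mem_edge_iff {i k : ℕ} (h : P.vtx (i + 1) ∈ P.edge k) :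
    k % P.n = i % P.n ∨ k % P.n = (i + 1) % P.n := by
  by_contra hcon
  push Not at hcon
  obtain ⟨l, hl, hl'⟩ := P.exists_vtx_of_mem_edges h (P.vtx_succ_mem_edge i) hcon.1
  obtain ⟨m, hm, hm'⟩ := P.exists_vtx_of_mem_edges h (P.vtx_mem_edge (i + 1)) hcon.2
  rw [P.vtx_eq_iff] at hl hm
  have key : ∀ a b, (a + 1) % P.n = (b + 1) % P.n → a % P.n = b % P.n := fun a b h =>
    Nat.ModEq.add_right_cancel' 1 h
  have h1 := key _ _ hl
  have h2 := key _ _ hm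
  have := P.succ_mod_ne i
  rcases hl' with hl' | hl' <;> rcases hm' with hm' | hm' <;> simp_all

lemma vtx_notMem_openSegment {i : ℕ} {x : Pt}
    (hx : x ∈ openSegment ℝ (P.vtx i) (P.vtx (i + 1))) : x ≠ P.vtx i ∧ x ≠ P.vtx (i + 1) := by
  have hne := P.vtx_ne_succ i
  constructor
  · rintro rfl
    exact hne (left_mem_openSegment_iff.1 hx)
  · rintro rfl
    exact hne (right_mem_openSegment_iff.1 hx)

lemma mem_edge_of_openSegment {i k : ℕ} {x : Pt}
    (hx : x ∈ openSegment ℝ (P.vtx i) (P.vtx (i + 1))) (hk : x ∈ P.edge k) :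
    k % P.n = i % P.n := by
  by_contra hcon
  obtain ⟨l, hl, hl'⟩ := P.exists_vtx_of_mem_edges hk (openSegment_subset_segment ℝ _ _ hx) hcon
  obtain ⟨h1, h2⟩ := P.vtx_notMem_openSegment hx
  rw [hl, Ne, vtx_eq_iff] at h1 h2
  rcases hl' with hl' | hl'
  · exact h1 hl'.2.symm
  · exact h2 (Nat.ModEq.add_right 1 (show l ≡ i [MOD P.n] from hl'.1.symm))

/-- Around any point the boundary consists of the edges through that point. -/
lemma exists_ball_edges (x : Pt) : ∃ ε > 0, ∀ z ∈ Metric.ball x ε, ∀ k, z ∈ P.edge k →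
    x ∈ P.edge k := by
  have : ∀ᶠ z in nhds x, ∀ k ∈ Finset.range P.n, z ∈ P.edge k → x ∈ P.edge k := by
    rw [Filter.eventually_all_finset]
    intro k _
    by_cases h : x ∈ P.edge k
    · exact Filter.Eventually.of_forall fun _ _ => h
    · filter_upwards [(P.isClosed_edge k).isOpen_compl.mem_nhds h] with z hz hz'
      exact absurd hz' hz
  obtain ⟨ε, hε, h⟩ := Metric.eventually_nhds_iff_ball.1 this
  refine ⟨ε, hε, fun z hz k hk => ?_⟩
  rw [← P.edge_mod] at hk ⊢
  exact h z hz _ (Finset.mem_range.2 (Nat.mod_lt _ P.n_pos)) hk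

end SimplePolygon

/-- Two points lie in a common preconnected subset of `U`. -/
def Linked {X : Type*} [TopologicalSpace X] (U : Set X) (a b : X) : Prop :=
  ∃ s ⊆ U, IsPreconnected s ∧ a ∈ s ∧ b ∈ s

lemma Linked.symm {X : Type*} [TopologicalSpace X] {U : Set X} {a b : X} (h : Linked U a b) :
    Linked U b a := by
  obtain ⟨s, h1, h2, h3, h4⟩ := h
  exact ⟨s, h1, h2, h4, h3⟩

lemma Linked.trans {X : Type*} [TopologicalSpace X] {U : Set X} {a b c : X}
    (h : Linked U a b) (h' : Linked U b c) : Linked U a c := by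
  obtain ⟨s, h1, h2, h3, h4⟩ := h
  obtain ⟨s', h1', h2', h3', h4'⟩ := h'
  exact ⟨s ∪ s', Set.union_subset h1 h1', h2.union b h4 h3' h2', Or.inl h3, Or.inr h4'⟩

lemma Linked.mem_component {X : Type*} [TopologicalSpace X] {U : Set X} {a b : X}
    (h : Linked U a b) : b ∈ connectedComponentIn U a := by
  obtain ⟨s, h1, h2, h3, h4⟩ := h
  exact h2.subset_connectedComponentIn h3 h1 h4

lemma Linked.left_mem {X : Type*} [TopologicalSpace X] {U : Set X} {a b : X}
    (h : Linked U a b) : a ∈ U := by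
  obtain ⟨s, h1, h2, h3, h4⟩ := h
  exact h1 h3

lemma convex_ball_pos (x u : Pt) (ε : ℝ) :
    Convex ℝ (Metric.ball x ε ∩ {z | 0 < det2 u (z - x)}) := by
  refine (convex_ball x ε).inter ?_
  have : {z : Pt | 0 < det2 u (z - x)} = {z | det2 u x < det2L u z} := by
    ext z; simp [det2_sub_right]
  rw [this]
  exact convex_halfSpace_gt (det2L u).isLinear _

lemma convex_pos (x u : Pt) : Convex ℝ {z | 0 < det2 u (z - x)} := by
  have : {z : Pt | 0 < det2 u (z - x)} = {z | det2 u x < det2L u z} := by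
    ext z; simp [det2_sub_right]
  rw [this]
  exact convex_halfSpace_gt (det2L u).isLinear _

/-- Points near `x` strictly on the positive side of a line through `x`. -/
lemma exists_near_pos (x : Pt) {u : Pt} (hu : u ≠ 0) {ε : ℝ} (hε : 0 < ε) :
    ∃ z ∈ Metric.ball x ε, 0 < det2 u (z - x) := by
  have hc : Continuous fun t : ℝ => x + t • rotJ u := by fun_prop
  have h1 : ∀ᶠ t in nhdsWithin (0 : ℝ) (Set.Ioi 0), x + t • rotJ u ∈ Metric.ball x ε := by
    apply (hc.tendsto' 0 x (by simp)).mono_left nhdsWithin_le_nhds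
    exact Metric.ball_mem_nhds x hε
  obtain ⟨t, ht, ht'⟩ := (h1.and self_mem_nhdsWithin).exists
  refine ⟨_, ht, ?_⟩
  rw [add_sub_cancel_left, det2_smul_right]
  exact mul_pos ht' (det2_rotJ_pos hu)

lemma det2_openSegment {a b x : Pt} (hx : x ∈ segment ℝ a b) : det2 (b - a) (x - a) = 0 := by
  obtain ⟨s, t, hs, ht, hst, rfl⟩ := hx
  have hs' : s = 1 - t := by linarith
  subst hs'
  simp [det2]; ring

namespace SimplePolygon
variable (P : SimplePolygon)

/-- The point `z` is linked, off the boundary, to all points near the `i`-th edge on its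
`σ`-side. -/
def SideOf (σ : ℝ) (i : ℕ) (z : Pt) : Prop :=
  ∀ x ∈ openSegment ℝ (P.vtx i) (P.vtx (i + 1)), ∃ ε > 0, ∀ z' ∈ Metric.ball x ε,
    0 < det2 (σ • (P.vtx (i + 1) - P.vtx i)) (z' - x) → Linked P.boundaryᶜ z z'

open scoped Pointwise in
lemma exists_sideOf {σ : ℝ} (i : ℕ) {x : Pt}
    (hx : x ∈ openSegment ℝ (P.vtx i) (P.vtx (i + 1))) :
    ∃ ε > 0, ∀ z ∈ Metric.ball x ε, 0 < det2 (σ • (P.vtx (i + 1) - P.vtx i)) (z - x) →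
      P.SideOf σ i z := by
  set a := P.vtx i
  set b := P.vtx (i + 1)
  set u := σ • (b - a) with hu
  -- a uniform radius for two points of the edge
  have key : ∀ x' ∈ openSegment ℝ a b, ∃ ε > 0, ∀ y ∈ segment ℝ x x', ∀ w : Pt, ‖w‖ < ε →
      0 < det2 u w → y + w ∈ P.boundaryᶜ := by
    intro x' hx'
    set K : Set Pt := ⋃ k ∈ (Finset.range P.n).filter (fun k => k ≠ i % P.n), P.edge k
    have hK : IsClosed K :=
      (Finset.finite_toSet _).isClosed_biUnion fun k _ => P.isClosed_edge k
    have hsub : segment ℝ x x' ⊆ openSegment ℝ a b := (convex_openSegment a b).segment_subset hx hx'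
    have hdisj : Disjoint (segment ℝ x x') K := by
      rw [Set.disjoint_left]
      intro y hy hyK
      simp only [K, Set.mem_iUnion, Finset.mem_filter, Finset.mem_range] at hyK
      obtain ⟨k, ⟨hk, hk'⟩, hyk⟩ := hyK
      have := P.mem_edge_of_openSegment (hsub hy) hyk
      rw [Nat.mod_eq_of_lt hk] at this
      exact hk' this
    have hcomp : IsCompact (segment ℝ x x') := by
      rw [segment_eq_image]; exact isCompact_Icc.image (by fun_prop)
    obtain ⟨ε, hε, hd⟩ := hdisj.exists_thickenings hcomp hK
    refine ⟨ε, hε, fun y hy w hw hpos hmem => ?_⟩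
    obtain ⟨k, hk, hyk⟩ := P.mem_boundary.1 hmem
    by_cases hki : k = i % P.n
    · rw [hki, P.edge_mod] at hyk
      have h1 := det2_openSegment hyk
      have h2 := det2_openSegment (openSegment_subset_segment ℝ _ _ (hsub hy))
      rw [add_sub_right_comm, det2_add_right, h2, zero_add] at h1
      rw [hu, det2_smul_left, h1, mul_zero] at hpos
      exact lt_irrefl _ hpos
    · refine Set.disjoint_left.1 hd (?_ : y + w ∈ _) ?_
      · exact Metric.mem_thickening_iff.2 ⟨y, hy, by simpa [dist_eq_norm] using hw⟩
      · apply Metric.self_subset_thickening hε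
        simp only [K, Set.mem_iUnion, Finset.mem_filter, Finset.mem_range]
        exact ⟨k, ⟨hk, hki⟩, hyk⟩
  obtain ⟨ε₀, hε₀, h₀⟩ := key x hx
  have hball : ∀ z ∈ Metric.ball x ε₀, ∀ z' ∈ Metric.ball x ε₀, 0 < det2 u (z - x) →
      0 < det2 u (z' - x) → Linked P.boundaryᶜ z z' := by
    intro z hz z' hz' h h'
    refine ⟨Metric.ball x ε₀ ∩ {z | 0 < det2 u (z - x)}, ?_, (convex_ball_pos x u ε₀).isPreconnected,
      ⟨hz, h⟩, ⟨hz', h'⟩⟩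
    rintro y ⟨hy, hy'⟩
    have := h₀ x (left_mem_segment ℝ _ _) (y - x) (by simpa [dist_eq_norm] using hy) hy'
    simpa using this
  refine ⟨ε₀, hε₀, fun z hz hpos x' hx' => ?_⟩
  obtain ⟨ε, hε, h⟩ := key x' hx'
  have hu0 : u ≠ 0 := by rintro h; rw [h] at hpos; simp at hpos
  refine ⟨ε, hε, fun z' hz' hpos' => ?_⟩
  obtain ⟨y, hy, hy'⟩ := exists_near_pos x hu0 (lt_min hε hε₀)
  have hy1 : y ∈ Metric.ball x ε := Metric.ball_subset_ball (min_le_left _ _) hy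
  have hy2 : y ∈ Metric.ball x ε₀ := Metric.ball_subset_ball (min_le_right _ _) hy
  refine (hball z hz y hy2 hpos hy').trans ?_
  refine ⟨segment ℝ x x' + (Metric.ball 0 ε ∩ {w | 0 < det2 u w}), ?_, ?_, ?_, ?_⟩
  · rintro _ ⟨p, hp, w, ⟨hw, hw'⟩, rfl⟩
    exact h p hp w (by simpa using hw) hw'
  · have := convex_ball_pos 0 u ε
    simp only [sub_zero] at this
    exact ((convex_segment x x').add this).isPreconnected
  · exact ⟨x, left_mem_segment ℝ _ _, y - x, ⟨by simpa [dist_eq_norm] using hy1, hy'⟩, by simp⟩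
  · exact ⟨x', right_mem_segment ℝ _ _, z' - x', ⟨by simpa [dist_eq_norm] using hz', hpos'⟩,
      by simp⟩

variable {P}

lemma SideOf.linked_trans {σ : ℝ} {i : ℕ} {z z' : Pt} (h : P.SideOf σ i z)
    (hl : Linked P.boundaryᶜ z' z) : P.SideOf σ i z' := fun x hx => by
  obtain ⟨ε, hε, h⟩ := h x hx
  exact ⟨ε, hε, fun w hw hw' => hl.trans (h w hw hw')⟩

lemma SideOf.linked {σ : ℝ} (hσ : σ ≠ 0) {i : ℕ} {z z' : Pt} (h : P.SideOf σ i z)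
    (h' : P.SideOf σ i z') : Linked P.boundaryᶜ z z' := by
  have hx := midpoint_mem_openSegment (𝕜 := ℝ) (P.vtx i) (P.vtx (i + 1))
  obtain ⟨ε, hε, h⟩ := h _ hx
  obtain ⟨ε', hε', h'⟩ := h' _ hx
  have hu : σ • (P.vtx (i + 1) - P.vtx i) ≠ 0 :=
    smul_ne_zero hσ (sub_ne_zero.2 (P.vtx_ne_succ i).symm)
  obtain ⟨y, hy, hy'⟩ := exists_near_pos _ hu (lt_min hε hε')
  exact (h y (Metric.ball_subset_ball (min_le_left _ _) hy) hy').trans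
    (h' y (Metric.ball_subset_ball (min_le_right _ _) hy) hy').symm

end SimplePolygon

lemma exists_small_smul (x u : Pt) {U : Set Pt} (hU : U ∈ nhds x) :
    ∃ s : ℝ, 0 < s ∧ s < 1 ∧ x + s • u ∈ U := by
  have hc : Continuous fun t : ℝ => x + t • u := by fun_prop
  have h1 : ∀ᶠ t in nhdsWithin (0 : ℝ) (Set.Ioi 0), x + t • u ∈ U :=
    ((hc.tendsto' 0 x (by simp)).mono_left nhdsWithin_le_nhds) hU
  have h2 : ∀ᶠ t in nhdsWithin (0 : ℝ) (Set.Ioi 0), t < 1 :=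
    nhdsWithin_le_nhds (gt_mem_nhds one_pos)
  obtain ⟨t, ⟨ht, ht1⟩, ht'⟩ := ((h1.and h2).and self_mem_nhdsWithin).exists
  exact ⟨t, ht', ht1, ht⟩

namespace SimplePolygon
variable {P : SimplePolygon}

lemma sideOf_of_near {σ : ℝ} {i : ℕ} {x z : Pt} {C : Set Pt} (hσ : σ ≠ 0)
    (hx : x ∈ openSegment ℝ (P.vtx i) (P.vtx (i + 1))) (hC : IsPreconnected C)
    (hCb : C ⊆ P.boundaryᶜ) (hz : z ∈ C) {U : Set Pt} (hU : U ∈ nhds x)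
    (h : ∀ z' ∈ U, 0 < det2 (σ • (P.vtx (i + 1) - P.vtx i)) (z' - x) → z' ∈ C) :
    P.SideOf σ i z := by
  obtain ⟨ε, hε, hs⟩ := P.exists_sideOf (σ := σ) i hx
  obtain ⟨δ, hδ, hδU⟩ := Metric.mem_nhds_iff.1 hU
  have hu : σ • (P.vtx (i + 1) - P.vtx i) ≠ 0 :=
    smul_ne_zero hσ (sub_ne_zero.2 (P.vtx_ne_succ i).symm)
  obtain ⟨y, hy, hy'⟩ := exists_near_pos x hu (lt_min hε hδ)
  exact (hs y (Metric.ball_subset_ball (min_le_left _ _) hy) hy').linked_trans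
    ⟨C, hCb, hC, hz, h y (hδU (Metric.ball_subset_ball (min_le_right _ _) hy)) hy'⟩

lemma sideOf_vertex {σ : ℝ} (i : ℕ)
    (hσ : 0 < σ * det2 (P.vtx (i + 1) - P.vtx i) (P.vtx (i + 2) - P.vtx (i + 1))) :
    ∃ ε > 0,
      (∀ z ∈ Metric.ball (P.vtx (i + 1)) ε,
        0 < det2 (σ • (P.vtx (i + 1) - P.vtx i)) (z - P.vtx (i + 1)) →
        0 < det2 (σ • (P.vtx (i + 2) - P.vtx (i + 1))) (z - P.vtx (i + 1)) →
        P.SideOf σ i z ∧ P.SideOf σ (i + 1) z) ∧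
      (∀ z ∈ Metric.ball (P.vtx (i + 1)) ε,
        (0 < det2 ((-σ) • (P.vtx (i + 1) - P.vtx i)) (z - P.vtx (i + 1)) ∨
          0 < det2 ((-σ) • (P.vtx (i + 2) - P.vtx (i + 1))) (z - P.vtx (i + 1))) →
        P.SideOf (-σ) i z ∧ P.SideOf (-σ) (i + 1) z) := by
  set v := P.vtx (i + 1) with hv
  set d := P.vtx (i + 1) - P.vtx i with hd
  set e := P.vtx (i + 2) - P.vtx (i + 1) with he
  have hσ0 : σ ≠ 0 := by rintro rfl; simp at hσ
  have hedge : P.vtx i = v - d := by rw [hd, hv]; abel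
  have hedge' : P.vtx (i + 1 + 1) = v + e := by rw [he, hv]; simp
  obtain ⟨ε, hε, hball⟩ := P.exists_ball_edges v
  have hbd : ∀ z ∈ Metric.ball v ε, z ∈ P.boundary →
      (det2 d (z - v) = 0 ∧ 0 ≤ σ * det2 e (z - v)) ∨
      (det2 e (z - v) = 0 ∧ 0 ≤ σ * det2 d (z - v)) := by
    intro z hz hzb
    obtain ⟨k, -, hk⟩ := P.mem_boundary.1 hzb
    rcases P.vtx_mem_edge_iff (hball z hz k hk) with h | h
    · left
      rw [← P.edge_mod, h, P.edge_mod] at hk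
      obtain ⟨s, t, hs, ht, hst, rfl⟩ := hk
      rw [hedge, ← hv]
      have : s • (v - d) + t • v - v = (-s) • d := by
        rw [← eq_sub_iff_add_eq'] at hst; subst hst; module
      rw [this, det2_smul_right, det2_smul_right, det2_self, det2_swap e d]
      exact ⟨by simp, by nlinarith⟩
    · right
      rw [← P.edge_mod, h, P.edge_mod] at hk
      obtain ⟨s, t, hs, ht, hst, rfl⟩ := hk
      rw [hedge', ← hv]
      have : s • v + t • (v + e) - v = t • e := by
        rw [← eq_sub_iff_add_eq] at hst; subst hst; module
      rw [this, det2_smul_right, det2_smul_right, det2_self]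
      exact ⟨by simp, by nlinarith⟩
  -- points of the two edges near the vertex
  obtain ⟨s, hs0, hs1, hsU⟩ := exists_small_smul v (-d) (Metric.ball_mem_nhds v hε)
  obtain ⟨t, ht0, ht1, htU⟩ := exists_small_smul v e (Metric.ball_mem_nhds v hε)
  have hx : v + s • -d ∈ openSegment ℝ (P.vtx i) (P.vtx (i + 1)) := by
    rw [hedge, ← hv]
    exact ⟨s, 1 - s, hs0, by linarith, by ring, by module⟩
  have hy : v + t • e ∈ openSegment ℝ (P.vtx (i + 1)) (P.vtx (i + 1 + 1)) := by
    rw [hedge', ← hv]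
    exact ⟨1 - t, t, by linarith, ht0, by ring, by module⟩
  have hxd : ∀ (c : ℝ) (z : Pt), det2 (c • d) (z - (v + s • -d)) = det2 (c • d) (z - v) := by
    intro c z
    simp only [det2_smul_left, det2_sub_right, det2_add_right, det2_smul_right, det2_neg_right,
      det2_self]; ring
  have hye : ∀ (c : ℝ) (z : Pt), det2 (c • e) (z - (v + t • e)) = det2 (c • e) (z - v) := by
    intro c z
    simp only [det2_smul_left, det2_sub_right, det2_add_right, det2_smul_right, det2_self]; ring
  have hdi : P.vtx (i + 1) - P.vtx i = d := rfl
  have hei : P.vtx (i + 1 + 1) - P.vtx (i + 1) = e := rfl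
  refine ⟨ε, hε, fun z hz h1 h2 => ?_, ?_⟩
  · set C := Metric.ball v ε ∩ {z | 0 < det2 (σ • d) (z - v)} ∩
      ({z | 0 < det2 (σ • e) (z - v)})
    have hC : IsPreconnected C :=
      ((convex_ball_pos v _ ε).inter (convex_pos v _)).isPreconnected
    have hCb : C ⊆ P.boundaryᶜ := by
      rintro z ⟨⟨hz, hz1⟩, hz2⟩ hzb
      simp only [Set.mem_ofPred_eq, det2_smul_left] at hz1 hz2
      rcases hbd z hz hzb with h | h
      · rw [h.1] at hz1; simp at hz1
      · rw [h.1] at hz2; simp at hz2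
    constructor
    · refine sideOf_of_near hσ0 hx hC hCb ⟨⟨hz, h1⟩, h2⟩
        (U := Metric.ball v ε ∩ {z | 0 < det2 (σ • e) (z - v)}) ?_ ?_
      · refine (Metric.isOpen_ball.inter (isOpen_lt (by fun_prop) (by fun_prop))).mem_nhds
          ⟨hsU, ?_⟩
        simp only [Set.mem_ofPred_eq, add_sub_cancel_left, det2_smul_right, det2_neg_right,
          det2_smul_left]
        rw [det2_swap e d]
        nlinarith
      · rintro z' ⟨hz', hz''⟩ hpos
        rw [hdi, hxd] at hpos
        exact ⟨⟨hz', hpos⟩, hz''⟩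
    · refine sideOf_of_near hσ0 hy hC hCb ⟨⟨hz, h1⟩, h2⟩
        (U := Metric.ball v ε ∩ {z | 0 < det2 (σ • d) (z - v)}) ?_ ?_
      · refine (Metric.isOpen_ball.inter (isOpen_lt (by fun_prop) (by fun_prop))).mem_nhds
          ⟨htU, ?_⟩
        simp only [Set.mem_ofPred_eq, add_sub_cancel_left, det2_smul_right,
          det2_smul_left]
        nlinarith
      · rintro z' ⟨hz', hz''⟩ hpos
        rw [hei, hye] at hpos
        exact ⟨⟨hz', hz''⟩, hpos⟩
  · set C₁ := Metric.ball v ε ∩ {z | 0 < det2 ((-σ) • d) (z - v)} with hC₁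
    set C₂ := Metric.ball v ε ∩ {z | 0 < det2 ((-σ) • e) (z - v)} with hC₂
    have hb₁ : C₁ ⊆ P.boundaryᶜ := by
      rintro z ⟨hz, hz1⟩ hzb
      simp only [Set.mem_ofPred_eq, det2_smul_left] at hz1
      rcases hbd z hz hzb with h | h
      · rw [h.1] at hz1; simp at hz1
      · linarith
    have hb₂ : C₂ ⊆ P.boundaryᶜ := by
      rintro z ⟨hz, hz1⟩ hzb
      simp only [Set.mem_ofPred_eq, det2_smul_left] at hz1
      rcases hbd z hz hzb with h | h
      · linarith
      · rw [h.1] at hz1; simp at hz1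
    obtain ⟨r, hr0, hr1, hrU⟩ := exists_small_smul v (d - e) (Metric.ball_mem_nhds v hε)
    have hC : IsPreconnected (C₁ ∪ C₂) := by
      refine IsPreconnected.union (v + r • (d - e)) ⟨hrU, ?_⟩ ⟨hrU, ?_⟩
        (convex_ball_pos v _ ε).isPreconnected (convex_ball_pos v _ ε).isPreconnected
      · rw [Set.mem_ofPred_eq, add_sub_cancel_left, det2_smul_right, det2_smul_left,
          det2_sub_right, det2_self]
        nlinarith
      · rw [Set.mem_ofPred_eq, add_sub_cancel_left, det2_smul_right, det2_smul_left,
          det2_sub_right, det2_self, det2_swap e d]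
        nlinarith
    intro z hz hpos
    have hzC : z ∈ C₁ ∪ C₂ := hpos.imp (fun h => ⟨hz, h⟩) (fun h => ⟨hz, h⟩)
    constructor
    · refine sideOf_of_near (neg_ne_zero.2 hσ0) hx hC (Set.union_subset hb₁ hb₂) hzC
        (U := Metric.ball v ε) (Metric.isOpen_ball.mem_nhds hsU) fun z' hz' hp => Or.inl ⟨hz', ?_⟩
      rwa [hdi, hxd] at hp
    · refine sideOf_of_near (neg_ne_zero.2 hσ0) hy hC (Set.union_subset hb₁ hb₂) hzC
        (U := Metric.ball v ε) (Metric.isOpen_ball.mem_nhds htU) fun z' hz' hp => Or.inr ⟨hz', ?_⟩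
      rwa [hei, hye] at hp

end SimplePolygon

namespace SimplePolygon
variable {P : SimplePolygon}

/-- No three consecutive vertices are collinear. -/
def Nondegenerate (P : SimplePolygon) : Prop :=
  ∀ i, det2 (P.vtx (i + 1) - P.vtx i) (P.vtx (i + 2) - P.vtx (i + 1)) ≠ 0

lemma SideOf.succ (hP : P.Nondegenerate) {σ : ℝ} (hσ : σ ≠ 0) {i : ℕ} {z : Pt}
    (h : P.SideOf σ i z) : P.SideOf σ (i + 1) z := by
  suffices ∃ y, P.SideOf σ i y ∧ P.SideOf σ (i + 1) y by
    obtain ⟨y, h1, h2⟩ := this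
    exact h2.linked_trans (h.linked hσ h1)
  rcases lt_or_gt_of_ne (mul_ne_zero hσ (hP i)) with hneg | hpos
  · obtain ⟨ε, hε, -, h2⟩ := sideOf_vertex (σ := -σ) i (by linarith)
    rw [neg_neg] at h2
    obtain ⟨y, hy, hy'⟩ := exists_near_pos (P.vtx (i + 1))
      (smul_ne_zero hσ (sub_ne_zero.2 (P.vtx_ne_succ i).symm)) hε
    exact ⟨y, h2 y hy (Or.inl hy')⟩
  · obtain ⟨ε, hε, h1, -⟩ := sideOf_vertex i hpos
    obtain ⟨s, hs0, hs1, hsU⟩ := exists_small_smul (P.vtx (i + 1))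
      ((P.vtx (i + 2) - P.vtx (i + 1)) - (P.vtx (i + 1) - P.vtx i)) (Metric.ball_mem_nhds _ hε)
    refine ⟨_, h1 _ hsU ?_ ?_⟩
    · rw [add_sub_cancel_left, det2_smul_left, det2_smul_right,
        det2_sub_right _ (P.vtx (i + 2) - P.vtx (i + 1)), det2_self]
      nlinarith
    · rw [add_sub_cancel_left, det2_smul_left, det2_smul_right,
        det2_sub_right _ (P.vtx (i + 2) - P.vtx (i + 1)), det2_self,
        det2_swap (P.vtx (i + 2) - P.vtx (i + 1))]
      nlinarith

lemma SideOf.of_le (hP : P.Nondegenerate) {σ : ℝ} (hσ : σ ≠ 0) {i j : ℕ} (hij : i ≤ j) {z : Pt}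
    (h : P.SideOf σ i z) : P.SideOf σ j z := by
  induction j, hij using Nat.le_induction with
  | base => exact h
  | succ j _ ih => exact ih.succ hP hσ

/-- Every point off the boundary lies on one of the two sides of the boundary curve. -/
lemma sideOf_or (hP : P.Nondegenerate) {z : Pt} (hz : z ∈ P.boundaryᶜ) :
    P.SideOf 1 (2 * P.n) z ∨ P.SideOf (-1) (2 * P.n) z := by
  have hne : P.boundary.Nonempty := ⟨_, P.edge_subset_boundary 0 (P.vtx_mem_edge 0)⟩
  obtain ⟨x, hxb, hxd⟩ := P.isClosed_boundary.exists_infDist_eq_dist hne z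
  have hxz : z ≠ x := by rintro rfl; exact hz hxb
  have hfree : ∀ s : ℝ, 0 < s → s < 1 → Linked P.boundaryᶜ z (x + s • (z - x)) := by
    intro s hs0 hs1
    refine ⟨segment ℝ z (x + s • (z - x)), ?_, (convex_segment _ _).isPreconnected,
      left_mem_segment ℝ _ _, right_mem_segment ℝ _ _⟩
    rintro y ⟨a, b, ha, hb, hab, rfl⟩ hy
    have h1 := Metric.infDist_le_dist_of_mem (x := z) hy
    rw [hxd, ← eq_sub_iff_add_eq] at *
    subst hab
    have h2 : z - ((1 - b) • z + b • (x + s • (z - x))) = (b * (1 - s)) • (z - x) := by module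
    rw [dist_eq_norm, dist_eq_norm, h2, norm_smul, Real.norm_of_nonneg
      (mul_nonneg hb (by linarith))] at h1
    have h3 : 0 < ‖z - x‖ := norm_pos_iff.2 (sub_ne_zero.2 hxz)
    have h4 : b * (1 - s) ≤ 1 - s := by nlinarith
    nlinarith
  have hopen : IsOpen P.boundaryᶜ := P.isClosed_boundary.isOpen_compl
  -- perturbing a point in the complement of the boundary
  have hpert : ∀ y ∈ P.boundaryᶜ, ∀ U ∈ nhds y, ∀ w : Pt, ∃ s : ℝ, 0 < s ∧ y + s • w ∈ U ∧
      Linked P.boundaryᶜ y (y + s • w) := by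
    intro y hy U hU w
    obtain ⟨δ, hδ, hb⟩ := Metric.isOpen_iff.1 hopen y hy
    obtain ⟨s, hs0, -, hsU⟩ := exists_small_smul y w
      (Filter.inter_mem hU (Metric.ball_mem_nhds y hδ))
    exact ⟨s, hs0, hsU.1, _, hb, (convex_ball y δ).isPreconnected, Metric.mem_ball_self hδ, hsU.2⟩
  obtain ⟨k, hkn, hk⟩ := P.mem_boundary.1 hxb
  by_cases hv : ∃ i ≤ 2 * P.n, x = P.vtx (i + 1) ∧ i + 1 ≤ 2 * P.n
  · obtain ⟨i, -, rfl, hi⟩ := hv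
    obtain ⟨σ, hσ, hσd⟩ : ∃ σ : ℝ, (σ = 1 ∨ σ = -1) ∧
        0 < σ * det2 (P.vtx (i + 1) - P.vtx i) (P.vtx (i + 2) - P.vtx (i + 1)) := by
      rcases lt_or_gt_of_ne (hP i) with h | h
      · exact ⟨-1, Or.inr rfl, by linarith⟩
      · exact ⟨1, Or.inl rfl, by linarith⟩
    have hσ0 : σ ≠ 0 := by rintro rfl; simp at hσd
    suffices P.SideOf σ i z ∨ P.SideOf (-σ) i z by
      have := this.imp (SideOf.of_le hP hσ0 (show i ≤ 2 * P.n by omega))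
        (SideOf.of_le hP (neg_ne_zero.2 hσ0) (show i ≤ 2 * P.n by omega))
      rcases hσ with rfl | rfl
      · exact this
      · rw [neg_neg] at this; exact this.symm
    obtain ⟨ε, hε, h1, h2⟩ := sideOf_vertex i hσd
    set d := P.vtx (i + 1) - P.vtx i
    set e := P.vtx (i + 2) - P.vtx (i + 1)
    obtain ⟨s, hs0, hs1, hsU⟩ := exists_small_smul (P.vtx (i + 1)) (z - P.vtx (i + 1))
      (Metric.ball_mem_nhds _ hε)
    have hl := hfree s hs0 hs1
    set y := P.vtx (i + 1) + s • (z - P.vtx (i + 1)) with hy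
    have hyb : y ∈ P.boundaryᶜ := hl.symm.left_mem
    suffices P.SideOf σ i y ∨ P.SideOf (-σ) i y from
      this.imp (·.linked_trans hl) (·.linked_trans hl)
    simp only [det2_smul_left] at h1 h2
    by_cases hA : 0 < -σ * det2 d (y - P.vtx (i + 1))
    · exact Or.inr (h2 y hsU (Or.inl hA)).1
    by_cases hB : 0 < -σ * det2 e (y - P.vtx (i + 1))
    · exact Or.inr (h2 y hsU (Or.inr hB)).1
    by_cases hA' : 0 < σ * det2 d (y - P.vtx (i + 1))
    · by_cases hB' : 0 < σ * det2 e (y - P.vtx (i + 1))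
      · exact Or.inl (h1 y hsU hA' hB').1
      · obtain ⟨r, hr0, hrU, hrl⟩ := hpert y hyb _ (Metric.isOpen_ball.mem_nhds hsU) d
        refine Or.inr ((h2 _ hrU (Or.inr ?_)).1.linked_trans hrl)
        rw [add_sub_right_comm, det2_add_right, det2_smul_right, det2_swap e d]
        nlinarith
    · obtain ⟨r, hr0, hrU, hrl⟩ := hpert y hyb _ (Metric.isOpen_ball.mem_nhds hsU) (-e)
      refine Or.inr ((h2 _ hrU (Or.inl ?_)).1.linked_trans hrl)
      rw [add_sub_right_comm, det2_add_right, det2_smul_right, det2_neg_right]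
      nlinarith
  · have hxo : x ∈ openSegment ℝ (P.vtx k) (P.vtx (k + 1)) := by
      rw [edge, ← insert_endpoints_openSegment] at hk
      rcases hk with h | h | h
      · refine absurd ⟨k + P.n - 1, by omega, ?_, by omega⟩ hv
        rw [show k + P.n - 1 + 1 = k + P.n by omega, P.periodic, h]
      · exact absurd ⟨k, by omega, h, by omega⟩ hv
      · exact h
    suffices P.SideOf 1 k z ∨ P.SideOf (-1) k z from
      this.imp (SideOf.of_le hP one_ne_zero (show k ≤ 2 * P.n by omega))
        (SideOf.of_le hP (neg_ne_zero.2 one_ne_zero) (show k ≤ 2 * P.n by omega))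
    obtain ⟨ε, hε, h1⟩ := P.exists_sideOf (σ := 1) k hxo
    obtain ⟨ε', hε', h2⟩ := P.exists_sideOf (σ := -1) k hxo
    obtain ⟨s, hs0, hs1, hsU⟩ := exists_small_smul x (z - x)
      (Filter.inter_mem (Metric.ball_mem_nhds x hε) (Metric.ball_mem_nhds x hε'))
    have hl := hfree s hs0 hs1
    set y := x + s • (z - x)
    have hyb : y ∈ P.boundaryᶜ := hl.symm.left_mem
    suffices P.SideOf 1 k y ∨ P.SideOf (-1) k y from
      this.imp (·.linked_trans hl) (·.linked_trans hl)
    set d := P.vtx (k + 1) - P.vtx k with hd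
    rcases lt_trichotomy (det2 d (y - x)) 0 with h | h | h
    · right
      apply h2 y hsU.2
      rw [det2_smul_left]; linarith
    · left
      obtain ⟨r, hr0, hrU, hrl⟩ := hpert y hyb _ (Metric.isOpen_ball.mem_nhds hsU.1) (rotJ d)
      refine (h1 _ hrU ?_).linked_trans hrl
      rw [add_sub_right_comm, det2_smul_left, det2_add_right, det2_smul_right, h, one_mul, zero_add]
      exact mul_pos hr0 (det2_rotJ_pos (sub_ne_zero.2 (P.vtx_ne_succ k).symm))
    · left
      apply h1 y hsU.1
      rw [det2_smul_left]; linarith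

lemma component_eq_of_mem {z w : Pt} (h : w ∈ connectedComponentIn P.boundaryᶜ z) :
    connectedComponentIn P.boundaryᶜ z = connectedComponentIn P.boundaryᶜ w :=
  connectedComponentIn_eq h

lemma interior_of_linked {z w : Pt} (hz : z ∈ P.interior) (h : Linked P.boundaryᶜ z w) :
    w ∈ P.interior := by
  refine ⟨h.symm.left_mem, ?_⟩
  rw [← component_eq_of_mem h.mem_component]
  exact hz.2

lemma exists_notMem_interior (P : SimplePolygon) : ∃ z ∈ P.boundaryᶜ, z ∉ P.interior := by
  obtain ⟨ρ, hρ⟩ := P.isBounded_boundary.subset_ball 0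
  set f : Pt := !₂[1, 0]
  have hf : ‖f‖ = 1 := by simp [f, EuclideanSpace.norm_eq]
  set ray : Set Pt := (fun t : ℝ => t • f) '' Set.Ici (max ρ 0)
  have hray : ray ⊆ P.boundaryᶜ := by
    rintro _ ⟨t, ht, rfl⟩ hb
    have := hρ hb
    rw [mem_ball_zero_iff, norm_smul, hf, mul_one] at this
    have h1 : max ρ 0 ≤ t := ht
    have h2 := le_max_left ρ 0
    have h3 := le_abs_self t
    rw [Real.norm_eq_abs] at this
    linarith
  have hpre : IsPreconnected ray := isPreconnected_Ici.image _ (by fun_prop)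
  have h0 : max ρ 0 • f ∈ ray := ⟨_, Set.self_mem_Ici, rfl⟩
  refine ⟨max ρ 0 • f, hray h0, fun hcon => ?_⟩
  obtain ⟨M, hM⟩ := (hcon.2.subset (hpre.subset_connectedComponentIn h0 hray)).subset_ball 0
  have := hM ⟨max (max ρ 0) M, Set.mem_Ici.2 (le_max_left _ _), rfl⟩
  rw [mem_ball_zero_iff, norm_smul, hf, mul_one, Real.norm_eq_abs] at this
  have h1 := le_abs_self (max (max ρ 0) M)
  have h2 := le_max_right (max ρ 0) M
  linarith

/-- The interior of a nondegenerate simple polygon is connected. -/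
lemma interior_linked (hP : P.Nondegenerate) {z w : Pt} (hz : z ∈ P.interior)
    (hw : w ∈ P.interior) : Linked P.boundaryᶜ z w := by
  obtain ⟨y, hy, hyi⟩ := P.exists_notMem_interior
  have key : ∀ σ : ℝ, σ ≠ 0 → P.SideOf σ (2 * P.n) y → ∀ x ∈ P.interior,
      ¬ P.SideOf σ (2 * P.n) x := fun σ hσ h x hx hx' =>
    hyi (interior_of_linked hx (hx'.linked hσ h))
  have h1 : (1 : ℝ) ≠ 0 := one_ne_zero
  have h2 : (-1 : ℝ) ≠ 0 := neg_ne_zero.2 h1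
  rcases sideOf_or hP hy with h | h
  · exact ((sideOf_or hP hz.1).resolve_left (key _ h1 h z hz)).linked h2
      ((sideOf_or hP hw.1).resolve_left (key _ h1 h w hw))
  · exact ((sideOf_or hP hz.1).resolve_right (key _ h2 h z hz)).linked h1
      ((sideOf_or hP hw.1).resolve_right (key _ h2 h w hw))

lemma isOpen_interior (P : SimplePolygon) : IsOpen P.interior := by
  have hopen : IsOpen P.boundaryᶜ := P.isClosed_boundary.isOpen_compl
  rw [Metric.isOpen_iff]
  intro x hx
  obtain ⟨ε, hε, hb⟩ := Metric.isOpen_iff.1 hopen x hx.1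
  exact ⟨ε, hε, fun y hy => interior_of_linked hx
    ⟨_, hb, (convex_ball x ε).isPreconnected, Metric.mem_ball_self hε, hy⟩⟩

lemma isPreconnected_interior (hP : P.Nondegenerate) : IsPreconnected P.interior := by
  refine isPreconnected_of_forall_pair fun x hx y hy => ?_
  obtain ⟨s, hs, hpre, hxs, hys⟩ := interior_linked hP hx hy
  exact ⟨s, fun w hw => interior_of_linked hx ⟨s, hs, hpre, hxs, hw⟩, hxs, hys, hpre⟩

lemma isBounded_interior (hP : P.Nondegenerate) : Bornology.IsBounded P.interior := by
  rcases P.interior.eq_empty_or_nonempty with h | ⟨x, hx⟩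
  · rw [h]; exact Bornology.isBounded_empty
  · exact hx.2.subset fun w hw => (interior_linked hP hx hw).mem_component

lemma disjoint_interior_boundary (P : SimplePolygon) : Disjoint P.interior P.boundary :=
  Set.disjoint_left.2 fun _ h => h.1

/-- A preconnected set off the boundary meeting the interior is contained in it. -/
lemma subset_interior {s : Set Pt} (hs : IsPreconnected s) (hb : Disjoint s P.boundary)
    {x : Pt} (hx : x ∈ s) (hxi : x ∈ P.interior) : s ⊆ P.interior := fun _ hw =>
  interior_of_linked hxi ⟨s, Set.subset_compl_iff_disjoint_right.2 hb, hs, hx, hw⟩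

end SimplePolygon

lemma eq_of_mem_segments {a b e z : Pt} (he : e ∈ segment ℝ a b) (h1 : z ∈ segment ℝ a e)
    (h2 : z ∈ segment ℝ e b) : z = e := by
  have d1 := dist_add_dist_of_mem_segment h1
  have d2 := dist_add_dist_of_mem_segment h2
  have d3 := dist_add_dist_of_mem_segment he
  have d4 := dist_triangle a z b
  have d5 := dist_comm e z
  have d6 := dist_nonneg (x := z) (y := e)
  exact dist_le_zero.1 (by linarith)

lemma eventually_eq_of_coe {X : Type*} [TopologicalSpace X] {f : X → ℝ} {z : X}
    (hf : ContinuousAt f z)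
    (h0 : ∀ᶠ z' in nhds z, (f z' : Real.Angle) = 0) : ∀ᶠ z' in nhds z, f z' = f z := by
  have hp := Real.pi_pos
  have h1 : ∀ᶠ z' in nhds z, |f z' - f z| < Real.pi := by
    have := (hf.sub_const (f z)).abs
    simp only [sub_self, abs_zero] at this
    exact this.eventually_lt_const hp
  filter_upwards [h0, h1] with z' h h'
  rw [abs_lt] at h'
  rcases lt_trichotomy (f z' - f z) 0 with h2 | h2 | h2
  · have := eq_add_two_pi_of_coe h0.self_of_nhds h (by linarith) (by linarith)
    linarith
  · linarith
  · have := eq_add_two_pi_of_coe h h0.self_of_nhds (by linarith) (by linarith)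
    linarith

namespace SimplePolygon
variable {P : SimplePolygon}

lemma wind_interior_const (hP : P.Nondegenerate) {z w : Pt} (hz : z ∈ P.interior)
    (hw : w ∈ P.interior) : wind P.vtx P.n z = wind P.vtx P.n w := by
  refine wind_const P.n_pos (by simpa using P.periodic 0) (isPreconnected_interior hP) ?_ hz hw
  intro z hz i _ h
  exact hz.1 (P.edge_subset_boundary i h)

/-- The arc of the boundary from `e₁` on edge `i` forward to `e₂` on edge `j`, `i < j`. -/
def arcFwd (P : SimplePolygon) (i j : ℕ) (e₁ e₂ : Pt) : Set Pt :=
  {z | ∃ k, i ≤ k ∧ k ≤ j ∧ z ∈ P.edge k ∧ (k = i → z ∈ segment ℝ e₁ (P.vtx (i + 1))) ∧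
    (k = j → z ∈ segment ℝ (P.vtx j) e₂)}

/-- The complementary arc, from `e₂` on edge `j` around to `e₁` on edge `i`. -/
def arcBwd (P : SimplePolygon) (i j : ℕ) (e₁ e₂ : Pt) : Set Pt :=
  {z | ∃ k < P.n, (k ≤ i ∨ j ≤ k) ∧ z ∈ P.edge k ∧ (k = i → z ∈ segment ℝ (P.vtx i) e₁) ∧
    (k = j → z ∈ segment ℝ e₂ (P.vtx (j + 1)))}

variable {i j : ℕ} {e₁ e₂ : Pt}

lemma arc_inter (hij : i < j) (hj : j < P.n) (h1 : e₁ ∈ P.edge i) (h2 : e₂ ∈ P.edge j) {z : Pt}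
    (hf : z ∈ P.arcFwd i j e₁ e₂) (hb : z ∈ P.arcBwd i j e₁ e₂) : z = e₁ ∨ z = e₂ := by
  obtain ⟨k, hik, hkj, hk, hki', hkj'⟩ := hf
  obtain ⟨l, hln, hl, hlz, hli', hlj'⟩ := hb
  by_cases hkl : k = l
  · subst hkl
    rcases hl with hl | hl
    · have : k = i := by omega
      exact Or.inl (eq_of_mem_segments h1 (hli' this) (hki' this))
    · have : k = j := by omega
      exact Or.inr (eq_of_mem_segments h2 (hkj' this) (hlj' this))
  have hkn : k < P.n := by omega
  obtain ⟨m, hm, hm'⟩ := P.exists_vtx_of_mem_edges hk hlz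
    (by rwa [Nat.mod_eq_of_lt hkn, Nat.mod_eq_of_lt hln])
  rw [Nat.mod_eq_of_lt hkn, Nat.mod_eq_of_lt hln] at hm'
  have hz1 : z = P.vtx (m % P.n + 1) := by
    rw [hm, P.vtx_eq_iff]; simp
  have hz2 : z = P.vtx ((m + 1) % P.n) := by rw [hm, P.vtx_mod]
  have hmod : (m + 1) % P.n = m % P.n + 1 ∨ ((m + 1) % P.n = 0 ∧ m % P.n = P.n - 1) := by
    have hlt := Nat.mod_lt m P.n_pos
    rw [← Nat.mod_add_mod]
    rcases Nat.lt_or_ge (m % P.n + 1) P.n with h | h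
    · left; exact Nat.mod_eq_of_lt h
    · right
      have : m % P.n + 1 = P.n := by omega
      rw [this, Nat.mod_self]
      exact ⟨rfl, by omega⟩
  rcases hm' with ⟨ek, el⟩ | ⟨el, ek⟩
  · -- `l` follows `k`
    rw [← ek] at hz1
    rw [← el] at hz2
    right
    rw [← ek, ← el] at hmod
    by_cases hk2 : k = j
    · have h3 := hkj' hk2
      rw [hk2] at hz1
      have := eq_of_mem_segments h2 h3 (by rw [hz1]; exact right_mem_segment ℝ _ _)
      exact this
    · have hlj : l = j := by omega
      have h3 := hlj' hlj
      rw [hlj] at hz2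
      exact eq_of_mem_segments h2 (by rw [hz2]; exact left_mem_segment ℝ _ _) h3
  · rw [← el] at hz1
    rw [← ek] at hz2
    left
    rw [← ek, ← el] at hmod
    by_cases hk2 : k = i
    · have h3 := hki' hk2
      rw [hk2] at hz2
      exact eq_of_mem_segments h1 (by rw [hz2]; exact left_mem_segment ℝ _ _) h3
    · have hlj : l = i := by omega
      have h3 := hli' hlj
      rw [hlj] at hz1
      exact eq_of_mem_segments h1 h3 (by rw [hz1]; exact right_mem_segment ℝ _ _)

lemma mem_segment_or {a b e z : Pt} (he : e ∈ segment ℝ a b) (hz : z ∈ segment ℝ a b) :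
    z ∈ segment ℝ a e ∨ z ∈ segment ℝ e b := by
  have hr : e ∈ Set.range (AffineMap.lineMap a b : ℝ → Pt) := by
    rw [segment_eq_image_lineMap] at he
    exact Set.image_subset_range _ _ he
  rw [← insert_endpoints_openSegment] at hz
  rcases hz with rfl | rfl | hz
  · exact Or.inl (left_mem_segment ℝ _ _)
  · exact Or.inr (right_mem_segment ℝ _ _)
  · rcases openSegment_subset_union a b hr hz with rfl | hz | hz
    · exact Or.inl (right_mem_segment ℝ _ _)
    · exact Or.inl (openSegment_subset_segment ℝ _ _ hz)
    · exact Or.inr (openSegment_subset_segment ℝ _ _ hz)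

lemma mem_arcs (hij : i < j) (hj : j < P.n) (h1 : e₁ ∈ P.edge i) (h2 : e₂ ∈ P.edge j) {z : Pt}
    (hz : z ∈ P.boundary) : z ∈ P.arcFwd i j e₁ e₂ ∨ z ∈ P.arcBwd i j e₁ e₂ := by
  obtain ⟨k, hkn, hk⟩ := P.mem_boundary.1 hz
  by_cases hki : k = i
  · subst hki
    rcases mem_segment_or h1 hk with h | h
    · exact Or.inr ⟨k, hkn, by omega, hk, fun _ => h, by omega⟩
    · exact Or.inl ⟨k, by omega, by omega, hk, fun _ => h, by omega⟩
  by_cases hkj : k = j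
  · subst hkj
    rcases mem_segment_or h2 hk with h | h
    · exact Or.inl ⟨k, by omega, by omega, hk, by omega, fun _ => h⟩
    · exact Or.inr ⟨k, hkn, by omega, hk, by omega, fun _ => h⟩
  by_cases h : i ≤ k ∧ k ≤ j
  · exact Or.inl ⟨k, h.1, h.2, hk, by omega, by omega⟩
  · exact Or.inr ⟨k, hkn, by omega, hk, by omega, by omega⟩

lemma segment_fst_subset {a b e : Pt} (he : e ∈ segment ℝ a b) :
    segment ℝ a e ⊆ segment ℝ a b :=
  (convex_segment a b).segment_subset (left_mem_segment ℝ _ _) he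

lemma segment_snd_subset {a b e : Pt} (he : e ∈ segment ℝ a b) :
    segment ℝ e b ⊆ segment ℝ a b :=
  (convex_segment a b).segment_subset he (right_mem_segment ℝ _ _)

/-- The winding number of the closed chain made of the forward arc and the chord. -/
def windFwd (P : SimplePolygon) (i j : ℕ) (e₁ e₂ z : Pt) : ℝ :=
  ang z e₂ e₁ + (ang z e₁ (P.vtx (i + 1)) +
    ∑ k ∈ Finset.Ico (i + 1) j, ang z (P.vtx k) (P.vtx (k + 1)) + ang z (P.vtx j) e₂)

/-- The winding number of the closed chain made of the backward arc and the chord. -/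
def windBwd (P : SimplePolygon) (i j : ℕ) (e₁ e₂ z : Pt) : ℝ :=
  ang z e₁ e₂ + (ang z e₂ (P.vtx (j + 1)) +
    ∑ k ∈ Finset.Ico (j + 1) P.n, ang z (P.vtx k) (P.vtx (k + 1)) +
    ∑ k ∈ Finset.Ico 0 i, ang z (P.vtx k) (P.vtx (k + 1)) + ang z (P.vtx i) e₁)

lemma arcFwd_parts (hij : i < j) (h1 : e₁ ∈ P.edge i) (h2 : e₂ ∈ P.edge j) {z : Pt}
    (hz : z ∉ P.arcFwd i j e₁ e₂) :
    z ∉ segment ℝ e₁ (P.vtx (i + 1)) ∧ (∀ k ∈ Finset.Ico (i + 1) j, z ∉ P.edge k) ∧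
      z ∉ segment ℝ (P.vtx j) e₂ := by
  refine ⟨fun h => hz ⟨i, le_rfl, hij.le, segment_snd_subset h1 h, fun _ => h, by omega⟩,
    fun k hk h => ?_,
    fun h => hz ⟨j, hij.le, le_rfl, segment_fst_subset h2 h, by omega, fun _ => h⟩⟩
  rw [Finset.mem_Ico] at hk
  exact hz ⟨k, by omega, by omega, h, by omega, by omega⟩

lemma arcBwd_parts (hij : i < j) (hj : j < P.n) (h1 : e₁ ∈ P.edge i) (h2 : e₂ ∈ P.edge j) {z : Pt}
    (hz : z ∉ P.arcBwd i j e₁ e₂) :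
    z ∉ segment ℝ e₂ (P.vtx (j + 1)) ∧ (∀ k ∈ Finset.Ico (j + 1) P.n, z ∉ P.edge k) ∧
      (∀ k ∈ Finset.Ico 0 i, z ∉ P.edge k) ∧ z ∉ segment ℝ (P.vtx i) e₁ := by
  refine ⟨fun h => hz ⟨j, hj, Or.inr le_rfl, segment_snd_subset h2 h, by omega, fun _ => h⟩,
    fun k hk h => ?_, fun k hk h => ?_,
    fun h => hz ⟨i, by omega, Or.inl le_rfl, segment_fst_subset h1 h, fun _ => h, by omega⟩⟩ <;>
  · rw [Finset.mem_Ico] at hk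
    exact hz ⟨k, by omega, by omega, h, by omega, by omega⟩

lemma continuousAt_windFwd_aux (hij : i < j) (h1 : e₁ ∈ P.edge i) (h2 : e₂ ∈ P.edge j)
    {z : Pt} (hz : z ∉ P.arcFwd i j e₁ e₂) :
    ContinuousAt (fun z => ang z e₁ (P.vtx (i + 1)) +
    ∑ k ∈ Finset.Ico (i + 1) j, ang z (P.vtx k) (P.vtx (k + 1)) + ang z (P.vtx j) e₂) z := by
  obtain ⟨a1, a2, a3⟩ := arcFwd_parts hij h1 h2 hz
  exact ((continuousAt_ang a1).add (tendsto_finsetSum _ fun k hk => continuousAt_ang (a2 k hk))).add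
    (continuousAt_ang a3)

lemma continuousAt_windBwd (hij : i < j) (hj : j < P.n) (h1 : e₁ ∈ P.edge i) (h2 : e₂ ∈ P.edge j)
    {z : Pt} (hz : z ∉ P.arcBwd i j e₁ e₂) (hc : z ∉ segment ℝ e₁ e₂) :
    ContinuousAt (P.windBwd i j e₁ e₂) z := by
  obtain ⟨a1, a2, a3, a4⟩ := arcBwd_parts hij hj h1 h2 hz
  exact (continuousAt_ang hc).add ((((continuousAt_ang a1).add
    (tendsto_finsetSum _ fun k hk => continuousAt_ang (a2 k hk))).add
    (tendsto_finsetSum _ fun k hk => continuousAt_ang (a3 k hk))).add (continuousAt_ang a4))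

lemma windFwd_coe (hij : i < j) (h1 : e₁ ∈ P.edge i) (h2 : e₂ ∈ P.edge j)
    {z : Pt} (hz : z ∉ P.arcFwd i j e₁ e₂) : (P.windFwd i j e₁ e₂ z : Real.Angle) = 0 := by
  obtain ⟨a1, a2, a3⟩ := arcFwd_parts hij h1 h2 hz
  obtain ⟨b1, b2⟩ := ne_of_notMem_segment a1
  obtain ⟨b3, b4⟩ := ne_of_notMem_segment a3
  rw [windFwd]
  simp only [Real.Angle.coe_add]
  rw [sum_ang_coe _ _ hij, ang_coe b4 b1, ang_coe b1 b2, ang_coe b3 b4]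
  · abel
  · intro k hk hk'
    rcases hk'.lt_or_eq with h | rfl
    · exact (ne_of_notMem_segment (a2 k (Finset.mem_Ico.2 ⟨hk, h⟩))).1
    · exact b3

lemma windBwd_coe (hij : i < j) (hj : j < P.n) (h1 : e₁ ∈ P.edge i) (h2 : e₂ ∈ P.edge j)
    {z : Pt} (hz : z ∉ P.arcBwd i j e₁ e₂) : (P.windBwd i j e₁ e₂ z : Real.Angle) = 0 := by
  obtain ⟨a1, a2, a3, a4⟩ := arcBwd_parts hij hj h1 h2 hz
  obtain ⟨b1, b2⟩ := ne_of_notMem_segment a1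
  obtain ⟨b3, b4⟩ := ne_of_notMem_segment a4
  have hn : P.vtx P.n = P.vtx 0 := by simpa using P.periodic 0
  have h0 : P.vtx 0 ≠ z := by
    rcases Nat.eq_zero_or_pos i with rfl | h
    · exact b3
    · exact (ne_of_notMem_segment (a3 0 (Finset.mem_Ico.2 ⟨le_rfl, h⟩))).1
  rw [windBwd]
  simp only [Real.Angle.coe_add]
  rw [sum_ang_coe _ _ (show j + 1 ≤ P.n by omega), sum_ang_coe _ _ (Nat.zero_le i),
    ang_coe b4 b1, ang_coe b1 b2, ang_coe b3 b4, hn]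
  · abel
  · intro k hk hk'
    rcases hk'.lt_or_eq with h | rfl
    · exact (ne_of_notMem_segment (a3 k (Finset.mem_Ico.2 ⟨hk, h⟩))).1
    · exact b3
  · intro k hk hk'
    rcases hk'.lt_or_eq with h | rfl
    · exact (ne_of_notMem_segment (a2 k (Finset.mem_Ico.2 ⟨hk, h⟩))).1
    · rw [hn]; exact h0

lemma windFwd_add_windBwd (hij : i < j) (hj : j < P.n) (h1 : e₁ ∈ P.edge i) (h2 : e₂ ∈ P.edge j)
    {z : Pt} (hz : z ∉ P.boundary) (hc : z ∉ segment ℝ e₁ e₂) :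
    P.windFwd i j e₁ e₂ z + P.windBwd i j e₁ e₂ z = wind P.vtx P.n z := by
  have c1 := ang_split (fun h => hz (P.edge_subset_boundary i h)) h1
  have c2 := ang_split (fun h => hz (P.edge_subset_boundary j h)) h2
  have c3 := ang_swap_add hc
  have c4 : wind P.vtx P.n z = ∑ k ∈ Finset.Ico 0 i, ang z (P.vtx k) (P.vtx (k + 1)) +
      ang z (P.vtx i) (P.vtx (i + 1)) + ∑ k ∈ Finset.Ico (i + 1) j, ang z (P.vtx k) (P.vtx (k + 1))
      + ang z (P.vtx j) (P.vtx (j + 1)) +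
      ∑ k ∈ Finset.Ico (j + 1) P.n, ang z (P.vtx k) (P.vtx (k + 1)) := by
    rw [wind, ← Nat.Ico_zero_eq_range, ← Finset.sum_Ico_succ_top (Nat.zero_le i),
      Finset.sum_Ico_consecutive _ (Nat.zero_le _) hij, ← Finset.sum_Ico_succ_top (Nat.zero_le j),
      Finset.sum_Ico_consecutive _ (Nat.zero_le _) hj]
  rw [c4, windFwd, windBwd]
  linarith

end SimplePolygon

namespace SimplePolygon
variable {P : SimplePolygon}

lemma isClosed_arcFwd (P : SimplePolygon) (i j : ℕ) (e₁ e₂ : Pt) :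
    IsClosed (P.arcFwd i j e₁ e₂) := by
  have : P.arcFwd i j e₁ e₂ = ⋃ k ∈ Finset.Icc i j, (P.edge k ∩
      (if k = i then segment ℝ e₁ (P.vtx (i + 1)) else Set.univ)) ∩
      (if k = j then segment ℝ (P.vtx j) e₂ else Set.univ) := by
    ext z
    simp only [arcFwd, Set.mem_ofPred_eq, Set.mem_iUnion, Finset.mem_Icc, Set.mem_inter_iff]
    refine exists_congr fun k => ?_
    split_ifs <;> simp_all <;> tauto
  rw [this]
  refine (Finset.finite_toSet _).isClosed_biUnion fun k _ => (IsClosed.inter (P.isClosed_edge k) ?_).inter ?_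
  · split_ifs
    exacts [isClosed_segment _ _, isClosed_univ]
  · split_ifs
    exacts [isClosed_segment _ _, isClosed_univ]

lemma isClosed_arcBwd (P : SimplePolygon) (i j : ℕ) (e₁ e₂ : Pt) :
    IsClosed (P.arcBwd i j e₁ e₂) := by
  have : P.arcBwd i j e₁ e₂ = ⋃ k ∈ (Finset.range P.n).filter (fun k => k ≤ i ∨ j ≤ k),
      (P.edge k ∩ (if k = i then segment ℝ (P.vtx i) e₁ else Set.univ)) ∩
      (if k = j then segment ℝ e₂ (P.vtx (j + 1)) else Set.univ) := by
    ext z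
    simp only [arcBwd, Set.mem_ofPred_eq, Set.mem_iUnion, Finset.mem_filter, Finset.mem_range,
      Set.mem_inter_iff]
    refine exists_congr fun k => ?_
    split_ifs <;> simp_all <;> tauto
  rw [this]
  refine (Finset.finite_toSet _).isClosed_biUnion fun k _ => (IsClosed.inter (P.isClosed_edge k) ?_).inter ?_
  · split_ifs
    exacts [isClosed_segment _ _, isClosed_univ]
  · split_ifs
    exacts [isClosed_segment _ _, isClosed_univ]

/-- A function separating the two sides of the chord from `e₁` to `e₂` in the polygon. -/
structure ChordLabel (P : SimplePolygon) (e₁ e₂ : Pt) (τ : Pt → ℝ) : Prop where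
  locally_const : ∀ z ∈ P.region, z ∉ segment ℝ e₁ e₂ →
    ∀ᶠ z' in nhds z, z' ∈ P.region → z' ∉ segment ℝ e₁ e₂ → τ z' = τ z
  jump : ∀ z₀ ∈ openSegment ℝ e₁ e₂, ∃ ε > 0, ∀ z ∈ Metric.ball z₀ ε, ∀ z' ∈ Metric.ball z₀ ε,
    0 < det2 (e₂ - e₁) (z - e₁) → det2 (e₂ - e₁) (z' - e₁) < 0 → τ z ≠ τ z'

lemma exists_chordLabel_of_lt (hP : P.Nondegenerate) {i j : ℕ} {e₁ e₂ : Pt} (hij : i < j)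
    (hj : j < P.n) (h1 : e₁ ∈ P.edge i) (h2 : e₂ ∈ P.edge j) (hne : e₁ ≠ e₂)
    (hsub : openSegment ℝ e₁ e₂ ⊆ P.interior) : ∃ τ, P.ChordLabel e₁ e₂ τ := by
  obtain ⟨x₀, hx₀⟩ : P.interior.Nonempty := ⟨_, hsub (midpoint_mem_openSegment e₁ e₂)⟩
  set w := wind P.vtx P.n x₀
  have hsum : ∀ z ∈ P.interior, z ∉ segment ℝ e₁ e₂ →
      P.windFwd i j e₁ e₂ z = w - P.windBwd i j e₁ e₂ z := by
    intro z hz hc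
    have h₁ := wind_interior_const hP hz hx₀
    have h₂ := windFwd_add_windBwd hij hj h1 h2 hz.1 hc
    simp only [w]; linarith
  set Γ := P.arcFwd i j e₁ e₂ with hΓ
  have hint : ∀ z ∈ P.interior, z ∉ Γ := by
    rintro z hz ⟨k, -, -, hk, -⟩
    exact hz.1 (P.edge_subset_boundary k hk)
  refine ⟨fun z => if z ∈ Γ then w - P.windBwd i j e₁ e₂ z else P.windFwd i j e₁ e₂ z, ?_, ?_⟩
  · intro z hz hc
    by_cases hzΓ : z ∈ Γ
    · have hzb : z ∉ P.arcBwd i j e₁ e₂ := by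
        intro hb
        rcases arc_inter hij hj h1 h2 hzΓ hb with rfl | rfl
        · exact hc (left_mem_segment ℝ _ _)
        · exact hc (right_mem_segment ℝ _ _)
      have hev : ∀ᶠ z' in nhds z, z' ∉ P.arcBwd i j e₁ e₂ :=
        (P.isClosed_arcBwd i j e₁ e₂).isOpen_compl.mem_nhds hzb
      have hcst := eventually_eq_of_coe (continuousAt_windBwd hij hj h1 h2 hzb hc)
        (hev.mono fun z' h => windBwd_coe hij hj h1 h2 h)
      filter_upwards [hev, hcst] with z' hb' hz' hr' hc'
      simp only [hzΓ, if_true]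
      split_ifs with hΓ'
      · rw [hz']
      · have : z' ∈ P.interior := by
          rcases hr' with hr' | hr'
          · exact absurd (mem_arcs hij hj h1 h2 hr') (by simp [← hΓ, hΓ', hb'])
          · exact hr'
        rw [hsum z' this hc', hz']
    · have hev : ∀ᶠ z' in nhds z, z' ∉ Γ :=
        (P.isClosed_arcFwd i j e₁ e₂).isOpen_compl.mem_nhds hzΓ
      have hcont : ContinuousAt (P.windFwd i j e₁ e₂) z :=
        (continuousAt_ang (by rwa [segment_symm])).add (continuousAt_windFwd_aux hij h1 h2 hzΓ)
      have hcst := eventually_eq_of_coe hcont (hev.mono fun z' h => windFwd_coe hij h1 h2 h)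
      filter_upwards [hev, hcst] with z' h h' _ _
      simp [h, hzΓ, h']
  · intro z₀ hz₀
    have hz₀i := hsub hz₀
    have hev : ∀ᶠ z in nhds z₀, z ∉ Γ :=
      (P.isClosed_arcFwd i j e₁ e₂).isOpen_compl.mem_nhds (hint _ hz₀i)
    obtain ⟨ε, hε, hj'⟩ := wind_jump (by rwa [openSegment_symm]) hne.symm
      (continuousAt_windFwd_aux hij h1 h2 (hint _ hz₀i))
      (hev.mono fun z h _ => windFwd_coe hij h1 h2 h)
    obtain ⟨δ, hδ, hb⟩ := Metric.eventually_nhds_iff_ball.1 hev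
    refine ⟨min ε δ, lt_min hε hδ, fun z hz z' hz' hp hn => ?_⟩
    have m1 := Metric.ball_subset_ball (min_le_left ε δ) hz
    have m2 := Metric.ball_subset_ball (min_le_right ε δ) hz
    have m1' := Metric.ball_subset_ball (min_le_left ε δ) hz'
    have m2' := Metric.ball_subset_ball (min_le_right ε δ) hz'
    have hrev : ∀ y, det2 (e₁ - e₂) (y - e₂) = -det2 (e₂ - e₁) (y - e₁) := by
      intro y; simp [det2]; ring
    have := hj' z' m1' z m1 (by rw [hrev]; linarith) (by rw [hrev]; linarith)
    simp only [hb z m2, hb z' m2', if_false]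
    change P.windFwd i j e₁ e₂ z' = P.windFwd i j e₁ e₂ z + 2 * Real.pi at this
    intro h
    have hp := Real.pi_pos
    linarith

lemma exists_chordLabel (hP : P.Nondegenerate) {e₁ e₂ : Pt} (h1 : e₁ ∈ P.boundary)
    (h2 : e₂ ∈ P.boundary) (hne : e₁ ≠ e₂) (hsub : openSegment ℝ e₁ e₂ ⊆ P.interior) :
    ∃ τ, P.ChordLabel e₁ e₂ τ := by
  obtain ⟨i, hi, hi'⟩ := P.mem_boundary.1 h1
  obtain ⟨j, hj, hj'⟩ := P.mem_boundary.1 h2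
  rcases lt_trichotomy i j with h | rfl | h
  · exact exists_chordLabel_of_lt hP h hj hi' hj' hne hsub
  · have hm := midpoint_mem_openSegment (𝕜 := ℝ) e₁ e₂
    exact absurd (P.edge_subset_boundary i ((convex_segment _ _).openSegment_subset hi' hj' hm))
      (hsub hm).1
  · obtain ⟨τ, hτ⟩ := exists_chordLabel_of_lt hP h hi hj' hi' hne.symm
      (by rwa [openSegment_symm])
    refine ⟨τ, ?_, ?_⟩
    · rw [segment_symm]; exact hτ.locally_const
    · intro z₀ hz₀
      rw [openSegment_symm] at hz₀
      obtain ⟨ε, hε, h⟩ := hτ.jump z₀ hz₀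
      have hrev : ∀ y, det2 (e₁ - e₂) (y - e₂) = -det2 (e₂ - e₁) (y - e₁) := by
        intro y; simp [det2]; ring
      simp only [hrev] at h
      exact ⟨ε, hε, fun z hz z' hz' hp hn => (h z' hz' z hz (by linarith) (by linarith)).symm⟩

end SimplePolygon

/-- The maximal segment of direction `u` through `p` in `O`. -/
def chord (O : Set Pt) (p u : Pt) : Set Pt := {q | ∃ s : ℝ, q = p + s • u ∧ segment ℝ p q ⊆ O}

/-- The part of `O` to the left of the chord of direction `u` through `p`. -/
def leftSide (O : Set Pt) (p u : Pt) : Set Pt :=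
  {z | ∃ t : ℝ, 0 < t ∧ segment ℝ p (p + t • rotJ u) ⊆ O ∧
    z ∈ connectedComponentIn (O \ chord O p u) (p + t • rotJ u)}

/-- A bounded connected open set that is disconnected by each of its chords. -/
structure ChordDomain (O : Set Pt) : Prop where
  isOpen : IsOpen O
  isPreconnected : IsPreconnected O
  isBounded : Bornology.IsBounded O
  separates : ∀ p ∈ O, ∀ u ≠ 0, ∀ X ⊆ O \ chord O p u, IsPreconnected X → ∀ t t' : ℝ, 0 < t →
    0 < t' → segment ℝ p (p + t • rotJ u) ⊆ O → segment ℝ p (p - t' • rotJ u) ⊆ O →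
    p + t • rotJ u ∈ X → p - t' • rotJ u ∉ X

lemma rotJ_neg (u : Pt) : rotJ (-u) = -rotJ u := by
  apply pt_ext <;> simp [rotJ_zero, rotJ_one]

/-- Two vectors in the plane with vanishing determinant are proportional. -/
lemma exists_smul_of_det2_eq_zero {u v : Pt} (hu : u ≠ 0) (h : det2 u v = 0) :
    ∃ s : ℝ, v = s • u := by
  have hp := dot2_self_pos hu
  refine ⟨(u 0 * v 0 + u 1 * v 1) / (u 0 * u 0 + u 1 * u 1), ?_⟩
  have hp' : u 0 * u 0 + u 1 * u 1 ≠ 0 := by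
    have : 0 < u 0 * u 0 + u 1 * u 1 := by simpa [dot2] using hp
    exact this.ne'
  simp only [det2] at h
  apply pt_ext
  · simp only [PiLp.smul_apply, smul_eq_mul]; rw [div_mul_eq_mul_div, eq_div_iff hp']
    linear_combination -(u 1) * h
  · simp only [PiLp.smul_apply, smul_eq_mul]; rw [div_mul_eq_mul_div, eq_div_iff hp']
    linear_combination (u 0) * h

section chord
variable {O : Set Pt} {p q u : Pt}

lemma chord_subset : chord O p u ⊆ O := fun _ ⟨_, _, h⟩ => h (right_mem_segment _ _ _)

lemma mem_chord_self (hp : p ∈ O) : p ∈ chord O p u :=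
  ⟨0, by simp, by simpa [segment_same] using hp⟩

lemma det2_of_mem_chord (h : q ∈ chord O p u) : det2 u (q - p) = 0 := by
  obtain ⟨s, rfl, -⟩ := h
  simp [det2_smul_right]

lemma mem_chord_iff (hu : u ≠ 0) :
    q ∈ chord O p u ↔ det2 u (q - p) = 0 ∧ segment ℝ p q ⊆ O := by
  refine ⟨fun h => ⟨det2_of_mem_chord h, h.choose_spec.2⟩, fun ⟨h, h'⟩ => ?_⟩
  obtain ⟨s, hs⟩ := exists_smul_of_det2_eq_zero hu h
  exact ⟨s, by rw [← hs]; abel, h'⟩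

lemma segment_of_det2_eq_zero {a b c : Pt} (hu : u ≠ 0) (h1 : det2 u (b - a) = 0)
    (h2 : det2 u (c - a) = 0) : segment ℝ a c ⊆ segment ℝ a b ∪ segment ℝ b c := by
  obtain ⟨s, hs⟩ := exists_smul_of_det2_eq_zero hu h1
  obtain ⟨t, ht⟩ := exists_smul_of_det2_eq_zero hu h2
  have hb : b = a + s • u := by rw [← hs]; abel
  have hc : c = a + t • u := by rw [← ht]; abel
  have key : ∀ x y : ℝ, segment ℝ (a + x • u) (a + y • u) =
      (fun r : ℝ => a + r • u) '' segment ℝ x y := by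
    intro x y
    have := image_segment ℝ (AffineMap.lineMap a (a + u) : ℝ →ᵃ[ℝ] Pt) x y
    simp only [AffineMap.lineMap_apply, vsub_eq_sub, add_sub_cancel_left, vadd_eq_add] at this
    simp only [add_comm a]
    rw [← this]
    exact Set.image_congr' fun r => by simp [AffineMap.lineMap_apply]
  have ha : a = a + (0 : ℝ) • u := by simp
  rw [hb, hc]
  nth_rewrite 1 [ha]
  nth_rewrite 3 [ha]
  rw [key, key, key, ← Set.image_union]
  refine Set.image_mono ?_
  rw [segment_eq_uIcc, segment_eq_uIcc, segment_eq_uIcc]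
  exact Set.uIcc_subset_uIcc_union_uIcc

lemma segment_subset_chord (h : q ∈ chord O p u) : segment ℝ p q ⊆ chord O p u := by
  intro z hz
  obtain ⟨s, rfl, hs⟩ := h
  have hz' := hz
  rw [segment_eq_image_lineMap] at hz
  obtain ⟨θ, hθ, rfl⟩ := hz
  refine ⟨θ * s, by simp [AffineMap.lineMap_apply, mul_smul, add_comm], ?_⟩
  exact ((convex_segment _ _).segment_subset (left_mem_segment _ _ _) hz').trans hs

lemma chord_eq_of_mem (hu : u ≠ 0) (h : q ∈ chord O p u) : chord O q u = chord O p u := by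
  have aux : ∀ {p q : Pt}, q ∈ chord O p u → chord O q u ⊆ chord O p u := by
    intro p q h z hz
    rw [mem_chord_iff hu] at *
    have e : det2 u (z - p) = 0 := by
      have : z - p = (z - q) + (q - p) := by abel
      rw [this, det2_add_right, hz.1, h.1, add_zero]
    refine ⟨e, (segment_of_det2_eq_zero hu h.1 e).trans (Set.union_subset h.2 hz.2)⟩
  refine (aux h).antisymm (aux ?_)
  rw [mem_chord_iff hu] at *
  refine ⟨?_, by rw [segment_symm]; exact h.2⟩
  rw [← neg_sub, det2_neg_right, h.1, neg_zero]

lemma chord_smul {s : ℝ} (hs : s ≠ 0) : chord O p (s • u) = chord O p u := by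
  ext z
  constructor
  · rintro ⟨r, rfl, h⟩
    exact ⟨r * s, by rw [mul_smul], h⟩
  · rintro ⟨r, rfl, h⟩
    exact ⟨r / s, by rw [smul_smul, div_mul_cancel₀ _ hs], h⟩

lemma chord_neg : chord O p (-u) = chord O p u := by
  rw [← neg_one_smul ℝ u, chord_smul (by norm_num)]

lemma chord_inter_segment {w z : Pt} (hu : u ≠ 0) (hw : w ∈ chord O p u) (hz : det2 u (z - p) = 0)
    (h : segment ℝ w z ⊆ O) : z ∈ chord O p u := by
  rw [← chord_eq_of_mem hu hw, mem_chord_iff hu]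
  refine ⟨?_, h⟩
  have : z - w = (z - p) - (w - p) := by abel
  rw [this, det2_sub_right, hz, det2_of_mem_chord hw, sub_zero]

lemma isOpen_diff_chord (hO : IsOpen O) (hu : u ≠ 0) : IsOpen (O \ chord O p u) := by
  rw [isOpen_iff_mem_nhds]
  rintro z ⟨hz, hzc⟩
  obtain ⟨ε, hε, hb⟩ := Metric.isOpen_iff.1 hO z hz
  by_cases h0 : det2 u (z - p) = 0
  · filter_upwards [Metric.ball_mem_nhds z hε] with z' hz'
    refine ⟨hb hz', fun hc => hzc (chord_inter_segment hu hc h0 ?_)⟩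
    exact ((convex_ball z ε).segment_subset hz' (Metric.mem_ball_self hε)).trans hb
  · have : ∀ᶠ z' in nhds z, det2 u (z' - p) ≠ 0 :=
      (by fun_prop : Continuous fun z' => det2 u (z' - p)).continuousAt.eventually_ne h0
    filter_upwards [this, hO.mem_nhds hz] with z' h1 h2
    exact ⟨h2, fun hc => h1 (det2_of_mem_chord hc)⟩

/-- A chord of a bounded open set is an open segment whose end points are outside the set. -/
lemma exists_chord_end (hO : IsOpen O) (hOb : Bornology.IsBounded O) (hp : p ∈ O) (hu : u ≠ 0) :
    ∃ s : ℝ, 0 < s ∧ p + s • u ∉ O ∧ ∀ t, 0 ≤ t → t < s → p + t • u ∈ O := by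
  set A := {t : ℝ | 0 ≤ t ∧ p + t • u ∉ O} with hA
  have hcl : IsClosed A := by
    apply (isClosed_Ici (a := (0 : ℝ))).inter
    exact hO.isClosed_compl.preimage (by fun_prop : Continuous fun t : ℝ => p + t • u)
  have hne : A.Nonempty := by
    by_contra hempty
    rw [Set.not_nonempty_iff_eq_empty] at hempty
    obtain ⟨C, hC⟩ := hOb.exists_norm_le
    have hun : 0 < ‖u‖ := norm_pos_iff.2 hu
    have hC0 : 0 ≤ C := (norm_nonneg _).trans (hC p hp)
    set t := (C + ‖p‖ + 1) / ‖u‖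
    have ht : 0 ≤ t := by positivity
    have hin : p + t • u ∈ O := by
      by_contra h
      have : t ∈ A := ⟨ht, h⟩
      rw [hempty] at this
      exact this
    have h1 := hC _ hin
    have h2 : ‖t • u‖ = C + ‖p‖ + 1 := by
      rw [norm_smul, Real.norm_of_nonneg ht]
      exact div_mul_cancel₀ _ hun.ne'
    have h3 := norm_add_le (p + t • u) (-p)
    rw [show p + t • u + -p = t • u by abel, norm_neg] at h3
    linarith
  have hbdd : BddBelow A := ⟨0, fun t ht => ht.1⟩
  have hmem := hcl.csInf_mem hne hbdd
  refine ⟨sInf A, lt_of_le_of_ne hmem.1 ?_, hmem.2, ?_⟩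
  · intro h0
    have := hmem.2
    rw [← h0] at this
    simp [hp] at this
  · intro t h0 ht
    by_contra h
    exact absurd (csInf_le hbdd ⟨h0, h⟩) (not_le.2 ht)

end chord

section side
variable {O : Set Pt} {p q u : Pt}

lemma det2_pos_convex (u p : Pt) : Convex ℝ {z : Pt | 0 < det2 u (z - p)} := by
  have : {z : Pt | 0 < det2 u (z - p)} = {z | det2 u p < det2L u z} := by
    ext z; simp [det2_sub_right, det2L_apply]
  rw [this]
  exact convex_halfSpace_gt (det2L u).toLinearMap.isLinear _

lemma exists_left_start (hO : IsOpen O) (hp : p ∈ O) (u : Pt) :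
    ∃ t : ℝ, 0 < t ∧ segment ℝ p (p + t • u) ⊆ O := by
  obtain ⟨ε, hε, hb⟩ := Metric.isOpen_iff.1 hO p hp
  obtain ⟨t, ht, -, hm⟩ := exists_small_smul p u (Metric.ball_mem_nhds p hε)
  exact ⟨t, ht, ((convex_ball p ε).segment_subset (Metric.mem_ball_self hε) hm).trans hb⟩

lemma det2_start_pos (hu : u ≠ 0) {t : ℝ} (ht : 0 < t) : 0 < det2 u (p + t • rotJ u - p) := by
  rw [add_sub_cancel_left, det2_smul_right]
  exact mul_pos ht (det2_rotJ_pos hu)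

lemma subset_diff_chord {X : Set Pt} (hX : X ⊆ O) (h : ∀ z ∈ X, det2 u (z - p) ≠ 0) :
    X ⊆ O \ chord O p u :=
  fun z hz => ⟨hX hz, fun hc => h z hz (det2_of_mem_chord hc)⟩

lemma component_start_eq (hu : u ≠ 0) {t t' : ℝ} (ht : 0 < t) (ht' : 0 < t')
    (h : segment ℝ p (p + t • rotJ u) ⊆ O) (h' : segment ℝ p (p + t' • rotJ u) ⊆ O) :
    connectedComponentIn (O \ chord O p u) (p + t • rotJ u) =
      connectedComponentIn (O \ chord O p u) (p + t' • rotJ u) := by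
  wlog htt : t ≤ t' generalizing t t'
  · exact (this ht' ht h' h (le_of_not_ge htt)).symm
  have hmem : p + t • rotJ u ∈ segment ℝ p (p + t' • rotJ u) := by
    rw [segment_eq_image_lineMap]
    refine ⟨t / t', ⟨by positivity, (div_le_one ht').2 htt⟩, ?_⟩
    simp only [AffineMap.lineMap_apply, vsub_eq_sub, add_sub_cancel_left, vadd_eq_add, smul_smul]
    rw [div_mul_cancel₀ _ ht'.ne', add_comm]
  have hs : segment ℝ (p + t • rotJ u) (p + t' • rotJ u) ⊆ O \ chord O p u := by
    apply subset_diff_chord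
    · exact ((convex_segment _ _).segment_subset hmem (right_mem_segment _ _ _)).trans h'
    · intro z hz
      exact ne_of_gt ((det2_pos_convex u p).segment_subset (det2_start_pos hu ht)
        (det2_start_pos hu ht') hz)
  exact connectedComponentIn_eq ((convex_segment _ _).isPreconnected.subset_connectedComponentIn
    (left_mem_segment _ _ _) hs (right_mem_segment _ _ _))

lemma leftSide_eq (hu : u ≠ 0) {t : ℝ} (ht : 0 < t) (h : segment ℝ p (p + t • rotJ u) ⊆ O) :
    leftSide O p u = connectedComponentIn (O \ chord O p u) (p + t • rotJ u) := by
  ext z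
  constructor
  · rintro ⟨t', ht', h', hz⟩
    rwa [component_start_eq hu ht ht' h h']
  · exact fun hz => ⟨t, ht, h, hz⟩

lemma leftSide_subset_diff : leftSide O p u ⊆ O \ chord O p u :=
  fun _ ⟨_, _, _, hz⟩ => connectedComponentIn_subset _ _ hz

lemma leftSide_subset : leftSide O p u ⊆ O := fun _ h => (leftSide_subset_diff h).1

lemma isOpen_leftSide (hO : IsOpen O) (hu : u ≠ 0) : IsOpen (leftSide O p u) := by
  have : leftSide O p u = ⋃ t ∈ {t : ℝ | 0 < t ∧ segment ℝ p (p + t • rotJ u) ⊆ O},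
      connectedComponentIn (O \ chord O p u) (p + t • rotJ u) := by
    ext z; simp [leftSide, and_assoc]
  rw [this]
  exact isOpen_biUnion fun t _ => (isOpen_diff_chord hO hu).connectedComponentIn

lemma isPreconnected_leftSide (hO : IsOpen O) (hp : p ∈ O) (hu : u ≠ 0) :
    IsPreconnected (leftSide O p u) := by
  obtain ⟨t, ht, h⟩ := exists_left_start hO hp (rotJ u)
  rw [leftSide_eq hu ht h]
  exact isPreconnected_connectedComponentIn

lemma exists_ball_left (hO : IsOpen O) (hu : u ≠ 0) {w : Pt} (hw : w ∈ chord O p u) :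
    ∃ ε > 0, Metric.ball w ε ⊆ O ∧
      ∀ z ∈ Metric.ball w ε, 0 < det2 u (z - w) → z ∈ leftSide O p u := by
  have hwo := (mem_chord_iff hu).1 hw
  have hcpt : IsCompact (segment ℝ p w) := by
    rw [segment_eq_image_lineMap]
    exact isCompact_Icc.image AffineMap.lineMap_continuous
  obtain ⟨ε, hε, hth⟩ := hcpt.exists_thickening_subset_open hO hwo.2
  have hball : ∀ y ∈ segment ℝ p w, Metric.ball y ε ⊆ Metric.thickening ε (segment ℝ p w) :=
    fun y hy => Metric.ball_subset_thickening hy ε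
  refine ⟨ε, hε, (hball w (right_mem_segment _ _ _)).trans hth, fun z hz hdz => ?_⟩
  have hdz' : 0 < det2 u (z - p) := by
    have : z - p = (z - w) + (w - p) := by abel
    rw [this, det2_add_right, hwo.1, add_zero]; exact hdz
  obtain ⟨t, ht, -, hm⟩ := exists_small_smul p (rotJ u) (Metric.ball_mem_nhds p hε)
  have hpb := hball p (left_mem_segment _ _ _)
  have hs : segment ℝ p (p + t • rotJ u) ⊆ O :=
    (((convex_ball p ε).segment_subset (Metric.mem_ball_self hε) hm).trans hpb).trans hth
  rw [leftSide_eq hu ht hs]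
  have hcv : Convex ℝ (Metric.thickening ε (segment ℝ p w) ∩ {z : Pt | 0 < det2 u (z - p)}) :=
    ((convex_segment _ _).thickening ε).inter (det2_pos_convex u p)
  refine hcv.isPreconnected.subset_connectedComponentIn ⟨hpb hm, det2_start_pos hu ht⟩
    (subset_diff_chord (Set.inter_subset_left.trans hth) fun y hy => ne_of_gt hy.2)
    ⟨hball w (right_mem_segment _ _ _) hz, hdz'⟩

lemma leftSide_eq_of_mem (hO : IsOpen O) (hp : p ∈ O) (hu : u ≠ 0) (hq : q ∈ chord O p u) :
    leftSide O q u = leftSide O p u := by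
  obtain ⟨ε, hε, hb, hl⟩ := exists_ball_left hO hu hq
  obtain ⟨t, ht, -, hm⟩ := exists_small_smul q (rotJ u) (Metric.ball_mem_nhds q hε)
  have hs : segment ℝ q (q + t • rotJ u) ⊆ O :=
    ((convex_ball q ε).segment_subset (Metric.mem_ball_self hε) hm).trans hb
  have h1 := hl _ hm (det2_start_pos hu ht)
  obtain ⟨r, hr, hsr⟩ := exists_left_start hO hp (rotJ u)
  rw [leftSide_eq hu hr hsr] at h1 ⊢
  rw [leftSide_eq hu ht hs, chord_eq_of_mem hu hq]
  exact (connectedComponentIn_eq h1).symm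

end side

namespace ChordDomain
variable {O : Set Pt} {p q u : Pt} (hO : ChordDomain O)
include hO

lemma disjoint_sides (hp : p ∈ O) (hu : u ≠ 0) :
    Disjoint (leftSide O p u) (leftSide O p (-u)) := by
  obtain ⟨t, ht, h⟩ := exists_left_start hO.isOpen hp (rotJ u)
  obtain ⟨t', ht', h'⟩ := exists_left_start hO.isOpen hp (rotJ (-u))
  rw [leftSide_eq hu ht h, leftSide_eq (neg_ne_zero.2 hu) ht' h', chord_neg]
  have e : p + t' • rotJ (-u) = p - t' • rotJ u := by rw [rotJ_neg, smul_neg, sub_eq_add_neg]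
  rw [e] at h' ⊢
  rw [Set.disjoint_left]
  intro z hz hz'
  have hc := (connectedComponentIn_eq hz).trans (connectedComponentIn_eq hz').symm
  refine hO.separates p hp u hu _ (connectedComponentIn_subset _ _)
    isPreconnected_connectedComponentIn t t' ht ht' h h' (mem_connectedComponentIn ?_) ?_
  · exact subset_diff_chord (X := {p + t • rotJ u}) (by
      simpa using h (right_mem_segment _ _ _))
      (by simpa [-add_sub_cancel_left] using (det2_start_pos hu ht).ne') rfl
  · rw [hc]
    apply mem_connectedComponentIn
    have h2 := det2_start_pos (p := p) (neg_ne_zero.2 hu) ht'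
    rw [e] at h2
    refine subset_diff_chord (X := {p - t' • rotJ u}) (by
      simpa using h' (right_mem_segment _ _ _)) ?_ rfl
    rintro z rfl h0
    rw [det2_neg_left, h0] at h2
    simp at h2

lemma exists_ball_sides (hu : u ≠ 0) {w : Pt} (hw : w ∈ chord O p u) :
    ∃ ε > 0, Metric.ball w ε ⊆ O ∧ ∀ z ∈ Metric.ball w ε,
      (0 < det2 u (z - w) → z ∈ leftSide O p u) ∧
      (det2 u (z - w) < 0 → z ∈ leftSide O p (-u)) ∧
      (det2 u (z - w) = 0 → z ∈ chord O p u) := by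
  obtain ⟨ε, hε, hb, h⟩ := exists_ball_left hO.isOpen hu hw
  obtain ⟨ε', hε', -, h'⟩ := exists_ball_left hO.isOpen (neg_ne_zero.2 hu)
    (by rwa [chord_neg] : w ∈ chord O p (-u))
  refine ⟨min ε ε', lt_min hε hε', (Metric.ball_subset_ball (min_le_left _ _)).trans hb,
    fun z hz => ⟨h z (Metric.ball_subset_ball (min_le_left _ _) hz), fun hz' =>
      h' z (Metric.ball_subset_ball (min_le_right _ _) hz) (by rw [det2_neg_left]; linarith),
      fun h0 => ?_⟩⟩
  refine chord_inter_segment hu hw ?_ (((convex_ball w ε).segment_subset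
    (Metric.mem_ball_self hε) (Metric.ball_subset_ball (min_le_left _ _) hz)).trans hb)
  have : z - p = (z - w) + (w - p) := by abel
  rw [this, det2_add_right, h0, det2_of_mem_chord hw, add_zero]

/-- A chord splits the domain into its two sides. -/
lemma mem_sides (hp : p ∈ O) (hu : u ≠ 0) {z : Pt} (hz : z ∈ O) :
    z ∈ leftSide O p u ∨ z ∈ chord O p u ∨ z ∈ leftSide O p (-u) := by
  by_contra hcon
  push Not at hcon
  set U := leftSide O p u ∪ chord O p u ∪ leftSide O p (-u) with hU
  have hUo : IsOpen U := by
    rw [isOpen_iff_mem_nhds]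
    rintro w ((hw | hw) | hw)
    · filter_upwards [(isOpen_leftSide hO.isOpen hu).mem_nhds hw] with y hy
      exact Or.inl (Or.inl hy)
    · obtain ⟨ε, hε, -, h⟩ := hO.exists_ball_sides hu hw
      filter_upwards [Metric.ball_mem_nhds w hε] with y hy
      obtain ⟨h1, h2, h3⟩ := h y hy
      rcases lt_trichotomy (det2 u (y - w)) 0 with hlt | heq | hgt
      · exact Or.inr (h2 hlt)
      · exact Or.inl (Or.inr (h3 heq))
      · exact Or.inl (Or.inl (h1 hgt))
    · filter_upwards [(isOpen_leftSide hO.isOpen (neg_ne_zero.2 hu)).mem_nhds hw] with y hy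
      exact Or.inr hy
  obtain ⟨t, ht, h⟩ := exists_left_start hO.isOpen hp (rotJ u)
  obtain ⟨t', ht', h'⟩ := exists_left_start hO.isOpen hp (rotJ (-u))
  set V := {y ∈ O \ chord O p u | y ∉ U}
  have hVo : IsOpen V := by
    have : V = ⋃ y ∈ V, connectedComponentIn (O \ chord O p u) y := by
      refine Set.Subset.antisymm (fun y hy => Set.mem_biUnion hy (mem_connectedComponentIn hy.1)) ?_
      refine Set.iUnion₂_subset fun y hy x hx => ?_
      have hxo := connectedComponentIn_subset _ _ hx
      refine ⟨hxo, ?_⟩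
      have hyU := hy.2
      rintro ((hxU | hxU) | hxU)
      · rw [leftSide_eq hu ht h] at hxU
        apply hyU
        refine Or.inl (Or.inl ?_)
        rw [leftSide_eq hu ht h, connectedComponentIn_eq hxU, ← connectedComponentIn_eq hx]
        exact mem_connectedComponentIn hy.1
      · exact hxo.2 hxU
      · rw [leftSide_eq (neg_ne_zero.2 hu) ht' h', chord_neg] at hxU
        apply hyU
        refine Or.inr ?_
        rw [leftSide_eq (neg_ne_zero.2 hu) ht' h', chord_neg, connectedComponentIn_eq hxU,
          ← connectedComponentIn_eq hx]
        exact mem_connectedComponentIn hy.1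
    rw [this]
    exact isOpen_biUnion fun y _ => (isOpen_diff_chord hO.isOpen hu).connectedComponentIn
  obtain ⟨y, -, hyU, hyV⟩ := hO.isPreconnected U V hUo hVo (fun y hy => by
    by_cases hyU : y ∈ U
    · exact Or.inl hyU
    · exact Or.inr ⟨⟨hy, fun hc => hyU (Or.inl (Or.inr hc))⟩, hyU⟩)
    ⟨p, hp, Or.inl (Or.inr (mem_chord_self hp))⟩ ⟨z, hz, ⟨hz, hcon.2.1⟩, by
      rintro ((hh | hh) | hh)
      exacts [hcon.1 hh, hcon.2.1 hh, hcon.2.2 hh]⟩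
  exact hyV.2 hyU

end ChordDomain

namespace SimplePolygon
variable {P : SimplePolygon}

lemma mem_boundary_of_mem_closure {e : Pt} (he : e ∈ closure P.interior) (h : e ∉ P.interior) :
    e ∈ P.boundary := by
  by_contra hb
  obtain ⟨ε, hε, hball⟩ := Metric.isOpen_iff.1 P.isClosed_boundary.isOpen_compl e hb
  obtain ⟨x, hx, hxe⟩ := Metric.mem_closure_iff.1 he ε hε
  exact h (subset_interior (convex_ball e ε).isPreconnected
    (Set.disjoint_left.2 fun z hz hzb => hball hz hzb) (by rwa [Metric.mem_ball, dist_comm]) hx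
    (Metric.mem_ball_self hε))

lemma exists_chord_end (hP : P.Nondegenerate) {p u : Pt} (hp : p ∈ P.interior) (hu : u ≠ 0) :
    ∃ s : ℝ, 0 < s ∧ p + s • u ∈ P.boundary ∧ ∀ t, 0 ≤ t → t < s → p + t • u ∈ P.interior := by
  obtain ⟨s, hs, hn, h⟩ := _root_.exists_chord_end P.isOpen_interior (isBounded_interior hP) hp hu
  refine ⟨s, hs, mem_boundary_of_mem_closure ?_ hn, h⟩
  have h1 : s ∈ closure (Set.Ico 0 s) := by
    rw [closure_Ico hs.ne]; exact ⟨hs.le, le_rfl⟩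
  exact map_mem_closure (f := fun t : ℝ => p + t • u) (by fun_prop) h1
    fun t ht => h t ht.1 ht.2

lemma exists_chord_eq (hP : P.Nondegenerate) {p u : Pt} (hp : p ∈ P.interior) (hu : u ≠ 0) :
    ∃ e₁ ∈ P.boundary, ∃ e₂ ∈ P.boundary, ∃ k : ℝ, 0 < k ∧ e₂ - e₁ = k • u ∧
      openSegment ℝ e₁ e₂ = chord P.interior p u := by
  obtain ⟨s₁, hs₁, hb₁, h₁⟩ := exists_chord_end hP hp (neg_ne_zero.2 hu)
  obtain ⟨s₂, hs₂, hb₂, h₂⟩ := exists_chord_end hP hp hu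
  have hin : ∀ s, -s₁ < s → s < s₂ → p + s • u ∈ P.interior := by
    intro s h h'
    rcases le_total 0 s with h0 | h0
    · exact h₂ s h0 h'
    · have := h₁ (-s) (by linarith) (by linarith)
      simpa using this
  have hseg : ∀ s, segment ℝ p (p + s • u) = (fun r : ℝ => p + (r * s) • u) '' Set.Icc 0 1 := by
    intro s
    rw [segment_eq_image_lineMap]
    exact Set.image_congr' fun r => by simp [AffineMap.lineMap_apply, mul_smul, add_comm]
  refine ⟨_, hb₁, _, hb₂, s₁ + s₂, by positivity, by module, ?_⟩
  ext q
  rw [openSegment_eq_image_lineMap]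
  constructor
  · rintro ⟨θ, ⟨h0, h1⟩, rfl⟩
    refine ⟨-s₁ + θ * (s₁ + s₂), ?_, ?_⟩
    · simp only [AffineMap.lineMap_apply, vsub_eq_sub, vadd_eq_add]; module
    · have e : AffineMap.lineMap (p + s₁ • -u) (p + s₂ • u) θ =
          p + (-s₁ + θ * (s₁ + s₂)) • u := by
        simp only [AffineMap.lineMap_apply, vsub_eq_sub, vadd_eq_add]; module
      rw [e, hseg]
      rintro _ ⟨r, ⟨hr0, hr1⟩, rfl⟩
      have hpos : 0 < θ * (s₁ + s₂) := by positivity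
      have hlt : θ * (s₁ + s₂) < s₁ + s₂ := by nlinarith
      apply hin
      · rcases le_total 0 (-s₁ + θ * (s₁ + s₂)) with h | h
        · nlinarith [mul_nonneg hr0 h]
        · nlinarith
      · rcases le_total 0 (-s₁ + θ * (s₁ + s₂)) with h | h
        · nlinarith
        · nlinarith
  · rintro ⟨s, rfl, hs⟩
    have hnot : ∀ r, 0 ≤ r → r ≤ 1 → p + (r * s) • u ∈ P.interior := fun r h0 h1 =>
      hs (by rw [hseg]; exact ⟨r, ⟨h0, h1⟩, rfl⟩)
    have hl : -s₁ < s := by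
      by_contra hcon
      have hs0 : s < 0 := by linarith
      have := hnot (-s₁ / s) (by rw [div_nonneg_iff]; right; constructor <;> linarith)
        (by rw [div_le_one_of_neg hs0]; linarith)
      rw [div_mul_cancel₀ _ hs0.ne, neg_smul, ← smul_neg] at this
      exact this.1 hb₁
    have hr : s < s₂ := by
      by_contra hcon
      have hs0 : 0 < s := by linarith
      have := hnot (s₂ / s) (by positivity) (by rw [div_le_one hs0]; linarith)
      rw [div_mul_cancel₀ _ hs0.ne'] at this
      exact this.1 hb₂
    have hk : s₁ + s₂ ≠ 0 := by positivity
    refine ⟨(s + s₁) / (s₁ + s₂), ⟨div_pos (by linarith) (by linarith), by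
      rw [div_lt_one (by linarith)]; linarith⟩, ?_⟩
    simp only [AffineMap.lineMap_apply, vsub_eq_sub, vadd_eq_add]
    have : p + s₂ • u - (p + s₁ • -u) = (s₁ + s₂) • u := by module
    rw [this, smul_smul, div_mul_cancel₀ _ hk]
    module

lemma ChordLabel.const_on {e₁ e₂ : Pt} {τ : Pt → ℝ} (hτ : P.ChordLabel e₁ e₂ τ) {X : Set Pt}
    (hX : X ⊆ P.region) (hXc : Disjoint X (segment ℝ e₁ e₂)) (hpre : IsPreconnected X) {x y : Pt}
    (hx : x ∈ X) (hy : y ∈ X) : τ x = τ y := by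
  refine hpre.induction₂' (fun a b => τ a = τ b) ?_ (fun a b c _ _ _ h h' => h.trans h') hx hy
  intro a ha
  have := hτ.locally_const a (hX ha) (Set.disjoint_left.1 hXc ha)
  filter_upwards [mem_nhdsWithin_of_mem_nhds this, self_mem_nhdsWithin] with b hb hbX
  have := hb (hX hbX) (Set.disjoint_left.1 hXc hbX)
  exact ⟨this.symm, this⟩

lemma interior_subset_region : P.interior ⊆ P.region := Set.subset_union_right

lemma segment_subset_openSegment_union (e₁ e₂ : Pt) :
    segment ℝ e₁ e₂ = openSegment ℝ e₁ e₂ ∪ {e₁, e₂} := by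
  rw [← insert_endpoints_openSegment]
  ext z; simp [or_comm, or_assoc]

lemma chordDomain_interior (hP : P.Nondegenerate) : ChordDomain P.interior := by
  refine ⟨P.isOpen_interior, isPreconnected_interior hP, isBounded_interior hP, ?_⟩
  intro p hp u hu X hX hpre t t' ht ht' h h' hmem hmem'
  obtain ⟨e₁, hb₁, e₂, hb₂, k, hk, he, hch⟩ := exists_chord_eq hP hp hu
  have hne : e₁ ≠ e₂ := by
    rintro rfl
    rw [sub_self, eq_comm, smul_eq_zero] at he
    exact he.elim hk.ne' hu
  obtain ⟨τ, hτ⟩ := exists_chordLabel hP hb₁ hb₂ hne (by rw [hch]; exact chord_subset)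
  have hdis : ∀ Y ⊆ P.interior \ chord P.interior p u, Disjoint Y (segment ℝ e₁ e₂) := by
    intro Y hY
    rw [segment_subset_openSegment_union, hch, Set.disjoint_left]
    rintro z hz (hz' | rfl | rfl)
    · exact (hY hz).2 hz'
    · exact (hY hz).1.1 hb₁
    · exact (hY hz).1.1 hb₂
  have hcst : ∀ Y ⊆ P.interior \ chord P.interior p u, IsPreconnected Y → ∀ x ∈ Y, ∀ y ∈ Y,
      τ x = τ y := fun Y hY hYp x hx y hy => hτ.const_on (fun z hz => Or.inr (hY hz).1)
        (hdis Y hY) hYp hx hy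
  have hpo : p ∈ openSegment ℝ e₁ e₂ := by rw [hch]; exact mem_chord_self hp
  obtain ⟨ε, hε, hj⟩ := hτ.jump p hpo
  have hdet : ∀ z, det2 (e₂ - e₁) (z - e₁) = k * det2 u (z - p) := by
    intro z
    have := det2_openSegment (openSegment_subset_segment ℝ _ _ hpo)
    have e : z - e₁ = (z - p) + (p - e₁) := by abel
    rw [e, det2_add_right, this, add_zero, he, det2_smul_left]
  have key : ∀ v : Pt, (∀ r : ℝ, 0 < r → det2 u (r • v) ≠ 0) → ∀ t : ℝ, 0 < t →
      segment ℝ p (p + t • v) ⊆ P.interior → ∃ r : ℝ, 0 < r ∧ p + r • v ∈ Metric.ball p ε ∧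
      τ (p + r • v) = τ (p + t • v) := by
    intro v hv t ht hs
    obtain ⟨r, hr, hr1, hm⟩ := exists_small_smul p (t • v) (Metric.ball_mem_nhds p hε)
    rw [smul_smul] at hm
    refine ⟨r * t, by positivity, hm, ?_⟩
    refine hcst ((fun s : ℝ => p + (s * t) • v) '' Set.Icc r 1) ?_ ?_ _ ⟨r, ⟨le_rfl, hr1.le⟩, rfl⟩ _
      ⟨1, ⟨hr1.le, le_rfl⟩, by simp⟩
    · apply subset_diff_chord
      · rintro _ ⟨s, ⟨hs1, hs2⟩, rfl⟩
        apply hs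
        rw [segment_eq_image_lineMap]
        exact ⟨s, ⟨hr.le.trans hs1, hs2⟩, by
          simp [AffineMap.lineMap_apply, mul_smul, add_comm]⟩
      · rintro _ ⟨s, ⟨hs1, hs2⟩, rfl⟩
        rw [add_sub_cancel_left]
        exact hv _ (mul_pos (hr.trans_le hs1) ht)
    · exact isPreconnected_Icc.image _ (by fun_prop)
  have hJ := det2_rotJ_pos hu
  obtain ⟨r, hr, hrb, hrτ⟩ := key (rotJ u) (fun r hr => by
    rw [det2_smul_right]; positivity) t ht h
  obtain ⟨r', hr', hrb', hrτ'⟩ := key (-rotJ u) (fun r hr => by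
    rw [det2_smul_right, det2_neg_right]; exact (by nlinarith : r * -det2 u (rotJ u) < 0).ne) t' ht'
    (by rwa [smul_neg, ← sub_eq_add_neg])
  refine hj _ hrb _ hrb' ?_ ?_ ?_
  · rw [hdet, add_sub_cancel_left, det2_smul_right]; positivity
  · rw [hdet, add_sub_cancel_left, det2_smul_right, det2_neg_right]
    nlinarith [mul_pos hk (mul_pos hr' hJ)]
  · rw [hrτ, hrτ', smul_neg, ← sub_eq_add_neg]
    exact hcst X hX hpre _ hmem _ hmem'

end SimplePolygon

/-- `PolyReach A p q ℓ`: a polygonal path of length `ℓ` inside `A` leads from `p` to `q`. -/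
inductive PolyReach (A : Set Pt) : Pt → Pt → ℝ → Prop
  | refl {a : Pt} (ha : a ∈ A) : PolyReach A a a 0
  | cons {a b c : Pt} {ℓ : ℝ} (h : segment ℝ a b ⊆ A) (h' : PolyReach A b c ℓ) :
      PolyReach A a c (dist a b + ℓ)

namespace PolyReach
variable {A : Set Pt} {a b c : Pt} {ℓ ℓ' : ℝ}

lemma trans (h : PolyReach A a b ℓ) (h' : PolyReach A b c ℓ') : PolyReach A a c (ℓ + ℓ') := by
  induction h with
  | refl _ => simpa using h'
  | cons hs _ ih => rw [add_assoc]; exact cons hs (ih h')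

lemma of_segment (h : segment ℝ a b ⊆ A) : PolyReach A a b (dist a b) := by
  simpa using cons h (refl (h (right_mem_segment _ _ _)))

lemma symm (h : PolyReach A a b ℓ) : PolyReach A b a ℓ := by
  induction h with
  | refl h => exact refl h
  | cons hs _ ih =>
    rw [add_comm, dist_comm]
    exact ih.trans (of_segment (by rwa [segment_symm]))

lemma dist_le (h : PolyReach A a b ℓ) : dist a b ≤ ℓ := by
  induction h with
  | refl => simp
  | cons _ _ ih => exact (dist_triangle _ _ _).trans (by gcongr)

lemma eVariationOn_lineMap_le (a b : Pt) :
    eVariationOn (AffineMap.lineMap a b : ℝ → Pt) (Set.Icc 0 1) ≤ ENNReal.ofReal (dist a b) := by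
  have h1 : LipschitzWith (nndist a b) (AffineMap.lineMap a b : ℝ → Pt) := lipschitzWith_lineMap a b
  have h2 := (h1.lipschitzOnWith (s := Set.univ)).comp_eVariationOn_le
    (Set.mapsTo_univ (id : ℝ → ℝ) (Set.Icc 0 1))
  have h3 : eVariationOn (id : ℝ → ℝ) (Set.Icc 0 1) ≤ 1 := by
    have := (monotoneOn_id (s := Set.Icc (0 : ℝ) 1)).eVariationOn_eq
      (Set.left_mem_Icc.2 zero_le_one) (Set.right_mem_Icc.2 zero_le_one)
    rw [Set.inter_self] at this
    rw [this]
    simp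
  calc _ ≤ (nndist a b : ℝ≥0∞) * eVariationOn (id : ℝ → ℝ) (Set.Icc 0 1) := h2
    _ ≤ (nndist a b : ℝ≥0∞) * 1 := by gcongr
    _ = _ := by rw [mul_one, ← edist_nndist, edist_dist]

lemma exists_path (h : PolyReach A a b ℓ) : ∃ γ : ℝ → Pt, ContinuousOn γ (Set.Icc 0 1) ∧
    γ 0 = a ∧ γ 1 = b ∧ γ '' Set.Icc (0 : ℝ) 1 ⊆ A ∧
    eVariationOn γ (Set.Icc 0 1) ≤ ENNReal.ofReal ℓ := by
  induction h with
  | refl h =>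
    refine ⟨fun _ => _, continuousOn_const, rfl, rfl, ?_, ?_⟩
    · rintro _ ⟨_, -, rfl⟩; exact h
    · rw [eVariationOn.constant_on]
      · simp
      · rintro _ ⟨_, -, rfl⟩ _ ⟨_, -, rfl⟩; rfl
  | @cons a b c ℓ hs hr ih =>
    obtain ⟨γ, hc, h0, h1, hA, hv⟩ := ih
    set δ : ℝ → Pt := fun t => if t ≤ 1 / 2 then AffineMap.lineMap a b (2 * t) else γ (2 * t - 1)
      with hδ
    have e1 : Set.EqOn δ ((AffineMap.lineMap a b : ℝ → Pt) ∘ fun t => 2 * t)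
        (Set.Icc 0 (1 / 2)) := fun t ht => by simp only [hδ, ht.2, if_true]; rfl
    have e2 : Set.EqOn δ (γ ∘ fun t => 2 * t - 1) (Set.Icc (1 / 2) 1) := by
      intro t ht
      rcases ht.1.eq_or_lt with rfl | h
      · simp [hδ, h0]
      · simp only [hδ, not_le.2 h, if_false]; rfl
    have m1 : Set.MapsTo (fun t : ℝ => 2 * t) (Set.Icc 0 (1 / 2)) (Set.Icc 0 1) :=
      fun t ht => ⟨by linarith [ht.1], by linarith [ht.2]⟩
    have m2 : Set.MapsTo (fun t : ℝ => 2 * t - 1) (Set.Icc (1 / 2) 1) (Set.Icc 0 1) :=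
      fun t ht => ⟨by linarith [ht.1], by linarith [ht.2]⟩
    have hun : Set.Icc (0 : ℝ) 1 = Set.Icc 0 (1 / 2) ∪ Set.Icc (1 / 2) 1 :=
      (Set.Icc_union_Icc_eq_Icc (by norm_num) (by norm_num)).symm
    refine ⟨δ, ?_, by simp [hδ], ?_, ?_, ?_⟩
    · rw [hun]
      refine ContinuousOn.union_of_isClosed ?_ ?_ isClosed_Icc isClosed_Icc
      · refine ContinuousOn.congr ?_ e1
        exact (AffineMap.lineMap_continuous.comp (by fun_prop)).continuousOn
      · refine ContinuousOn.congr ?_ e2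
        exact hc.comp (by fun_prop) m2
    · rw [e2 (by norm_num)]; norm_num [h1]
    · rw [hun, Set.image_union]
      refine Set.union_subset ?_ ?_
      · rw [e1.image_eq]
        rintro _ ⟨t, ht, rfl⟩
        apply hs
        rw [segment_eq_image_lineMap]
        exact ⟨_, m1 ht, rfl⟩
      · rw [e2.image_eq]
        rintro _ ⟨t, ht, rfl⟩
        exact hA ⟨_, m2 ht, rfl⟩
    · have hl := hr.dist_le
      have hsp := eVariationOn.Icc_add_Icc δ (s := Set.univ) (a := 0) (b := 1 / 2) (c := (1 : ℝ))
        (by norm_num) (by norm_num) trivial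
      simp only [Set.univ_inter] at hsp
      rw [← hsp, ENNReal.ofReal_add dist_nonneg (dist_nonneg.trans hl),
        eVariationOn.eq_of_eqOn e1, eVariationOn.eq_of_eqOn e2]
      refine add_le_add ?_ ?_
      · refine (eVariationOn.comp_le_of_monotoneOn _ _ ?_ m1).trans (eVariationOn_lineMap_le a b)
        exact fun x _ y _ hxy => by linarith
      · refine (eVariationOn.comp_le_of_monotoneOn _ _ ?_ m2).trans hv
        exact fun x _ y _ hxy => by linarith

/-- A polygonal path leaving a set passes through its exit set. -/
lemma exists_exit {C E : Set Pt}
    (hex : ∀ a ∈ C, ∀ b ∉ C, segment ℝ a b ⊆ A → ∃ y ∈ segment ℝ a b, y ∈ E)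
    (h : PolyReach A a b ℓ) (ha : a ∈ C) (hb : b ∉ C) :
    ∃ y ∈ E, ∃ ℓ', PolyReach A a y ℓ' ∧ ℓ' + dist y b ≤ ℓ := by
  induction h with
  | refl => exact absurd ha hb
  | @cons a b c ℓ hs hr ih =>
    by_cases hbC : b ∈ C
    · obtain ⟨y, hy, ℓ', h1, h2⟩ := ih hbC hb
      exact ⟨y, hy, _, cons hs h1, by linarith⟩
    · obtain ⟨y, hy, hyE⟩ := hex a ha b hbC hs
      refine ⟨y, hyE, _, of_segment
        (((convex_segment _ _).segment_subset (left_mem_segment _ _ _) hy).trans hs), ?_⟩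
      have h1 := dist_add_dist_of_mem_segment hy
      have h2 := hr.dist_le
      have h3 := dist_triangle y b c
      linarith

lemma of_list {L : List Pt} {p q z : Pt} (hp : L.head? = some p) (hq : L.getLast? = some q)
    (hA : polylineSet L ⊆ A) (hz : z ∈ polylineSet L) :
    ∃ ℓ₁ ℓ₂, PolyReach A p z ℓ₁ ∧ PolyReach A z q ℓ₂ ∧ ℓ₁ + ℓ₂ = polylineLen L := by
  induction L generalizing p z with
  | nil => simp at hp
  | cons a L ih =>
    obtain rfl : a = p := by simpa using hp
    cases L with
    | nil =>
      obtain rfl : a = q := by simpa using hq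
      obtain rfl : z = a := by simpa [polylineSet] using hz
      exact ⟨0, 0, refl (hA hz), refl (hA hz), by simp [polylineLen]⟩
    | cons b L =>
      have hs : segment ℝ a b ⊆ A := Set.subset_union_left.trans hA
      have hA' : polylineSet (b :: L) ⊆ A := Set.subset_union_right.trans hA
      have hq' : (b :: L).getLast? = some q := by
        rw [List.getLast?_cons_cons] at hq; exact hq
      rcases hz with hz | hz
      · have hb : b ∈ polylineSet (b :: L) := by
          cases L with
          | nil => simp [polylineSet]
          | cons c L => exact Or.inl (left_mem_segment _ _ _)
        obtain ⟨ℓ₁, ℓ₂, h1, h2, h3⟩ := ih (p := b) rfl hq' hA' (z := b) hb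
        refine ⟨dist a z, dist z b + (ℓ₁ + ℓ₂), of_segment
          (((convex_segment _ _).segment_subset (left_mem_segment _ _ _) hz).trans hs),
          cons (((convex_segment _ _).segment_subset hz (right_mem_segment _ _ _)).trans hs)
            (h1.trans h2), ?_⟩
        have := dist_add_dist_of_mem_segment hz
        simp only [polylineLen]
        linarith
      · obtain ⟨ℓ₁, ℓ₂, h1, h2, h3⟩ := ih (p := b) rfl hq' hA' hz
        exact ⟨_, ℓ₂, cons hs h1, h2, by simp only [polylineLen]; linarith⟩

lemma geodDist_le {P : SimplePolygon} (h : PolyReach P.region a b ℓ) :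
    P.geodDist a b ≤ ENNReal.ofReal ℓ := by
  obtain ⟨γ, h1, h2, h3, h4, h5⟩ := h.exists_path
  exact (iInf₂_le γ ⟨h1, h2, h3, h4⟩).trans h5

end PolyReach

/-- A set which can only be left through a segment it contains is geodesically convex. -/
lemma geodesicallyConvex_of_exit {P : SimplePolygon} {C : Set Pt} {e₁ e₂ : Pt}
    (hC : C ⊆ P.region) (hE : segment ℝ e₁ e₂ ⊆ C)
    (hex : ∀ a ∈ C, ∀ b ∉ C, segment ℝ a b ⊆ P.region → ∃ y ∈ segment ℝ a b, y ∈ segment ℝ e₁ e₂) :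
    GeodesicallyConvex P C := by
  refine ⟨hC, fun p hp q hq L ⟨h1, h2, _, _, h5, h6⟩ z hz => ?_⟩
  by_contra hzC
  obtain ⟨ℓ₁, ℓ₂, r1, r2, hl⟩ := PolyReach.of_list h1 h2 h5 hz
  obtain ⟨y₁, hy₁, ℓ₁', s1, hl1⟩ := r1.exists_exit hex hp hzC
  obtain ⟨y₂, hy₂, ℓ₂', s2, hl2⟩ := r2.symm.exists_exit hex hq hzC
  have hsub := (convex_segment _ _).segment_subset hy₁ hy₂
  have hr := (s1.trans (PolyReach.of_segment (hsub.trans (hE.trans hC)))).trans s2.symm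
  have hlt : dist y₁ y₂ < dist y₁ z + dist z y₂ := by
    refine (dist_triangle _ _ _).lt_of_ne fun h => hzC (hE (hsub ?_))
    exact mem_segment_iff_wbtw.2 (dist_add_dist_eq_iff.1 h.symm)
  have := hr.geodDist_le
  rw [← h6, ENNReal.ofReal_le_ofReal_iff (hr.dist_le.trans' dist_nonneg), ← hl] at this
  rw [dist_comm z y₂] at hlt
  linarith

namespace SimplePolygon
variable {P : SimplePolygon}

lemma leftSide_inter_nonempty_of_hull (hP : P.Nondegenerate) {S : Set Pt} (hS : S ⊆ P.interior)
    {p u : Pt} (hp : p ∈ P.interior) (hpK : p ∈ _root_.interior (geodesicHull P S)) (hu : u ≠ 0) :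
    (leftSide P.interior p u ∩ S).Nonempty := by
  by_contra hemp
  have hO := chordDomain_interior hP
  obtain ⟨e₁, hb₁, e₂, hb₂, k, hk, he, hch⟩ := exists_chord_eq hP hp hu
  have hne : e₁ ≠ e₂ := by
    rintro rfl
    rw [sub_self, eq_comm, smul_eq_zero] at he
    exact he.elim hk.ne' hu
  have hsub : openSegment ℝ e₁ e₂ ⊆ P.interior := by rw [hch]; exact chord_subset
  obtain ⟨τ, hτ⟩ := exists_chordLabel hP hb₁ hb₂ hne hsub
  have hpo : p ∈ openSegment ℝ e₁ e₂ := by rw [hch]; exact mem_chord_self hp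
  have hdet : ∀ z, det2 (e₂ - e₁) (z - e₁) = k * det2 u (z - p) := by
    intro z
    have := det2_openSegment (openSegment_subset_segment ℝ _ _ hpo)
    have e : z - e₁ = (z - p) + (p - e₁) := by abel
    rw [e, det2_add_right, this, add_zero, he, det2_smul_left]
  obtain ⟨ε, hε, hj⟩ := hτ.jump p hpo
  obtain ⟨δ, hδ, hδO, hside⟩ := hO.exists_ball_sides hu (mem_chord_self hp)
  obtain ⟨s', hs', -, hm'⟩ := exists_small_smul p (rotJ (-u))
    (Metric.ball_mem_nhds p (lt_min hε hδ))
  have hdneg : det2 u (p + s' • rotJ (-u) - p) < 0 := by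
    have := det2_start_pos (p := p) (neg_ne_zero.2 hu) hs'
    rw [det2_neg_left] at this; linarith
  have hR := (hside _ (Metric.ball_subset_ball (min_le_right _ _) hm')).2.1 hdneg
  set c₀ := τ (p + s' • rotJ (-u)) with hc₀
  have hEreg : segment ℝ e₁ e₂ ⊆ P.region := by
    rw [segment_subset_openSegment_union]
    rintro z (hz | rfl | rfl)
    exacts [Or.inr (hsub hz), Or.inl hb₁, Or.inl hb₂]
  have hdisj : ∀ X ⊆ P.interior \ chord P.interior p u, Disjoint X (segment ℝ e₁ e₂) := by
    intro X hX
    rw [segment_subset_openSegment_union, hch, Set.disjoint_left]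
    rintro z hz (hz' | rfl | rfl)
    · exact (hX hz).2 hz'
    · exact (hX hz).1.1 hb₁
    · exact (hX hz).1.1 hb₂
  set C := {z ∈ P.region | z ∈ segment ℝ e₁ e₂ ∨ τ z = c₀} with hC
  have hconv : GeodesicallyConvex P C := by
    refine geodesicallyConvex_of_exit (fun z hz => hz.1) (fun z hz => ⟨hEreg hz, Or.inl hz⟩) ?_
    intro a ha b hb hab
    by_contra hno
    push Not at hno
    have hbE := hno b (right_mem_segment _ _ _)
    have haE := hno a (left_mem_segment _ _ _)
    apply hb
    refine ⟨hab (right_mem_segment _ _ _), Or.inr ?_⟩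
    rw [← ha.2.resolve_left haE]
    exact hτ.const_on hab (Set.disjoint_left.2 hno) (convex_segment _ _).isPreconnected
      (right_mem_segment _ _ _) (left_mem_segment _ _ _)
  have hSC : S ⊆ C := by
    intro s hs
    refine ⟨Or.inr (hS hs), ?_⟩
    rcases hO.mem_sides hp hu (hS hs) with h | h | h
    · exact absurd ⟨s, h, hs⟩ hemp
    · rw [← hch] at h; exact Or.inl (openSegment_subset_segment _ _ _ h)
    · right
      have hd := leftSide_subset_diff (O := P.interior) (p := p) (u := -u)
      rw [chord_neg] at hd
      exact hτ.const_on (leftSide_subset.trans interior_subset_region) (hdisj _ hd)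
        (isPreconnected_leftSide hO.isOpen hp (neg_ne_zero.2 hu)) h hR
  have hKC : geodesicHull P S ⊆ C := Set.sInter_subset_of_mem ⟨hconv, hSC⟩
  obtain ⟨s, hs, -, hm, hmK⟩ := exists_small_smul p (rotJ u) (Filter.inter_mem
    (Metric.ball_mem_nhds p (lt_min hε hδ)) (mem_interior_iff_mem_nhds.1 hpK))
  have hdp := det2_start_pos (p := p) hu hs
  rcases (hKC hmK).2 with h | h
  · have := det2_openSegment h
    rw [hdet] at this
    exact (mul_pos hk hdp).ne' this
  · exact hj _ (Metric.ball_subset_ball (min_le_left _ _) hm) _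
      (Metric.ball_subset_ball (min_le_left _ _) hm') (by rw [hdet]; positivity)
      (by rw [hdet]; exact mul_neg_of_pos_of_neg hk hdneg) h

end SimplePolygon

section
variable {O : Set Pt} {p q u : Pt}

lemma isPreconnected_chord : IsPreconnected (chord O p u) := by
  by_cases hp : p ∈ O
  · refine isPreconnected_of_forall p fun q hq => ?_
    exact ⟨segment ℝ p q, segment_subset_chord hq, left_mem_segment _ _ _,
      right_mem_segment _ _ _, (convex_segment _ _).isPreconnected⟩
  · have : chord O p u = ∅ := by
      rw [Set.eq_empty_iff_forall_notMem]
      rintro q ⟨_, -, h⟩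
      exact hp (h (left_mem_segment _ _ _))
    rw [this]; exact isPreconnected_empty

lemma subset_leftSide (hO : IsOpen O) (hp : p ∈ O) (hu : u ≠ 0) {X : Set Pt} (hX : X ⊆ O)
    (hXc : Disjoint X (chord O p u)) (hpre : IsPreconnected X) {x : Pt} (hx : x ∈ X)
    (hxl : x ∈ leftSide O p u) : X ⊆ leftSide O p u := by
  obtain ⟨t, ht, h⟩ := exists_left_start hO hp (rotJ u)
  rw [leftSide_eq hu ht h] at hxl ⊢
  rw [connectedComponentIn_eq hxl]
  exact hpre.subset_connectedComponentIn hx fun z hz => ⟨hX hz, Set.disjoint_left.1 hXc hz⟩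

lemma mem_leftSide_of_segment (hO : IsOpen O) (hu : u ≠ 0) (h : segment ℝ p q ⊆ O)
    (hd : 0 < det2 u (q - p)) : q ∈ leftSide O p u := by
  have hp := h (left_mem_segment _ _ _)
  obtain ⟨ε, hε, -, hl⟩ := exists_ball_left hO hu (mem_chord_self hp)
  obtain ⟨s, hs, hs1, hm⟩ := exists_small_smul p (q - p) (Metric.ball_mem_nhds p hε)
  have hd' : 0 < det2 u (p + s • (q - p) - p) := by
    rw [add_sub_cancel_left, det2_smul_right]; positivity
  have hseg : p + s • (q - p) ∈ segment ℝ p q := by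
    rw [segment_eq_image_lineMap]
    exact ⟨s, ⟨hs.le, hs1.le⟩, by simp [AffineMap.lineMap_apply, add_comm]⟩
  refine subset_leftSide hO hp hu
    (((convex_segment _ _).segment_subset hseg (right_mem_segment _ _ _)).trans h) ?_
    (convex_segment _ _).isPreconnected (left_mem_segment _ _ _) (hl _ hm hd')
    (right_mem_segment _ _ _)
  rw [Set.disjoint_left]
  intro z hz hc
  exact (ne_of_gt ((det2_pos_convex u p).segment_subset hd' hd hz)) (det2_of_mem_chord hc)

lemma leftSide_neg_disjoint_of_subset (hO : ChordDomain O) (hp : p ∈ O) (hu : u ≠ 0) {X : Set Pt}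
    (h : X ⊆ leftSide O p (-u)) : Disjoint X (leftSide O p u) :=
  (hO.disjoint_sides hp hu).symm.mono_left h

lemma mem_closure_leftSide (hO : IsOpen O) (hu : u ≠ 0) (hq : q ∈ chord O p u) {U : Set Pt}
    (hU : U ∈ nhds q) : (leftSide O p u ∩ U).Nonempty := by
  obtain ⟨ε, hε, -, hl⟩ := exists_ball_left hO hu hq
  obtain ⟨s, hs, -, hm, hmU⟩ := exists_small_smul q (rotJ u)
    (Filter.inter_mem (Metric.ball_mem_nhds q hε) hU)
  exact ⟨_, hl _ hm (det2_start_pos hu hs), hmU⟩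
end

namespace ChordDomain
variable {O : Set Pt} {p q u : Pt} (hO : ChordDomain O)
include hO

lemma leftSide_subset_of_disjoint {w : Pt} (hp : p ∈ O) (hu : u ≠ 0) (hw : w ≠ 0)
    (hq : q ∈ leftSide O p u) (hd : Disjoint (chord O p u) (leftSide O q w)) :
    leftSide O q w ⊆ leftSide O p u := by
  have hqO := leftSide_subset hq
  obtain ⟨y, hy, hyU⟩ := mem_closure_leftSide hO.isOpen hw (mem_chord_self hqO)
    ((isOpen_leftSide hO.isOpen hu).mem_nhds hq)
  exact subset_leftSide hO.isOpen hp hu leftSide_subset hd.symm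
    (isPreconnected_leftSide hO.isOpen hqO hw) hy hyU

/-- Of the two sides of a parallel chord inside a side, one is contained in that side. -/
lemma exists_parallel_side (hp : p ∈ O) (hu : u ≠ 0) (hq : q ∈ leftSide O p u) :
    ∃ w, (w = u ∨ w = -u) ∧ leftSide O q w ⊆ leftSide O p u := by
  have hqO := leftSide_subset hq
  have hqc := (leftSide_subset_diff hq).2
  have hdis : Disjoint (chord O p u) (chord O q u) := by
    rw [Set.disjoint_left]
    intro z hz hz'
    apply hqc
    rw [← chord_eq_of_mem hu hz, chord_eq_of_mem hu hz']
    exact mem_chord_self hqO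
  have hpc : p ∉ chord O q u := Set.disjoint_left.1 hdis (mem_chord_self hp)
  rcases hO.mem_sides hqO hu hp with h | h | h
  · refine ⟨-u, Or.inr rfl, hO.leftSide_subset_of_disjoint hp hu (neg_ne_zero.2 hu) hq ?_⟩
    exact (hO.disjoint_sides hqO hu).mono_left (subset_leftSide hO.isOpen hqO hu chord_subset hdis
      isPreconnected_chord (mem_chord_self hp) h)
  · exact absurd h hpc
  · refine ⟨u, Or.inl rfl, hO.leftSide_subset_of_disjoint hp hu hu hq ?_⟩
    exact leftSide_neg_disjoint_of_subset hO hqO hu (subset_leftSide hO.isOpen hqO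
      (neg_ne_zero.2 hu) chord_subset (by rwa [chord_neg])
      isPreconnected_chord (mem_chord_self hp) h)

/-- If every chord through a nonextreme point has points of `S` on both sides, then such chords
have points of `B` on both sides. -/
lemma leftSide_inter_nonempty {S B : Finset Pt} {A : Set Pt} (hA : A ⊆ O)
    (hSA : ∀ s ∈ S, s ∉ B → s ∈ A)
    (h : ∀ p ∈ A, ∀ u ≠ 0, (leftSide O p u ∩ (S : Set Pt)).Nonempty) :
    ∀ p ∈ A, ∀ u ≠ 0, (leftSide O p u ∩ (B : Set Pt)).Nonempty := by
  suffices H : ∀ n, ∀ p ∈ A, ∀ u ≠ 0, (S.filter (· ∈ leftSide O p u)).card = n →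
      (leftSide O p u ∩ (B : Set Pt)).Nonempty from fun p hp u hu => H _ p hp u hu rfl
  intro n
  induction n using Nat.strong_induction_on with
  | _ n ih =>
    intro p hp u hu hn
    obtain ⟨s, hs, hsS⟩ := h p hp u hu
    by_cases hsB : s ∈ B
    · exact ⟨s, hs, hsB⟩
    have hsA := hSA s hsS hsB
    obtain ⟨w, hw, hsub⟩ := hO.exists_parallel_side (hA hp) hu hs
    have hw0 : w ≠ 0 := by
      rcases hw with rfl | rfl
      exacts [hu, neg_ne_zero.2 hu]
    refine (ih _ ?_ s hsA w hw0 rfl).mono (Set.inter_subset_inter_left _ hsub)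
    rw [← hn]
    refine Finset.card_lt_card (Finset.ssubset_iff_subset_ne.2 ⟨?_, fun heq => ?_⟩)
    · intro z hz
      rw [Finset.mem_filter] at hz ⊢
      exact ⟨hz.1, hsub hz.2⟩
    · have hmem : s ∈ S.filter (· ∈ leftSide O p u) := Finset.mem_filter.2 ⟨hsS, hs⟩
      rw [← heq, Finset.mem_filter] at hmem
      exact (leftSide_subset_diff hmem.2).2 (mem_chord_self (hA hsA))

end ChordDomain

/-- The points of `O` all of whose chords have points of `B` on both sides. -/
def kernelSet (O B : Set Pt) : Set Pt := {p ∈ O | ∀ u ≠ 0, (leftSide O p u ∩ B).Nonempty}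

namespace ChordDomain
variable {O B : Set Pt} {p q u : Pt} (hO : ChordDomain O)
include hO

lemma notMem_kernelSet_left (hu : u ≠ 0) (h : ¬ (leftSide O p u ∩ B).Nonempty)
    (hp : p ∈ O) (hq : q ∈ leftSide O p u) : q ∉ kernelSet O B := by
  intro hN
  obtain ⟨w, hw, hsub⟩ := hO.exists_parallel_side hp hu hq
  have hw0 : w ≠ 0 := by
    rcases hw with rfl | rfl
    exacts [hu, neg_ne_zero.2 hu]
  exact h ((hN.2 w hw0).mono (Set.inter_subset_inter_left _ hsub))

lemma notMem_kernelSet_chord (hu : u ≠ 0) (h : ¬ (leftSide O p u ∩ B).Nonempty)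
    (hp : p ∈ O) (hq : q ∈ chord O p u) : q ∉ kernelSet O B := by
  intro hN
  have := hN.2 u hu
  rw [leftSide_eq_of_mem hO.isOpen hp hu hq] at this
  exact h this

lemma kernelSet_segment (hp : p ∈ kernelSet O B) (hq : q ∈ kernelSet O B)
    (h : segment ℝ p q ⊆ O) : segment ℝ p q ⊆ kernelSet O B := by
  intro x hx
  refine ⟨h hx, fun u hu => ?_⟩
  by_contra hno
  have hxO := h hx
  have aux : ∀ y ∈ kernelSet O B, segment ℝ x y ⊆ O → det2 u (y - x) < 0 := by
    intro y hy hs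
    by_contra hcon
    rcases (not_lt.1 hcon).eq_or_lt with h0 | h0
    · exact hO.notMem_kernelSet_chord hu hno hxO ((mem_chord_iff hu).2 ⟨h0.symm, hs⟩) hy
    · exact hO.notMem_kernelSet_left hu hno hxO (mem_leftSide_of_segment hO.isOpen hu hs h0) hy
  have h1 := aux p hp (((convex_segment _ _).segment_subset hx (left_mem_segment _ _ _)).trans h)
  have h2 := aux q hq (((convex_segment _ _).segment_subset hx (right_mem_segment _ _ _)).trans h)
  obtain ⟨a, b, ha, hb, hab, rfl⟩ := hx
  have e : a * det2 u (p - (a • p + b • q)) + b * det2 u (q - (a • p + b • q)) = 0 := by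
    simp only [det2, PiLp.sub_apply, PiLp.add_apply, PiLp.smul_apply, smul_eq_mul]
    obtain rfl : b = 1 - a := by linarith
    ring
  rcases ha.eq_or_lt with rfl | ha'
  · obtain rfl : b = 1 := by linarith
    simp at h2
  · nlinarith [mul_neg_of_pos_of_neg ha' h1]

lemma interior_kernelSet_segment (hp : p ∈ interior (kernelSet O B)) (hq : q ∈ kernelSet O B)
    (h : segment ℝ p q ⊆ O) {z : Pt} (hz : z ∈ segment ℝ p q) (hzq : z ≠ q) :
    z ∈ interior (kernelSet O B) := by
  rw [segment_symm, segment_eq_image_lineMap] at hz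
  obtain ⟨θ, ⟨h0, h1⟩, rfl⟩ := hz
  have hθ : 0 < θ := by
    rcases h0.eq_or_lt with rfl | h0
    · simp at hzq
    · exact h0
  have hcpt : IsCompact (segment ℝ q p) := by
    rw [segment_eq_image_lineMap]
    exact isCompact_Icc.image AffineMap.lineMap_continuous
  obtain ⟨ε, hε, hth⟩ := hcpt.exists_thickening_subset_open hO.isOpen (by rwa [segment_symm])
  have hcont : ContinuousAt (fun z : Pt => q + θ⁻¹ • (z - q)) (AffineMap.lineMap q p θ) := by
    fun_prop
  have hval : q + θ⁻¹ • (AffineMap.lineMap q p θ - q) = p := by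
    simp [AffineMap.lineMap_apply, smul_smul, inv_mul_cancel₀ hθ.ne']
  rw [mem_interior_iff_mem_nhds] at hp ⊢
  have hev := hcont.preimage_mem_nhds (t := kernelSet O B ∩ Metric.ball p ε) (by
    rw [hval]; exact Filter.inter_mem hp (Metric.ball_mem_nhds p hε))
  filter_upwards [hev] with z hz
  have hzs : z ∈ segment ℝ q (q + θ⁻¹ • (z - q)) := by
    rw [segment_eq_image_lineMap]
    refine ⟨θ, ⟨hθ.le, h1⟩, ?_⟩
    simp [AffineMap.lineMap_apply, smul_smul, mul_inv_cancel₀ hθ.ne']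
  refine hO.kernelSet_segment hq hz.1 (Set.Subset.trans ?_ hth) hzs
  exact ((convex_segment _ _).thickening ε).segment_subset
    (Metric.ball_subset_thickening (left_mem_segment _ _ _) ε (Metric.mem_ball_self hε))
    (Metric.ball_subset_thickening (right_mem_segment _ _ _) ε hz.2)

/-- Two sides, neither containing the base point of the other, and whose chords do not cross in
the kernel set, have no point of `B` or of the kernel set in common. -/
lemma sides_disjoint {m m' u' : Pt} (hu : u ≠ 0) (hu' : u' ≠ 0) (hm : m ∈ kernelSet O B)
    (hm' : m' ∈ kernelSet O B) (h : m' ∉ leftSide O m u) (h' : m ∉ leftSide O m' u')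
    (hcc : ∀ x ∈ chord O m u, x ∈ chord O m' u' → x ∉ kernelSet O B) {z : Pt}
    (hz : z ∈ leftSide O m u) (hz' : z ∈ leftSide O m' u') : z ∉ B ∧ z ∉ kernelSet O B := by
  have hmO := hm.1
  have hmO' := hm'.1
  have hmc : m ∉ chord O m' u' := fun hc => hcc m (mem_chord_self hmO) hc hm
  have hmc' : m' ∉ chord O m u := fun hc => hcc m' hc (mem_chord_self hmO') hm'
  by_cases hx : ∃ x, x ∈ chord O m u ∧ x ∈ chord O m' u'
  swap
  · exfalso
    have hd : Disjoint (chord O m u) (chord O m' u') :=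
      Set.disjoint_left.2 fun x hx1 hx2 => hx ⟨x, hx1, hx2⟩
    have hmn : m ∈ leftSide O m' (-u') :=
      ((hO.mem_sides hmO' hu' hmO).resolve_left h').resolve_left hmc
    have hmn' : m' ∈ leftSide O m (-u) :=
      ((hO.mem_sides hmO hu hmO').resolve_left h).resolve_left hmc'
    have hc := subset_leftSide hO.isOpen hmO' (neg_ne_zero.2 hu')
      (chord_subset (p := m) (u := u)) (by rwa [chord_neg]) isPreconnected_chord (mem_chord_self hmO) hmn
    have hsub : leftSide O m' u' ⊆ leftSide O m u :=
      subset_leftSide hO.isOpen hmO hu leftSide_subset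
        (leftSide_neg_disjoint_of_subset hO hmO' hu' hc).symm
        (isPreconnected_leftSide hO.isOpen hmO' hu') hz' hz
    obtain ⟨y, hy, hyn⟩ := mem_closure_leftSide hO.isOpen hu' (mem_chord_self hmO')
      ((isOpen_leftSide hO.isOpen (neg_ne_zero.2 hu)).mem_nhds hmn')
    exact Set.disjoint_left.1 (hO.disjoint_sides hmO hu) (hsub hy) hyn
  obtain ⟨x, hxc, hxc'⟩ := hx
  have hxN := hcc x hxc hxc'
  have hxO := chord_subset hxc
  have : ∃ w, w ≠ 0 ∧ ¬ (leftSide O x w ∩ B).Nonempty := by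
    by_contra hcon
    push Not at hcon
    exact hxN ⟨hxO, fun w hw => hcon w hw⟩
  obtain ⟨w, hw, hwB⟩ := this
  have hnw := neg_ne_zero.2 hw
  have inF : ∀ y ∈ kernelSet O B, y ∈ leftSide O x (-w) := fun y hy =>
    ((hO.mem_sides hxO hw hy.1).resolve_left
      fun hc => hO.notMem_kernelSet_left hw hwB hxO hc hy).resolve_left
      fun hc => hO.notMem_kernelSet_chord hw hwB hxO hc hy
  rw [← not_or]
  intro hzBN
  rw [← leftSide_eq_of_mem hO.isOpen hmO hu hxc] at hz
  rw [← leftSide_eq_of_mem hO.isOpen hmO' hu' hxc'] at hz'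
  rw [← leftSide_eq_of_mem hO.isOpen hmO hu hxc] at h
  rw [← leftSide_eq_of_mem hO.isOpen hmO' hu' hxc'] at h'
  rw [← chord_eq_of_mem hu hxc] at hmc'
  rw [← chord_eq_of_mem hu' hxc'] at hmc
  have hmx : m ∈ chord O x u := by rw [chord_eq_of_mem hu hxc]; exact mem_chord_self hmO
  have hmx' : m' ∈ chord O x u' := by rw [chord_eq_of_mem hu' hxc']; exact mem_chord_self hmO'
  obtain ⟨z, hz, hz', hzF⟩ : ∃ z, z ∈ leftSide O x u ∧ z ∈ leftSide O x u' ∧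
      z ∈ leftSide O x (-w) := by
    rcases hzBN with hB | hN
    · rcases hO.mem_sides hxO hw (leftSide_subset hz) with hc | hc | hc
      · exact absurd ⟨z, hc, hB⟩ hwB
      · obtain ⟨y, hy, hy1, hy2⟩ := mem_closure_leftSide hO.isOpen hnw
          (by rwa [chord_neg]) (Filter.inter_mem ((isOpen_leftSide hO.isOpen hu).mem_nhds hz)
          ((isOpen_leftSide hO.isOpen hu').mem_nhds hz'))
        exact ⟨y, hy1, hy2, hy⟩
      · exact ⟨z, hz, hz', hc⟩
    · exact ⟨z, hz, hz', inF z hN⟩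
  have key : ∀ v v' n : Pt, v ≠ 0 → v' ≠ 0 → n ∈ kernelSet O B → n ∈ chord O x v →
      n ∉ leftSide O x v' → n ∉ chord O x v' → ∀ y ∈ chord O x v, y ∈ leftSide O x (-w) →
      y ∈ leftSide O x (-v') := by
    intro v v' n hv hv' hn hnc hnl hnc' y hy hyF
    obtain ⟨s, rfl, hs⟩ := hnc
    obtain ⟨r, rfl, hr⟩ := hy
    have neg_of : ∀ s : ℝ, segment ℝ x (x + s • v) ⊆ O → x + s • v ∈ leftSide O x (-w) →
        s * det2 w v < 0 := by
      intro s hs hF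
      by_contra hcon
      rcases (not_lt.1 hcon).eq_or_lt with h0 | h0
      · have := (leftSide_subset_diff hF).2
        rw [chord_neg] at this
        exact this ((mem_chord_iff hw).2 ⟨by
          rw [add_sub_cancel_left, det2_smul_right]; exact h0.symm, hs⟩)
      · exact Set.disjoint_left.1 (hO.disjoint_sides hxO hw)
          (mem_leftSide_of_segment hO.isOpen hw hs (by
            rw [add_sub_cancel_left, det2_smul_right]; exact h0)) hF
    have h1 := neg_of s hs (inF _ hn)
    have h2 := neg_of r hr hyF
    have h3 : s * det2 v' v < 0 := by
      by_contra hcon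
      rcases (not_lt.1 hcon).eq_or_lt with h0 | h0
      · exact hnc' ((mem_chord_iff hv').2 ⟨by
          rw [add_sub_cancel_left, det2_smul_right]; exact h0.symm, hs⟩)
      · exact hnl (mem_leftSide_of_segment hO.isOpen hv' hs (by
            rw [add_sub_cancel_left, det2_smul_right]; exact h0))
    refine mem_leftSide_of_segment hO.isOpen (neg_ne_zero.2 hv') hr ?_
    rw [add_sub_cancel_left, det2_smul_right, det2_neg_left]
    have h4 : 0 < s * r := by nlinarith [mul_pos_of_neg_of_neg h1 h2, sq_nonneg (det2 w v)]
    have h5 : 0 < s ^ 2 := by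
      rw [sq_pos_iff]; rintro rfl; simp at h1
    nlinarith [mul_pos h4 (neg_pos.2 h3)]
  obtain ⟨y, -, hyU, hyV⟩ := isPreconnected_leftSide hO.isOpen hxO hnw
    (leftSide O x u ∩ leftSide O x u') (leftSide O x (-u) ∪ leftSide O x (-u'))
    ((isOpen_leftSide hO.isOpen hu).inter (isOpen_leftSide hO.isOpen hu'))
    ((isOpen_leftSide hO.isOpen (neg_ne_zero.2 hu)).union
      (isOpen_leftSide hO.isOpen (neg_ne_zero.2 hu')))
    (fun y hy => by
      rcases hO.mem_sides hxO hu (leftSide_subset hy) with h1 | h1 | h1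
      · rcases hO.mem_sides hxO hu' (leftSide_subset hy) with h2 | h2 | h2
        · exact Or.inl ⟨h1, h2⟩
        · exact Or.inr (Or.inl (key u' u m' hu' hu hm' hmx' h hmc' y h2 hy))
        · exact Or.inr (Or.inr h2)
      · exact Or.inr (Or.inr (key u u' m hu hu' hm hmx h' hmc y h1 hy))
      · exact Or.inr (Or.inl h1))
    ⟨z, hzF, hz, hz'⟩ ⟨m, inF m hm, Or.inr (key u u' m hu hu' hm hmx h' hmc m hmx (inF m hm))⟩
  rcases hyV with hyV | hyV
  · exact Set.disjoint_left.1 (hO.disjoint_sides hxO hu) hyU.1 hyV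
  · exact Set.disjoint_left.1 (hO.disjoint_sides hxO hu') hyU.2 hyV

end ChordDomain

namespace ChordDomain
variable {O B G : Set Pt} {p q u m : Pt}

/-- A point of a connected set where a linear functional is maximal has nothing of the set
beyond its chord. -/
lemma disjoint_leftSide_of_max (hO : ChordDomain O) (hu : u ≠ 0) {X : Set Pt} (hX : X ⊆ O)
    (hpre : IsPreconnected X) (hm : m ∈ X) (hmax : ∀ x ∈ X, det2 u x ≤ det2 u m) {x : Pt}
    (hx : x ∈ X) : x ∉ leftSide O m u := by
  have key : (m ∈ leftSide O m u ↔ x ∈ leftSide O m u) := by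
    refine hpre.induction₂' (fun a b => (a ∈ leftSide O m u ↔ b ∈ leftSide O m u)) ?_
      (fun a b c _ _ _ h h' => h.trans h') hm hx
    intro a ha
    have hev : ∀ᶠ y in nhdsWithin a X, (a ∈ leftSide O m u ↔ y ∈ leftSide O m u) := by
      rcases hO.mem_sides (hX hm) hu (hX ha) with h | h | h
      · filter_upwards [mem_nhdsWithin_of_mem_nhds
          ((isOpen_leftSide hO.isOpen hu).mem_nhds h)] with y hy
        exact ⟨fun _ => hy, fun _ => h⟩
      · obtain ⟨ε, hε, -, hs⟩ := hO.exists_ball_sides hu h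
        filter_upwards [mem_nhdsWithin_of_mem_nhds (Metric.ball_mem_nhds a hε),
          self_mem_nhdsWithin] with y hy hyX
        have hle := hmax y hyX
        have h0 := det2_of_mem_chord h
        have hya : det2 u (y - a) ≤ 0 := by
          rw [det2_sub_right] at h0 ⊢; linarith
        have hn : y ∉ leftSide O m u := by
          rcases hya.lt_or_eq with hlt | heq
          · exact fun hl => Set.disjoint_left.1 (hO.disjoint_sides (hX hm) hu) hl
              ((hs y hy).2.1 hlt)
          · exact fun hl => (leftSide_subset_diff hl).2 ((hs y hy).2.2 heq)
        exact ⟨fun hl => absurd h (leftSide_subset_diff hl).2, fun hl => absurd hl hn⟩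
      · filter_upwards [mem_nhdsWithin_of_mem_nhds
          ((isOpen_leftSide hO.isOpen (neg_ne_zero.2 hu)).mem_nhds h)] with y hy
        have hd := Set.disjoint_left.1 (hO.disjoint_sides (hX hm) hu)
        exact ⟨fun hl => absurd h (hd hl), fun hl => absurd hy (hd hl)⟩
    filter_upwards [hev] with y hy
    exact ⟨hy, hy.symm⟩
  rw [← key]
  exact fun hl => (leftSide_subset_diff hl).2 (mem_chord_self (hX hm))

end ChordDomain

/-- A connected open part of the interior of the kernel set, closed under seeing. -/
structure IsPiece (O B G : Set Pt) : Prop where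
  isOpen : IsOpen G
  isPreconnected : IsPreconnected G
  subset : G ⊆ interior (kernelSet O B)
  segment : ∀ m ∈ G, ∀ x ∈ kernelSet O B, segment ℝ m x ⊆ O → ∀ z ∈ segment ℝ m x, z ≠ x → z ∈ G

namespace IsPiece
variable {O B G : Set Pt} {p q u m : Pt}

lemma subset_kernelSet (hG : IsPiece O B G) : G ⊆ kernelSet O B :=
  hG.subset.trans interior_subset

lemma subset_domain (hG : IsPiece O B G) : G ⊆ O := fun _ h => (hG.subset_kernelSet h).1

lemma segment_subset (hG : IsPiece O B G) (hp : p ∈ G) (hq : q ∈ G) (h : _root_.segment ℝ p q ⊆ O) :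
    _root_.segment ℝ p q ⊆ G := by
  intro z hz
  by_cases hzq : z = q
  · rwa [hzq]
  · exact hG.segment p hp q (hG.subset_kernelSet hq) h z hz hzq

lemma of_component (hO : ChordDomain O) (x : Pt) :
    IsPiece O B (connectedComponentIn (interior (kernelSet O B)) x) := by
  refine ⟨isOpen_interior.connectedComponentIn, isPreconnected_connectedComponentIn,
    connectedComponentIn_subset _ _, ?_⟩
  intro m hm y hy hmy z hz hzy
  have hmi := connectedComponentIn_subset _ _ hm
  rw [connectedComponentIn_eq hm]
  refine (convex_segment m z).isPreconnected.subset_connectedComponentIn (left_mem_segment _ _ _)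
    ?_ (right_mem_segment _ _ _)
  intro w hw
  refine hO.interior_kernelSet_segment hmi hy hmy
    ((convex_segment _ _).segment_subset (left_mem_segment _ _ _) hz hw) ?_
  rintro rfl
  have h1 := dist_add_dist_of_mem_segment hz
  have h2 := dist_add_dist_of_mem_segment hw
  have h3 : dist z w = 0 := by
    have := dist_comm z w
    have := dist_nonneg (x := z) (y := w)
    linarith
  exact hzy (dist_eq_zero.1 h3)

lemma chord_eq (hG : IsPiece O B G) (hp : p ∈ G) (hu : u ≠ 0) :
    chord G p u = chord O p u ∩ G := by
  ext z
  rw [Set.mem_inter_iff, mem_chord_iff hu, mem_chord_iff hu]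
  constructor
  · exact fun ⟨h1, h2⟩ => ⟨⟨h1, h2.trans hG.subset_domain⟩, h2 (right_mem_segment _ _ _)⟩
  · exact fun ⟨⟨h1, h2⟩, h3⟩ => ⟨h1, hG.segment_subset hp h3 h2⟩

lemma chordDomain (hO : ChordDomain O) (hG : IsPiece O B G) : ChordDomain G := by
  refine ⟨hG.isOpen, hG.isPreconnected, hO.isBounded.subset hG.subset_domain, ?_⟩
  intro p hp u hu X hX hpre t t' ht ht' h h'
  refine hO.separates p (hG.subset_domain hp) u hu X (fun z hz => ?_) hpre t t' ht ht'
    (h.trans hG.subset_domain) (h'.trans hG.subset_domain)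
  have := hX hz
  rw [hG.chord_eq hp hu] at this
  exact ⟨hG.subset_domain this.1, fun hc => this.2 ⟨hc, this.1⟩⟩

lemma leftSide_eq (hO : ChordDomain O) (hG : IsPiece O B G) (hp : p ∈ G) (hu : u ≠ 0) :
    leftSide G p u = leftSide O p u ∩ G := by
  have hsub : ∀ v : Pt, v ≠ 0 → leftSide G p v ⊆ leftSide O p v := by
    intro v hv
    obtain ⟨ε, hε, -, hb⟩ := exists_ball_left hO.isOpen hv (mem_chord_self (hG.subset_domain hp))
    obtain ⟨y, hy, hyU⟩ := mem_closure_leftSide hG.isOpen hv (mem_chord_self hp)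
      (Metric.ball_mem_nhds p hε)
    obtain ⟨ε', hε', -, hb'⟩ := (hG.chordDomain hO).exists_ball_sides hv (mem_chord_self hp)
    obtain ⟨s, hs, -, hm, hm'⟩ := exists_small_smul p (rotJ v)
      (Filter.inter_mem (Metric.ball_mem_nhds p hε) (Metric.ball_mem_nhds p hε'))
    have hd := det2_start_pos (p := p) hv hs
    refine subset_leftSide hO.isOpen (hG.subset_domain hp) hv
      (leftSide_subset.trans hG.subset_domain) ?_ (isPreconnected_leftSide hG.isOpen hp hv)
      ((hb' _ hm').1 hd) (hb _ hm hd)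
    rw [Set.disjoint_left]
    intro z hz hzc
    have := leftSide_subset_diff hz
    rw [hG.chord_eq hp hv] at this
    exact this.2 ⟨hzc, this.1⟩
  refine (Set.subset_inter (hsub u hu) leftSide_subset).antisymm ?_
  rintro z ⟨hz, hzG⟩
  rcases (hG.chordDomain hO).mem_sides hp hu hzG with h | h | h
  · exact h
  · rw [hG.chord_eq hp hu] at h
    exact absurd h.1 (leftSide_subset_diff hz).2
  · exact absurd (hsub (-u) (neg_ne_zero.2 hu) h)
      (Set.disjoint_left.1 (hO.disjoint_sides (hG.subset_domain hp) hu) hz)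

end IsPiece

/-- The part `V` of `G` contains everything of `G` on and beyond the chord through `m ∈ V`. -/
structure IsOuter (O G V : Set Pt) (m u : Pt) : Prop where
  ne_zero : u ≠ 0
  mem : m ∈ V
  subset : V ⊆ G
  left : leftSide O m u ∩ G ⊆ V
  chord : chord O m u ∩ G ⊆ V

namespace IsPiece
variable {O B G : Set Pt} {p q u m : Pt}

/-- Each union of components of a part of `G` cut off by a line contains an outer chord. -/
lemma exists_outer (hO : ChordDomain O) (hG : IsPiece O B G) (hB : B.Finite) (hu : u ≠ 0)
    {t₀ : ℝ} {V : Set Pt} (hVne : V.Nonempty) (hV : V ⊆ {z ∈ G | t₀ < det2 u z}) (hVo : IsOpen V)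
    (hVc : IsOpen ({z ∈ G | t₀ < det2 u z} \ V)) : ∃ m, IsOuter O G V m u := by
  have hVG : V ⊆ G := fun z hz => (hV hz).1
  have hpreV : ∀ X ⊆ {z ∈ G | t₀ < det2 u z}, IsPreconnected X → (X ∩ V).Nonempty → X ⊆ V := by
    intro X hX hpre hne
    refine hpre.subset_left_of_subset_union hVo hVc Set.disjoint_sdiff_right (fun z hz => ?_) hne
    by_cases h : z ∈ V
    exacts [Or.inl h, Or.inr ⟨hX hz, h⟩]
  obtain ⟨g, hgV, hgmin⟩ : ∃ g ∈ V, ∀ g' ∈ V,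
      (leftSide O g u ∩ B).ncard ≤ (leftSide O g' u ∩ B).ncard := by
    refine ⟨Function.argminOn (fun g => (leftSide O g u ∩ B).ncard) V hVne,
      Function.argminOn_mem _ _ _, fun g' hg' => ?_⟩
    exact Function.argminOn_le (fun g => (leftSide O g u ∩ B).ncard) V hg'
  have hgG := hVG hgV
  have hgO := hG.subset_domain hgG
  have hGd := hG.chordDomain hO
  refine ⟨g, hu, hgV, hVG, ?_, ?_⟩
  swap
  · rw [← hG.chord_eq hgG hu]
    refine hpreV _ (fun z hz => ⟨chord_subset hz, ?_⟩) isPreconnected_chord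
      ⟨g, mem_chord_self hgG, hgV⟩
    have := det2_of_mem_chord hz
    rw [det2_sub_right] at this
    linarith [(hV hgV).2]
  rw [← hG.leftSide_eq hO hgG hu]
  have hApre := isPreconnected_leftSide hG.isOpen hgG hu
  obtain ⟨ε, hε, hεG, hball⟩ := hGd.exists_ball_sides hu (mem_chord_self hgG)
  obtain ⟨s, hs, -, hvb, hvV⟩ := exists_small_smul g (rotJ u) (Filter.inter_mem
    (Metric.ball_mem_nhds g hε) (hVo.mem_nhds hgV))
  set v := g + s • rotJ u
  have hvd : 0 < det2 u (v - g) := det2_start_pos hu hs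
  have hvA := (hball v hvb).1 hvd
  refine hpreV _ ?_ hApre ⟨v, hvA, hvV⟩
  by_contra hcon
  obtain ⟨a, haA, ha⟩ := Set.not_subset.1 hcon
  have ha' : det2 u a ≤ t₀ := by
    by_contra h
    exact ha ⟨leftSide_subset haA, not_le.1 h⟩
  have hApc : IsPathConnected (leftSide G g u) :=
    ((isOpen_leftSide hG.isOpen hu).isConnected_iff_isPathConnected).1 ⟨⟨v, hvA⟩, hApre⟩
  obtain ⟨γ, hγ⟩ := hApc.joinedIn v hvA a haA
  set f : unitInterval → ℝ := fun t => det2 u (γ t)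
  have hf : Continuous f := by fun_prop
  have hgt := (hV hgV).2
  have hvg : det2 u g < det2 u v := by rw [det2_sub_right] at hvd; linarith
  set Z := {t | f t ≤ det2 u g}
  have hZ : IsClosed Z := isClosed_le hf continuous_const
  have hZne : Z.Nonempty := ⟨1, by simp [Z, f]; linarith⟩
  obtain ⟨t₁, ht₁, hmin⟩ := hZ.isCompact.exists_isMinOn hZne continuousOn_id
  have hbefore : ∀ t, t < t₁ → det2 u g < f t := by
    intro t ht
    by_contra h
    exact absurd (hmin (not_lt.1 h)) (not_le.2 ht)
  have hf1 : f t₁ = det2 u g := by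
    refine le_antisymm ht₁ ?_
    by_contra hlt
    have hev : ∀ᶠ t in nhds t₁, f t < det2 u g :=
      hf.continuousAt.eventually_lt continuousAt_const (not_le.1 hlt)
    have h0 : (0 : unitInterval) < t₁ := by
      rcases (unitInterval.nonneg' : 0 ≤ t₁).eq_or_lt with h | h
      · exfalso
        rw [← h] at ht₁
        simp [Z, f] at ht₁
        linarith
      · exact h
    have hcl : (nhdsWithin t₁ (Set.Iio t₁)).NeBot :=
      nhdsLT_neBot_of_exists_lt ⟨0, h0⟩
    obtain ⟨t, ht, ht'⟩ := ((hev.filter_mono nhdsWithin_le_nhds).and (self_mem_nhdsWithin (s := Set.Iio t₁))).exists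
    exact absurd (hbefore t (Set.mem_Iio.1 ht')) (not_lt.2 ht.le)
  set X₀ := γ '' Set.Iic t₁
  have hX₀A : X₀ ⊆ leftSide G g u := by rintro _ ⟨t, -, rfl⟩; exact hγ t
  have hX₀g : ∀ z ∈ X₀, det2 u g ≤ det2 u z := by
    rintro _ ⟨t, ht, rfl⟩
    rcases (Set.mem_Iic.1 ht).eq_or_lt with rfl | h
    exacts [hf1.ge, (hbefore t h).le]
  have hX₀pre : IsPreconnected X₀ := isPreconnected_Iic.image _ γ.continuous.continuousOn
  have hvX₀ : v ∈ X₀ := ⟨0, Set.mem_Iic.2 unitInterval.nonneg', by simp⟩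
  have hX₀V : X₀ ⊆ V := hpreV _ (fun z hz => ⟨leftSide_subset (hX₀A hz), by
    linarith [hX₀g z hz]⟩) hX₀pre ⟨v, hvX₀, hvV⟩
  obtain ⟨m, hmX, hmmax⟩ := ((isClosed_Iic.isCompact).image γ.continuous : IsCompact X₀).exists_isMaxOn
    ⟨v, hvX₀⟩ (by fun_prop : Continuous fun z => det2 u z).continuousOn
  set w := γ t₁
  have hwX₀ : w ∈ X₀ := ⟨t₁, Set.mem_Iic.2 le_rfl, rfl⟩
  have hseg : _root_.segment ℝ v g ⊆ Metric.ball g ε :=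
    (convex_ball g ε).segment_subset hvb (Metric.mem_ball_self hε)
  set X := X₀ ∪ _root_.segment ℝ v g
  have hXG : X ⊆ G := Set.union_subset (hX₀A.trans leftSide_subset) (hseg.trans hεG)
  have hXO := hXG.trans hG.subset_domain
  have hXpre : IsPreconnected X := hX₀pre.union v hvX₀ (left_mem_segment _ _ _)
    (convex_segment _ _).isPreconnected
  have hsegle : ∀ z ∈ _root_.segment ℝ v g, det2 u g ≤ det2 u z ∧ det2 u z ≤ det2 u v := by
    rintro _ ⟨α, β, hα, hβ, hαβ, rfl⟩
    rw [det2_add_right, det2_smul_right, det2_smul_right]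
    obtain rfl : β = 1 - α := by linarith
    constructor <;> nlinarith
  have hvm : det2 u v ≤ det2 u m := hmmax hvX₀
  have hXm : ∀ z ∈ X, det2 u z ≤ det2 u m := by
    rintro z (hz | hz)
    exacts [hmmax hz, (hsegle z hz).2.trans hvm]
  have hXw : ∀ z ∈ X, det2 (-u) z ≤ det2 (-u) w := by
    intro z hz
    have hw : det2 u w = det2 u g := hf1
    rw [det2_neg_left, det2_neg_left, hw]
    rcases hz with hz | hz
    exacts [neg_le_neg (hX₀g z hz), neg_le_neg (hsegle z hz).1]
  have hnu := neg_ne_zero.2 hu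
  have hgX : g ∈ X := Or.inr (right_mem_segment _ _ _)
  have hwX : w ∈ X := Or.inl hwX₀
  have hmX' : m ∈ X := Or.inl hmX
  have hmO := hXO hmX'
  have hwO := hXO hwX
  have offm : ∀ z ∈ X, det2 u z = det2 u g → z ∈ leftSide O m (-u) := by
    intro z hz hzg
    refine ((hO.mem_sides hmO hu (hXO hz)).resolve_left
      (hO.disjoint_leftSide_of_max hu hXO hXpre hmX' hXm hz)).resolve_left fun hc => ?_
    have := det2_of_mem_chord hc
    rw [det2_sub_right] at this
    linarith
  have offw : ∀ z ∈ X, z ∉ chord O w u → z ∈ leftSide O w u := by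
    intro z hz hzc
    rcases hO.mem_sides hwO hu (hXO hz) with h | h | h
    · exact h
    · exact absurd h hzc
    · exact absurd h (hO.disjoint_leftSide_of_max hnu hXO hXpre hwX hXw hz)
  have hAO : leftSide G g u ⊆ leftSide O g u := by
    rw [hG.leftSide_eq hO hgG hu]; exact Set.inter_subset_left
  have hwl : w ∈ leftSide O g u := hAO (hX₀A hwX₀)
  have hml : m ∈ leftSide O g u := hAO (hX₀A hmX)
  have hwc : w ∉ chord O g u := (leftSide_subset_diff hwl).2
  have hcc : Disjoint (chord O g u) (chord O w u) := by
    rw [Set.disjoint_left]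
    intro z hz hz'
    apply hwc
    rw [← chord_eq_of_mem hu hz, chord_eq_of_mem hu hz']
    exact mem_chord_self hwO
  have side : ∀ {x y v : Pt}, v ≠ 0 → x ∈ O → y ∈ O → chord O y v = chord O y u →
      Disjoint (chord O x u) (chord O y u) → x ∈ leftSide O y v → chord O x u ⊆ leftSide O y v :=
    fun hv hx hy he hd h => subset_leftSide hO.isOpen hy hv chord_subset (by rwa [he])
      isPreconnected_chord (mem_chord_self hx) h
  have dis : ∀ {x y : Pt}, det2 u x ≠ det2 u y → Disjoint (chord O x u) (chord O y u) := by
    intro x y hne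
    rw [Set.disjoint_left]
    intro z hz hz'
    have h1 := det2_of_mem_chord hz
    have h2 := det2_of_mem_chord hz'
    rw [det2_sub_right] at h1 h2
    exact hne (by linarith)
  have hgm : det2 u g ≠ det2 u m := by linarith [hvg, hvm] |> fun h : det2 u g < det2 u m => h.ne
  have hwm : det2 u w ≠ det2 u m := by rw [show det2 u w = det2 u g from hf1]; exact hgm
  have s1 : leftSide O w (-u) ⊆ leftSide O g u := by
    refine hO.leftSide_subset_of_disjoint hgO hu hnu hwl ?_
    refine (hO.disjoint_sides hwO hu).mono_left (side hu hgO hwO rfl hcc ?_)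
    exact offw g hgX (Set.disjoint_left.1 hcc (mem_chord_self hgO))
  have s2 : leftSide O m u ⊆ leftSide O g u := by
    refine hO.leftSide_subset_of_disjoint hgO hu hu hml ?_
    exact leftSide_neg_disjoint_of_subset hO hmO hu (side hnu hgO hmO chord_neg (dis hgm)
      (offm g hgX rfl))
  have s3 : leftSide O m u ⊆ leftSide O w u := by
    refine hO.leftSide_subset_of_disjoint hwO hu hu (offw m hmX' fun hc => ?_) ?_
    · exact Set.disjoint_left.1 (dis hwm) hc (mem_chord_self hmO)
    · exact leftSide_neg_disjoint_of_subset hO hmO hu (side hnu hwO hmO chord_neg (dis hwm)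
        (offm w hwX hf1))
  obtain ⟨b, hb, hbB⟩ := (hG.subset_kernelSet (hXG hwX)).2 (-u) hnu
  have hlt : (leftSide O m u ∩ B).ncard < (leftSide O g u ∩ B).ncard := by
    refine Set.ncard_lt_ncard ?_ (hB.subset Set.inter_subset_right)
    refine (Set.inter_subset_inter_left _ s2).ssubset_of_mem_notMem (a := b) ⟨s1 hb, hbB⟩ ?_
    exact fun hbm => Set.disjoint_left.1 (hO.disjoint_sides hwO hu) (s3 hbm.1) hb
  exact absurd (hgmin m (hX₀V hmX)) (not_le.2 hlt)

end IsPiece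

/-- Two based directions `(m, u)` whose sides do not contain the other base point and whose chords
do not cross in the kernel set. -/
structure Indep (O B : Set Pt) (a b : Pt × Pt) : Prop where
  left : b.1 ∉ leftSide O a.1 a.2
  right : a.1 ∉ leftSide O b.1 b.2
  chord : ∀ x ∈ chord O a.1 a.2, x ∈ chord O b.1 b.2 → x ∉ kernelSet O B

lemma Indep.symm {O B : Set Pt} {a b : Pt × Pt} (h : Indep O B a b) : Indep O B b a :=
  ⟨h.right, h.left, fun x hx hx' => h.chord x hx' hx⟩

/-- A finite set has at least as many points as there are pairwise independent sides outside a
subset. -/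
lemma ChordDomain.length_add_le {O B C : Set Pt} (hO : ChordDomain O) (hB : B.Finite)
    (hC : C ⊆ B) {l : List (Pt × Pt)} (hl : ∀ a ∈ l, a.1 ∈ kernelSet O B ∧ a.2 ≠ 0)
    (hp : l.Pairwise (Indep O B)) (hlC : ∀ a ∈ l, ∀ b ∈ C, b ∉ leftSide O a.1 a.2) :
    l.length + C.ncard ≤ B.ncard := by
  induction l generalizing C with
  | nil => simpa using Set.ncard_le_ncard hC hB
  | cons a l ih =>
    rw [List.pairwise_cons] at hp
    obtain ⟨b, hb, hbB⟩ := (hl a (by simp)).1.2 a.2 (hl a (by simp)).2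
    have hbC : b ∉ C := fun h => hlC a (by simp) b h hb
    have h := ih (C := insert b C) (Set.insert_subset hbB hC)
      (fun x hx => hl x (by simp [hx])) hp.2 ?_
    · rw [Set.ncard_insert_of_notMem hbC (hB.subset hC)] at h
      simp only [List.length_cons]
      omega
    · rintro x hx c (rfl | hc)
      · intro hcx
        have hi := hp.1 x hx
        exact (hO.sides_disjoint (hl a (by simp)).2 (hl x (by simp [hx])).2 (hl a (by simp)).1
          (hl x (by simp [hx])).1 hi.left hi.right hi.chord hb hcx).1 hbB
      · exact hlC x (by simp [hx]) c hc

/-- A nonempty relatively clopen part of the part of `G` beyond a line. -/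
structure IsCut (G V : Set Pt) (u : Pt) (t : ℝ) : Prop where
  ne_zero : u ≠ 0
  nonempty : V.Nonempty
  subset : V ⊆ {z ∈ G | t < det2 u z}
  isOpen : IsOpen V
  isOpen_diff : IsOpen ({z ∈ G | t < det2 u z} \ V)

namespace IsCut
variable {G V : Set Pt} {u : Pt} {t t' : ℝ}

lemma subset_left (h : IsCut G V u t) : V ⊆ G := fun _ hz => (h.subset hz).1

lemma beyond (h : IsCut G V u t) (ht : t ≤ t') (hne : (V ∩ {z | t' < det2 u z}).Nonempty) :
    IsCut G (V ∩ {z | t' < det2 u z}) u t' := by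
  have ho : IsOpen {z : Pt | t' < det2 u z} := isOpen_lt continuous_const (by fun_prop)
  refine ⟨h.ne_zero, hne, fun z hz => ⟨h.subset_left hz.1, hz.2⟩, h.isOpen.inter ho, ?_⟩
  convert h.isOpen_diff.inter ho using 1
  ext z
  simp only [Set.mem_sdiff, Set.mem_ofPred_eq, Set.mem_inter_iff]
  constructor
  · rintro ⟨⟨h1, h2⟩, h3⟩
    exact ⟨⟨⟨h1, ht.trans_lt h2⟩, fun h4 => h3 ⟨h4, h2⟩⟩, h2⟩
  · rintro ⟨⟨⟨h1, h2⟩, h3⟩, h4⟩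
    exact ⟨⟨h1, h4⟩, fun h5 => h3 h5.1⟩

lemma exists_avoid (h : IsCut G V u t) {E : Set Pt} (hE : E.Finite) :
    ∃ V' ⊆ V, ∃ t', IsCut G V' u t' ∧ ∀ z ∈ V', ∀ e ∈ E, det2 u z ≠ det2 u e := by
  induction E, hE using Set.Finite.induction_on with
  | empty => exact ⟨V, subset_rfl, t, h, by simp⟩
  | @insert e E _ _ ih =>
    obtain ⟨V', hV', t', hc, hav⟩ := ih
    by_cases hne : (V' ∩ {z | det2 u e < det2 u z}).Nonempty
    · refine ⟨V' ∩ {z | max t' (det2 u e) < det2 u z}, Set.inter_subset_left.trans hV',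
        max t' (det2 u e), hc.beyond (le_max_left _ _) ?_, ?_⟩
      · obtain ⟨z, hz, hz'⟩ := hne
        exact ⟨z, hz, max_lt (hc.subset hz).2 hz'⟩
      · rintro z ⟨hz, hz'⟩ f (rfl | hf)
        exacts [((le_max_right _ _).trans_lt hz').ne', hav z hz f hf]
    · refine ⟨V', hV', t', hc, ?_⟩
      rintro z hz f (rfl | hf)
      · intro heq
        obtain ⟨s, hs, -, hm⟩ := exists_small_smul z (rotJ u) (hc.isOpen.mem_nhds hz)
        refine hne ⟨_, hm, ?_⟩
        have := det2_start_pos (p := z) hc.ne_zero hs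
        rw [det2_sub_right] at this
        simp only [Set.mem_ofPred_eq]
        linarith
      · exact hav z hz f hf

end IsCut

namespace IsPiece
variable {O B G V V' : Set Pt} {m m' u u' : Pt} {t : ℝ}

lemma exists_outer_of_cut (hO : ChordDomain O) (hG : IsPiece O B G) (hB : B.Finite)
    (hV : IsCut G V u t) {E : Set Pt} (hE : E.Finite) :
    ∃ V' ⊆ V, ∃ m, IsOuter O G V' m u ∧ ∀ e ∈ E, det2 u m ≠ det2 u e := by
  obtain ⟨V', hV', t', hc, hav⟩ := hV.exists_avoid hE
  obtain ⟨m, hm⟩ := hG.exists_outer hO hB hc.ne_zero hc.nonempty hc.subset hc.isOpen hc.isOpen_diff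
  exact ⟨V', hV', m, hm, hav m hm.mem⟩

lemma mem_closure_chord (hG : IsPiece O B G) (h : IsOuter O G V m u) {x : Pt}
    (hx : x ∈ chord O m u) (hxN : x ∈ kernelSet O B) : x ∈ closure (chord O m u ∩ G) := by
  by_cases hxm : x = m
  · exact subset_closure ⟨hx, hxm ▸ h.subset h.mem⟩
  have hseg := ((mem_chord_iff h.ne_zero).1 hx).2
  have hsub : _root_.openSegment ℝ m x ⊆ chord O m u ∩ G := by
    intro z hz
    have hz' := openSegment_subset_segment _ _ _ hz
    have hzx : z ≠ x := by
      rintro rfl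
      exact hxm (right_mem_openSegment_iff.1 hz).symm
    exact ⟨segment_subset_chord hx hz', hG.segment m (h.subset h.mem) x hxN hseg z hz' hzx⟩
  exact closure_mono hsub (segment_subset_closure_openSegment (right_mem_segment _ _ _))

lemma outer_mem (hG : IsPiece O B G) (h : IsOuter O G V m u) :
    m ∈ kernelSet O B ∧ u ≠ 0 := ⟨hG.subset_kernelSet (h.subset h.mem), h.ne_zero⟩

/-- Outer chords of disjoint parts with disjoint closures are independent. -/
lemma indep (hG : IsPiece O B G) (h : IsOuter O G V m u) (h' : IsOuter O G V' m' u')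
    (hd : Disjoint V V') (hc : Disjoint (closure (chord O m u ∩ G)) (closure (chord O m' u' ∩ G))) :
    Indep O B (m, u) (m', u') :=
  ⟨fun hm => Set.disjoint_left.1 hd (h.left ⟨hm, h'.subset h'.mem⟩) h'.mem,
    fun hm => Set.disjoint_left.1 hd h.mem (h'.left ⟨hm, h.subset h.mem⟩),
    fun _ hx hx' hxN => Set.disjoint_left.1 hc (hG.mem_closure_chord h hx hxN)
      (hG.mem_closure_chord h' hx' hxN)⟩

lemma indep_of_closure (hG : IsPiece O B G) (h : IsOuter O G V m u) (h' : IsOuter O G V' m' u')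
    (hd : Disjoint (closure V) (closure V')) : Indep O B (m, u) (m', u') :=
  hG.indep h h' (hd.mono subset_closure subset_closure)
    (hd.mono (closure_mono h.chord) (closure_mono h'.chord))

end IsPiece

lemma IsOuter.det2_of_mem_closure {O G : Set Pt} {m u x : Pt}
    (hx : x ∈ closure (_root_.chord O m u ∩ G)) : det2 u x = det2 u m := by
  have hcl : IsClosed {z : Pt | det2 u z = det2 u m} := isClosed_eq (by fun_prop) continuous_const
  refine closure_minimal (fun z hz => ?_) hcl hx
  have := det2_of_mem_chord hz.1
  rw [det2_sub_right] at this
  simp only [Set.mem_ofPred_eq]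
  linarith

/-- In the plane the convex hull of a compact set is compact. -/
lemma isCompact_convexHull {K : Set Pt} (hK : IsCompact K) : IsCompact (convexHull ℝ K) := by
  have h : convexHull ℝ K = ⋃ n ∈ Finset.range 4, (fun p : (Fin n → ℝ) × (Fin n → Pt) =>
      ∑ i, p.1 i • p.2 i) '' (stdSimplex ℝ (Fin n) ×ˢ Set.pi Set.univ fun _ => K) := by
    ext x
    simp only [Set.mem_iUnion, Finset.mem_range, Set.mem_image, Set.mem_prod, Prod.exists]
    constructor
    · intro hx
      obtain ⟨ι, _, z, w, hz, hind, hw, hw1, rfl⟩ := eq_pos_convex_span_of_mem_convexHull hx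
      have hcard := hind.card_le_finrank_succ
      have hfr : Module.finrank ℝ (vectorSpan ℝ (Set.range z)) ≤ 2 :=
        (Submodule.finrank_le _).trans (by simp)
      let f := Fintype.equivFin ι
      refine ⟨Fintype.card ι, by omega, w ∘ f.symm, z ∘ f.symm, ⟨⟨fun i => (hw _).le, ?_⟩, ?_⟩, ?_⟩
      · rw [← hw1]; exact f.symm.sum_comp w
      · exact fun i _ => hz ⟨_, rfl⟩
      · exact f.symm.sum_comp fun i => w i • z i
    · rintro ⟨n, -, w, z, ⟨hw, hz⟩, rfl⟩
      exact (convex_convexHull ℝ K).sum_mem (fun i _ => hw.1 i) hw.2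
        fun i _ => subset_convexHull ℝ K (hz i trivial)
  rw [h]
  refine (Finset.range 4).isCompact_biUnion fun n _ => ?_
  exact ((isCompact_stdSimplex ℝ (Fin n)).prod (isCompact_univ_pi fun _ => hK)).image (by fun_prop)

/-- Extreme points of the convex hull of a compact set are cut off by lines. -/
lemma exists_cap {K : Set Pt} (hK : IsCompact K) {e : Pt}
    (he : e ∈ (convexHull ℝ K).extremePoints ℝ) {U : Set Pt} (hU : U ∈ nhds e) :
    ∃ u t, u ≠ 0 ∧ t < det2 u e ∧ ∀ z ∈ convexHull ℝ K, t < det2 u z → z ∈ U := by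
  set A := convexHull ℝ K \ interior U
  have hA : IsCompact A := (isCompact_convexHull hK).diff isOpen_interior
  have hAC : convexHull ℝ A ⊆ convexHull ℝ K :=
    convexHull_min Set.sdiff_subset (convex_convexHull ℝ K)
  have heA : e ∉ convexHull ℝ A := by
    intro h
    have h1 : e ∈ (convexHull ℝ A).extremePoints ℝ :=
      inter_extremePoints_subset_extremePoints_of_subset hAC ⟨h, he⟩
    exact (extremePoints_convexHull_subset h1).2 (mem_interior_iff_mem_nhds.2 hU)
  have key : ∀ z ∈ convexHull ℝ K, z ∉ convexHull ℝ A → z ∈ U := by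
    intro z hz hzA
    by_contra h
    exact hzA (subset_convexHull ℝ A ⟨hz, fun h' => h (interior_subset h')⟩)
  rcases (convexHull ℝ A).eq_empty_or_nonempty with hem | hne
  · refine ⟨!₂[1, 0], det2 !₂[1, 0] e - 1, fun h => ?_, by linarith, fun z hz _ => key z hz ?_⟩
    · have := congrArg (fun v : Pt => v 0) h
      simp at this
    · rw [hem]; exact Set.notMem_empty z
  obtain ⟨u, hu⟩ := exists_det2_pos (convex_convexHull ℝ A) (isCompact_convexHull hA).isClosed heA
  obtain ⟨x, hx, hmin⟩ := (isCompact_convexHull hA).exists_isMinOn hne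
    (by fun_prop : Continuous fun z => det2 u z).continuousOn
  have hxe := hu x hx
  refine ⟨-u, det2 (-u) x, ?_, ?_, ?_⟩
  · rw [neg_ne_zero]
    rintro rfl
    simp at hxe
  · rw [det2_sub_right] at hxe
    rw [det2_neg_left, det2_neg_left]
    linarith
  · intro z hz hlt
    refine key z hz fun hzA => ?_
    have := hmin hzA
    rw [det2_neg_left, det2_neg_left] at hlt
    simp only [Set.mem_ofPred_eq] at this
    linarith

lemma exists_radius {ι : Type*} [Finite ι] {x : ι → Pt} (hx : Function.Injective x) {F : Set Pt}
    (hF : IsClosed F) (hxF : ∀ i, x i ∉ F) :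
    ∃ δ > 0, (∀ i j, i ≠ j → Disjoint (Metric.closedBall (x i) δ) (Metric.closedBall (x j) δ)) ∧
      ∀ i, Disjoint (Metric.closedBall (x i) δ) F := by
  have h1 : ∀ᶠ δ in nhdsWithin (0 : ℝ) (Set.Ioi 0), ∀ i j, i ≠ j →
      Disjoint (Metric.closedBall (x i) δ) (Metric.closedBall (x j) δ) := by
    refine Filter.eventually_all.2 fun i => Filter.eventually_all.2 fun j => ?_
    by_cases hij : i = j
    · simp [hij]
    have hd : 0 < dist (x i) (x j) := dist_pos.2 fun h => hij (hx h)
    filter_upwards [Ioo_mem_nhdsGT (half_pos hd)] with δ hδ _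
    exact Metric.closedBall_disjoint_closedBall (by linarith [hδ.2])
  have h2 : ∀ᶠ δ in nhdsWithin (0 : ℝ) (Set.Ioi 0), ∀ i,
      Disjoint (Metric.closedBall (x i) δ) F := by
    refine Filter.eventually_all.2 fun i => ?_
    obtain ⟨ε, hε, hs⟩ := Metric.nhds_basis_closedBall.mem_iff.1 (hF.isOpen_compl.mem_nhds (hxF i))
    filter_upwards [Ioo_mem_nhdsGT hε] with δ hδ
    exact Set.disjoint_left.2 fun z hz => hs (Metric.closedBall_subset_closedBall hδ.2.le hz)
  obtain ⟨δ, ⟨h, h'⟩, h0⟩ := ((h1.and h2).and self_mem_nhdsWithin).exists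
  exact ⟨δ, h0, h, h'⟩

namespace IsPiece
variable {O B G V V' : Set Pt} {m m' u u' e : Pt}

lemma isCompact_closure (hO : ChordDomain O) (hG : IsPiece O B G) : IsCompact (closure G) :=
  (hO.isBounded.subset hG.subset_domain).isCompact_closure

lemma exists_isCut_cap (hO : ChordDomain O) (hG : IsPiece O B G)
    (he : e ∈ (convexHull ℝ (closure G)).extremePoints ℝ) {U : Set Pt} (hU : U ∈ nhds e) :
    ∃ u t, t < det2 u e ∧ IsCut G {z ∈ G | t < det2 u z} u t ∧
      ∀ z ∈ convexHull ℝ (closure G), t < det2 u z → z ∈ U := by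
  obtain ⟨u, t, hu, ht, h⟩ := exists_cap (hG.isCompact_closure hO) he hU
  have ho : IsOpen {z : Pt | t < det2 u z} := isOpen_lt continuous_const (by fun_prop)
  refine ⟨u, t, ht, ⟨hu, ?_, subset_rfl, hG.isOpen.inter ho, by simp⟩, h⟩
  have hcl : e ∈ closure G := extremePoints_convexHull_subset he
  obtain ⟨z, hz, hz'⟩ := mem_closure_iff_nhds.1 hcl _ (ho.mem_nhds ht)
  exact ⟨z, hz', hz⟩

lemma exists_cap_outer (hO : ChordDomain O) (hG : IsPiece O B G) (hB : B.Finite)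
    (he : e ∈ (convexHull ℝ (closure G)).extremePoints ℝ) {U : Set Pt} (hU : U ∈ nhds e)
    {E : Set Pt} (hE : E.Finite) :
    ∃ V ⊆ U, ∃ m u, IsOuter O G V m u ∧ ∀ e ∈ E, det2 u m ≠ det2 u e := by
  obtain ⟨u, t, -, hc, h⟩ := hG.exists_isCut_cap hO he hU
  obtain ⟨V, hV, m, hm, hav⟩ := hG.exists_outer_of_cut hO hB hc hE
  refine ⟨V, fun z hz => ?_, m, u, hm, hav⟩
  have := hV hz
  exact h z (subset_convexHull ℝ _ (subset_closure this.1)) this.2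

/-- Disjoint tiny caps around extreme points of a piece, together with one more outer chord. -/
lemma card_extreme_le (hO : ChordDomain O) (hG : IsPiece O B G) (hB : B.Finite) {n : ℕ}
    {x : Fin n → Pt} (hx : Function.Injective x)
    (he : ∀ i, x i ∈ (convexHull ℝ (closure G)).extremePoints ℝ)
    {l : List (Pt × Pt)} (hl : ∀ a ∈ l, a.1 ∈ kernelSet O B ∧ a.2 ≠ 0)
    (hp : l.Pairwise (Indep O B)) {F C : Set Pt} (hF : IsClosed F) (hxF : ∀ i, x i ∉ F)
    (hlF : ∀ a ∈ l, ∃ V ⊆ F, IsOuter O G V a.1 a.2) (hC : C ⊆ B)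
    (hCF : C ⊆ G) (hCl : ∀ a ∈ l, ∀ b ∈ C, b ∉ leftSide O a.1 a.2) (hCF' : C ⊆ F) :
    n + l.length + C.ncard ≤ B.ncard := by
  obtain ⟨δ, hδ, hd, hdF⟩ := exists_radius hx hF hxF
  choose V hV m u hm _ using fun i =>
    hG.exists_cap_outer hO hB (he i) (Metric.closedBall_mem_nhds (x i) hδ) Set.finite_empty
  have hVc : ∀ i, closure (V i) ⊆ Metric.closedBall (x i) δ := fun i =>
    closure_minimal (hV i) Metric.isClosed_closedBall
  have := hO.length_add_le (l := List.ofFn (fun i => (m i, u i)) ++ l) hB hC ?_ ?_ ?_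
  · simpa [add_assoc] using this
  · simp only [List.mem_append, List.mem_ofFn]
    rintro a (⟨i, rfl⟩ | ha)
    exacts [hG.outer_mem (hm i), hl a ha]
  · rw [List.pairwise_append, List.pairwise_ofFn]
    refine ⟨fun i j hij => ?_, hp, ?_⟩
    · exact hG.indep_of_closure (hm i) (hm j) ((hd i j hij.ne).mono (hVc i) (hVc j))
    · intro a ha b hb
      obtain ⟨i, rfl⟩ := List.mem_ofFn.1 ha
      obtain ⟨W, hW, hWo⟩ := hlF b hb
      exact hG.indep_of_closure (hm i) hWo ((hdF i).mono (hVc i) (closure_minimal hW hF))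
  · simp only [List.mem_append, List.mem_ofFn]
    rintro a (⟨i, rfl⟩ | ha) b hb
    · exact fun h => Set.disjoint_left.1 (hdF i) (hV i ((hm i).left ⟨h, hCF hb⟩)) (hCF' hb)
    · exact hCl a ha b hb

end IsPiece

/-- The closed triangle with corners `a`, `b`, `c`. -/
def tri (a b c : Pt) : Set Pt := convexHull ℝ {a, b, c}

lemma convex_tri (a b c : Pt) : Convex ℝ (tri a b c) := convex_convexHull _ _

lemma isCompact_tri (a b c : Pt) : IsCompact (tri a b c) :=
  Set.Finite.isCompact_convexHull ℝ (Set.toFinite _)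

lemma isClosed_tri (a b c : Pt) : IsClosed (tri a b c) := (isCompact_tri a b c).isClosed

lemma mem_tri {a b c z : Pt} : z ∈ tri a b c ↔
    ∃ α β γ : ℝ, 0 ≤ α ∧ 0 ≤ β ∧ 0 ≤ γ ∧ α + β + γ = 1 ∧ z = α • a + β • b + γ • c := by
  constructor
  · intro h
    rw [tri, convexHull_insert (by simp), convexHull_pair, mem_convexJoin] at h
    obtain ⟨_, rfl, y, ⟨s, t, hs, ht, hst, rfl⟩, σ, τ, hσ, hτ, hστ, rfl⟩ := h
    refine ⟨σ, τ * s, τ * t, hσ, by positivity, by positivity, ?_, ?_⟩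
    · rw [add_assoc, ← mul_add, hst, mul_one, hστ]
    · rw [smul_add, smul_smul, smul_smul, add_assoc]
  · rintro ⟨α, β, γ, hα, hβ, hγ, h, rfl⟩
    have := (convex_tri a b c).sum_mem (t := Finset.univ) (w := ![α, β, γ]) (z := ![a, b, c])
      (by intro i _; fin_cases i <;> assumption)
      (by simpa [Fin.sum_univ_three] using h)
      (by intro i _; fin_cases i <;> exact subset_convexHull ℝ _ (by simp))
    simpa [Fin.sum_univ_three] using this

lemma left_mem_tri (a b c : Pt) : a ∈ tri a b c := subset_convexHull ℝ _ (by simp)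
lemma mid_mem_tri (a b c : Pt) : b ∈ tri a b c := subset_convexHull ℝ _ (by simp)
lemma right_mem_tri (a b c : Pt) : c ∈ tri a b c := subset_convexHull ℝ _ (by simp)

lemma tri_subset {a b c : Pt} {K : Set Pt} (hK : Convex ℝ K) (ha : a ∈ K) (hb : b ∈ K)
    (hc : c ∈ K) : tri a b c ⊆ K :=
  convexHull_min (by simp [Set.insert_subset_iff, ha, hb, hc]) hK

lemma det2_barycentric (a b c : Pt) (α β γ : ℝ) (h : α + β + γ = 1) :
    det2 (c - b) (α • a + β • b + γ • c - b) = α * det2 (b - a) (c - a) := by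
  obtain rfl : γ = 1 - α - β := by linarith
  simp only [det2, PiLp.add_apply, PiLp.sub_apply, PiLp.smul_apply, smul_eq_mul]
  ring

lemma barycentric (a b c z : Pt) :
    det2 (b - a) (c - a) • z = det2 (c - b) (z - b) • a + det2 (a - c) (z - c) • b +
      det2 (b - a) (z - a) • c := by
  apply pt_ext <;>
  · simp only [det2, PiLp.add_apply, PiLp.sub_apply, PiLp.smul_apply, smul_eq_mul]
    ring

lemma det2_cyclic_sum (a b c z : Pt) : det2 (c - b) (z - b) + det2 (a - c) (z - c) +
    det2 (b - a) (z - a) = det2 (b - a) (c - a) := by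
  simp only [det2, PiLp.sub_apply]
  ring

lemma mem_tri_of_det2 {a b c z : Pt} (h : 0 < det2 (b - a) (c - a)) (h1 : 0 ≤ det2 (c - b) (z - b))
    (h2 : 0 ≤ det2 (a - c) (z - c)) (h3 : 0 ≤ det2 (b - a) (z - a)) : z ∈ tri a b c := by
  refine mem_tri.2 ⟨det2 (c - b) (z - b) / det2 (b - a) (c - a),
    det2 (a - c) (z - c) / det2 (b - a) (c - a), det2 (b - a) (z - a) / det2 (b - a) (c - a),
    by positivity, by positivity, by positivity, ?_, ?_⟩
  · rw [← add_div, ← add_div, det2_cyclic_sum, div_self h.ne']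
  · have := barycentric a b c z
    rw [div_eq_inv_mul, div_eq_inv_mul, div_eq_inv_mul, mul_smul, mul_smul, mul_smul, ← smul_add,
      ← smul_add, ← this, smul_smul, inv_mul_cancel₀ h.ne', one_smul]

lemma tri_rotate (a b c : Pt) : tri a b c = tri b c a := by
  unfold tri; congr 1; ext; simp; tauto

lemma tri_swap (a b c : Pt) : tri a b c = tri a c b := by
  unfold tri; congr 1; ext; simp; tauto

lemma det2_nonneg_of_mem_tri {a b c z : Pt} (h : 0 ≤ det2 (b - a) (c - a)) (hz : z ∈ tri a b c) :
    0 ≤ det2 (b - a) (z - a) := by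
  obtain ⟨α, β, γ, hα, hβ, hγ, hs, rfl⟩ := mem_tri.1 hz
  have h1 : det2 (b - a) (α • a + β • b + γ • c - a) = γ * det2 (b - a) (c - a) := by
    obtain rfl : α = 1 - β - γ := by linarith
    simp only [det2, PiLp.add_apply, PiLp.sub_apply, PiLp.smul_apply, smul_eq_mul]
    ring
  rw [h1]
  positivity

lemma mem_interior_tri_of_det2 {a b c z : Pt} (h : 0 < det2 (b - a) (c - a))
    (h1 : 0 < det2 (c - b) (z - b)) (h2 : 0 < det2 (a - c) (z - c))
    (h3 : 0 < det2 (b - a) (z - a)) : z ∈ interior (tri a b c) := by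
  refine mem_interior.2 ⟨{z | 0 < det2 (c - b) (z - b) ∧ 0 < det2 (a - c) (z - c) ∧
    0 < det2 (b - a) (z - a)}, fun w hw => mem_tri_of_det2 h hw.1.le hw.2.1.le hw.2.2.le, ?_,
    h1, h2, h3⟩
  have ho : ∀ p q : Pt, IsOpen {z | 0 < det2 p (z - q)} := fun p q =>
    isOpen_lt continuous_const (by fun_prop)
  exact (ho _ _).inter ((ho _ _).inter (ho _ _))

lemma det2_pos_of_mem_interior_tri {a b c z : Pt} (h : 0 < det2 (b - a) (c - a))
    (hz : z ∈ interior (tri a b c)) : 0 < det2 (b - a) (z - a) := by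
  have hne : b - a ≠ 0 := by
    intro h0
    rw [h0, det2_zero_left] at h
    exact lt_irrefl _ h
  obtain ⟨s, hs, -, hm⟩ := exists_small_smul z (-rotJ (b - a)) (mem_interior_iff_mem_nhds.1 hz)
  have h1 := det2_nonneg_of_mem_tri h.le hm
  have h2 := det2_rotJ_pos hne
  rw [add_sub_right_comm, det2_add_right, det2_smul_right, det2_neg_right] at h1
  nlinarith

lemma det2_rotate (a b c : Pt) : det2 (c - b) (a - b) = det2 (b - a) (c - a) := by
  simp only [det2, PiLp.sub_apply]
  ring

lemma mem_interior_tri_iff {a b c z : Pt} (h : 0 < det2 (b - a) (c - a)) :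
    z ∈ interior (tri a b c) ↔ 0 < det2 (c - b) (z - b) ∧ 0 < det2 (a - c) (z - c) ∧
      0 < det2 (b - a) (z - a) := by
  refine ⟨fun hz => ⟨?_, ?_, det2_pos_of_mem_interior_tri h hz⟩,
    fun ⟨h1, h2, h3⟩ => mem_interior_tri_of_det2 h h1 h2 h3⟩
  · rw [tri_rotate] at hz
    exact det2_pos_of_mem_interior_tri (by rwa [det2_rotate]) hz
  · rw [tri_rotate, tri_rotate] at hz
    exact det2_pos_of_mem_interior_tri (by rwa [det2_rotate, det2_rotate]) hz

/-- A degenerate triangle is covered by any two of its edges. -/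
lemma mem_segment_of_mem_tri {a b c z : Pt} (h : det2 (b - a) (c - a) = 0) (hz : z ∈ tri a b c) :
    z ∈ segment ℝ a b ∨ z ∈ segment ℝ a c := by
  obtain ⟨α, β, γ, hα, hβ, hγ, hs, rfl⟩ := mem_tri.1 hz
  by_cases hba : b = a
  · exact Or.inr ⟨α + β, γ, by positivity, hγ, by linarith, by rw [hba, add_smul]⟩
  obtain ⟨s, hs'⟩ := exists_smul_of_det2_eq_zero (sub_ne_zero.2 hba) h
  obtain rfl : c = a + s • (b - a) := by rw [← hs']; abel
  obtain rfl : α = 1 - β - γ := by linarith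
  have hr : (1 - β - γ) • a + β • b + γ • (a + s • (b - a)) = a + (β + γ * s) • (b - a) := by
    module
  have h1 : ∀ r : ℝ, 0 ≤ r → r ≤ 1 → a + r • (b - a) ∈ segment ℝ a b := fun r h0 h1 =>
    ⟨1 - r, r, by linarith, h0, by ring, by module⟩
  rw [hr]
  rcases le_or_gt 0 (β + γ * s) with h0 | h0
  · rcases le_or_gt (β + γ * s) 1 with hle | hle
    · exact Or.inl (h1 _ h0 hle)
    · right
      have hs1 : 1 < s := by
        by_contra hcon
        nlinarith
      have hs0 : 0 < s := by linarith
      refine ⟨1 - (β + γ * s) / s, (β + γ * s) / s, ?_, by positivity, by ring, ?_⟩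
      · rw [sub_nonneg, div_le_one hs0]
        nlinarith
      · rw [smul_add, smul_smul, div_mul_cancel₀ _ hs0.ne']
        module
  · right
    have hs0 : s < 0 := by
      by_contra hcon
      nlinarith
    refine ⟨1 - (β + γ * s) / s, (β + γ * s) / s, ?_, div_nonneg_of_nonpos h0.le hs0.le, by ring, ?_⟩
    · rw [sub_nonneg, div_le_one_of_neg hs0]
      nlinarith
    · rw [smul_add, smul_smul, div_mul_cancel₀ _ hs0.ne]
      module

/-- A point of a triangle off its edges lies in the interior. -/
lemma mem_interior_tri_of_notMem {a b c z : Pt} (hz : z ∈ tri a b c) (h1 : z ∉ segment ℝ a b)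
    (h2 : z ∉ segment ℝ a c) (h3 : z ∉ segment ℝ b c) : z ∈ interior (tri a b c) := by
  obtain ⟨α, β, γ, hα, hβ, hγ, hs, rfl⟩ := mem_tri.1 hz
  have hα' : 0 < α := hα.lt_of_ne fun h => h3 ⟨β, γ, hβ, hγ, by linarith, by simp [← h]⟩
  have hβ' : 0 < β := hβ.lt_of_ne fun h => h2 ⟨α, γ, hα, hγ, by linarith, by simp [← h]⟩
  have hγ' : 0 < γ := hγ.lt_of_ne fun h => h1 ⟨α, β, hα, hβ, by linarith, by simp [← h]⟩
  have ha := det2_barycentric a b c α β γ hs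
  have hb := det2_barycentric b c a β γ α (by linarith)
  have hc := det2_barycentric c a b γ α β (by linarith)
  rw [det2_rotate a b c] at hb
  rw [det2_rotate b c a, det2_rotate a b c] at hc
  rw [show β • b + γ • c + α • a = α • a + β • b + γ • c by abel] at hb
  rw [show γ • c + α • a + β • b = α • a + β • b + γ • c by abel] at hc
  rcases lt_trichotomy (det2 (b - a) (c - a)) 0 with h | h | h
  · rw [tri_swap]
    have h' : 0 < det2 (c - a) (b - a) := by rw [det2_swap]; linarith
    set z := α • a + β • b + γ • c
    have e1 : det2 (b - c) (z - c) = - det2 (c - b) (z - b) := by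
      simp only [det2, PiLp.sub_apply]; ring
    have e2 : det2 (a - b) (z - b) = - det2 (b - a) (z - a) := by
      simp only [det2, PiLp.sub_apply]; ring
    have e3 : det2 (c - a) (z - a) = - det2 (a - c) (z - c) := by
      simp only [det2, PiLp.sub_apply]; ring
    refine mem_interior_tri_of_det2 h' ?_ ?_ ?_
    · rw [e1, ha]; nlinarith
    · rw [e2, hc]; nlinarith
    · rw [e3, hb]; nlinarith
  · exact ((mem_segment_of_mem_tri h hz).elim h1 h2).elim
  · set z := α • a + β • b + γ • c
    refine mem_interior_tri_of_det2 h ?_ ?_ ?_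
    · rw [ha]; positivity
    · rw [hb]; positivity
    · rw [hc]; positivity

/-- A piece whose convex hull is a triangle with corners `x`, in counterclockwise order. -/
structure TriPiece (O B G : Set Pt) (x : Fin 3 → Pt) : Prop where
  dom : ChordDomain O
  piece : IsPiece O B G
  finite : B.Finite
  card : B.ncard ≤ 3
  det : ∀ k, 0 < det2 (x (k + 1) - x k) (x (k + 2) - x k)
  hull : convexHull ℝ (closure G) = tri (x 0) (x 1) (x 2)
  extreme : ∀ i, x i ∈ (tri (x 0) (x 1) (x 2)).extremePoints ℝ

namespace IsPiece
variable {O B G : Set Pt}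

lemma encard_extreme_le (hO : ChordDomain O) (hG : IsPiece O B G) (hB : B.Finite)
    (hBc : B.ncard ≤ 3) : ((convexHull ℝ (closure G)).extremePoints ℝ).encard ≤ 3 := by
  by_contra h
  have h4 : (4 : ℕ∞) ≤ ((convexHull ℝ (closure G)).extremePoints ℝ).encard := by
    rw [not_le] at h
    have := Order.add_one_le_of_lt h
    norm_num at this
    exact this
  obtain ⟨t, ht, ht4⟩ := Set.exists_subset_encard_eq h4
  have htf : t.Finite := Set.finite_of_encard_eq_coe (k := 4) ht4
  have htc : htf.toFinset.card = 4 := by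
    rw [← Set.ncard_eq_toFinset_card t htf, Set.ncard, ht4]; rfl
  let f := htf.toFinset.equivFinOfCardEq htc
  have := hG.card_extreme_le hO hB (x := fun i => (f.symm i : Pt)) (l := []) (F := ∅) (C := ∅)
    (fun i j hij => f.symm.injective (Subtype.ext hij))
    (fun i => ht (htf.mem_toFinset.1 (f.symm i).2)) (by simp) (by simp) isClosed_empty
    (by simp) (by simp) (by simp) (by simp) (by simp) (by simp)
  simp at this
  omega

/-- The convex hull of a nonempty piece is a triangle when `B` has at most three points. -/
lemma exists_triPiece (hO : ChordDomain O) (hG : IsPiece O B G) (hB : B.Finite)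
    (hBc : B.ncard ≤ 3) (hne : G.Nonempty) : ∃ x, TriPiece O B G x := by
  set C := convexHull ℝ (closure G)
  have hC : IsCompact C := isCompact_convexHull (hG.isCompact_closure hO)
  have hE := hG.encard_extreme_le hO hB hBc
  set E := C.extremePoints ℝ
  have hEf : E.Finite := Set.finite_of_encard_le_coe (k := 3) hE
  have hhull : convexHull ℝ E = C := by
    rw [← (Set.Finite.isCompact_convexHull ℝ hEf).isClosed.closure_eq]
    exact closure_convexHull_extremePoints hC (convex_convexHull ℝ _)
  have hCne : C.Nonempty := hne.mono (subset_closure.trans (subset_convexHull ℝ _))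
  have hEne : E.Nonempty := by
    rw [← convexHull_nonempty_iff (𝕜 := ℝ), hhull]; exact hCne
  obtain ⟨a, b, c, hEabc⟩ : ∃ a b c, E = {a, b, c} := by
    have h3 : E.ncard ≤ 3 := by
      rw [Set.ncard]
      exact ENat.toNat_le_of_le_natCast hE
    have h0 : 0 < E.ncard := (Set.ncard_pos hEf).2 hEne
    interval_cases h : E.ncard
    · obtain ⟨a, ha⟩ := Set.ncard_eq_one.1 h
      exact ⟨a, a, a, by simp [ha]⟩
    · obtain ⟨a, b, -, hab⟩ := Set.ncard_eq_two.1 h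
      exact ⟨a, b, b, by simp [hab]⟩
    · obtain ⟨a, b, c, -, -, -, habc⟩ := Set.ncard_eq_three.1 h
      exact ⟨a, b, c, habc⟩
  have main : ∀ a b c, E = {a, b, c} → 0 < det2 (b - a) (c - a) → ∃ x, TriPiece O B G x := by
    intro a b c h hd
    have hT : C = tri a b c := by rw [← hhull, h]; rfl
    refine ⟨![a, b, c], hO, hG, hB, hBc, ?_, hT, ?_⟩
    · intro k
      fin_cases k
      · exact hd
      · change 0 < det2 (c - b) (a - b)
        rwa [det2_rotate a b c]
      · change 0 < det2 (a - c) (b - c)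
        rwa [det2_rotate b c a, det2_rotate a b c]
    · intro i
      change _ ∈ (tri a b c).extremePoints ℝ
      rw [← hT]
      change _ ∈ E
      rw [h]
      fin_cases i <;> simp
  rcases lt_trichotomy (det2 (b - a) (c - a)) 0 with h | h | h
  · refine main a c b (by rw [hEabc]; ext; simp; tauto) ?_
    rw [det2_swap]
    linarith
  · exfalso
    obtain ⟨v, hv, h1, h2⟩ : ∃ v : Pt, v ≠ 0 ∧ det2 v (b - a) = 0 ∧ det2 v (c - a) = 0 := by
      by_cases hba : b - a = 0
      · by_cases hca : c - a = 0
        · refine ⟨!₂[1, 0], fun h => ?_, by simp [hba], by simp [hca]⟩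
          have := congrArg (fun v : Pt => v 0) h
          simp at this
        · exact ⟨c - a, hca, by simp [hba], det2_self _⟩
      · exact ⟨b - a, hba, det2_self _, h⟩
    have hsub : ∀ z ∈ C, det2 v z = det2 v a := by
      intro z hz
      rw [← hhull, hEabc] at hz
      rw [det2_sub_right] at h1 h2
      obtain ⟨α, β, γ, -, -, -, hs, rfl⟩ := mem_tri.1 hz
      obtain rfl : α = 1 - β - γ := by linarith
      simp only [det2_add_right, det2_smul_right]
      linear_combination β * h1 + γ * h2
    obtain ⟨g, hg⟩ := hne
    obtain ⟨s, hs, -, hm⟩ := exists_small_smul g (rotJ v) (hG.isOpen.mem_nhds hg)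
    have hGC : G ⊆ C := subset_closure.trans (subset_convexHull ℝ _)
    have hp := det2_start_pos (p := g) hv hs
    rw [det2_sub_right, hsub _ (hGC hm), hsub _ (hGC hg), sub_self] at hp
    exact lt_irrefl _ hp
  · exact main a b c hEabc h

end IsPiece

namespace TriPiece
variable {O B G : Set Pt} {x : Fin 3 → Pt}

/-- The triangle spanned by the piece. -/
abbrev body (_h : TriPiece O B G x) : Set Pt := tri (x 0) (x 1) (x 2)

lemma injective (h : TriPiece O B G x) : Function.Injective x := by
  have h1 : ∀ k, x (k + 1) ≠ x k := by
    intro k hk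
    have := h.det k
    rw [hk, sub_self, det2_zero_left] at this
    exact lt_irrefl _ this
  intro i j hij
  have h0 := h1 0
  have h1' := h1 1
  have h2 := h1 2
  change x 1 ≠ x 0 at h0
  change x 2 ≠ x 1 at h1'
  change x 0 ≠ x 2 at h2
  fin_cases i <;> fin_cases j <;> simp_all

lemma corner_mem (h : TriPiece O B G x) (i : Fin 3) : x i ∈ h.body := (h.extreme i).1

lemma subset_body (h : TriPiece O B G x) : G ⊆ h.body := by
  rw [body, ← h.hull]
  exact subset_closure.trans (subset_convexHull ℝ _)

lemma subset_interior (h : TriPiece O B G x) : G ⊆ interior h.body :=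
  interior_maximal h.subset_body h.piece.isOpen

lemma extreme' (h : TriPiece O B G x) (i : Fin 3) :
    x i ∈ (convexHull ℝ (closure G)).extremePoints ℝ := by
  rw [h.hull]; exact h.extreme i

lemma corner_of_mem_tri (h : TriPiece O B G x) {y u v : Pt} (hy : y ∈ h.body) (hu : u ∈ h.body)
    (hv : v ∈ h.body) {i : Fin 3} (hi : x i ∈ tri y u v) : x i = y ∨ x i = u ∨ x i = v := by
  have h1 : x i ∈ (convexHull ℝ {y, u, v}).extremePoints ℝ :=
    inter_extremePoints_subset_extremePoints_of_subset (tri_subset (convex_tri _ _ _) hy hu hv)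
      ⟨hi, h.extreme i⟩
  simpa using extremePoints_convexHull_subset h1

/-- Outer chords whose parts stay away from the corners do not exist. -/
lemma no_fourth (h : TriPiece O B G x) {V F : Set Pt} {m u : Pt} (hV : IsOuter O G V m u)
    (hF : IsClosed F) (hVF : V ⊆ F) (hxF : ∀ i, x i ∉ F) : False := by
  have := h.piece.card_extreme_le h.dom h.finite h.injective h.extreme' (l := [(m, u)]) (C := ∅)
    (by simpa using h.piece.outer_mem hV) (by simp) hF hxF
    (by simpa using ⟨V, hVF, hV⟩) (by simp) (by simp) (by simp) (by simp)
  have := h.card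
  simp at *
  omega

lemma corner_notMem_interior (h : TriPiece O B G x) (i : Fin 3) : x i ∉ interior h.body := by
  intro hb
  obtain ⟨s, hs, -, hm⟩ := exists_small_smul (x i) (x i - x (i + 1))
    (mem_interior_iff_mem_nhds.1 hb)
  have hne : x i ≠ x (i + 1) := fun hh => by
    have := h.injective hh
    revert this
    fin_cases i <;> decide
  refine hne ((mem_extremePoints.1 (h.extreme i)).2 _ hm _ (h.corner_mem (i + 1)) ?_).2.symm
  refine ⟨1 / (1 + s), s / (1 + s), by positivity, by positivity, by field_simp, ?_⟩
  have h1 : (1 + s) ≠ 0 := by positivity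
  rw [show x i + s • (x i - x (i + 1)) = (1 + s) • x i - s • x (i + 1) by module, smul_sub,
    smul_smul, smul_smul, one_div_mul_cancel h1, one_smul, one_div_mul_eq_div]
  abel

/-- No point of `B` lies in the piece. -/
lemma disjoint_finite (h : TriPiece O B G x) : Disjoint G B := by
  rw [Set.disjoint_left]
  intro b hbG hbB
  have hxb : ∀ i, x i ∉ ({b} : Set Pt) := by
    rintro i rfl
    exact h.corner_notMem_interior i (h.subset_interior hbG)
  have := h.piece.card_extreme_le h.dom h.finite h.injective h.extreme' (l := []) (F := {b})
    (C := {b}) (by simp) (by simp) isClosed_singleton hxb (by simp) (by simpa) (by simpa)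
    (by simp) subset_rfl
  have := h.card
  simp at *
  omega

end TriPiece

/-- The part of an open set inside a triangle and beyond a line is a cut when its edges are not
met. -/
lemma isCut_tri {G : Set Pt} (hG : IsOpen G) {y u v d : Pt} {t : ℝ} (hd : d ≠ 0)
    (hne : ({z ∈ G | t < det2 d z} ∩ tri y u v).Nonempty)
    (h1 : Disjoint {z ∈ G | t < det2 d z} (segment ℝ y u))
    (h2 : Disjoint {z ∈ G | t < det2 d z} (segment ℝ y v))
    (h3 : Disjoint {z ∈ G | t < det2 d z} (segment ℝ u v)) :
    IsCut G ({z ∈ G | t < det2 d z} ∩ tri y u v) d t := by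
  have ho : IsOpen {z ∈ G | t < det2 d z} :=
    hG.inter (isOpen_lt continuous_const (by fun_prop) : IsOpen {z : Pt | t < det2 d z})
  refine ⟨hd, hne, Set.inter_subset_left, ?_, ?_⟩
  · convert ho.inter (isOpen_interior (s := tri y u v)) using 1
    refine Set.Subset.antisymm (fun z hz => ⟨hz.1, ?_⟩)
      (Set.inter_subset_inter_right _ interior_subset)
    exact mem_interior_tri_of_notMem hz.2 (Set.disjoint_left.1 h1 hz.1)
      (Set.disjoint_left.1 h2 hz.1) (Set.disjoint_left.1 h3 hz.1)
  · rw [Set.sdiff_self_inter]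
    exact ho.sdiff (isClosed_tri _ _ _)

lemma det2_of_mem_segment {a b d z : Pt} (h : det2 d a = det2 d b) (hz : z ∈ segment ℝ a b) :
    det2 d z = det2 d a := by
  obtain ⟨α, β, -, -, hs, rfl⟩ := hz
  rw [det2_add_right, det2_smul_right, det2_smul_right, ← h]
  linear_combination det2 d a * hs

/-- A triangle two of whose edges miss an open set either misses the set or contains a cut. -/
lemma exists_ear {G : Set Pt} (hG : IsOpen G) {y u v : Pt} (h1 : Disjoint G (segment ℝ y u))
    (h2 : Disjoint G (segment ℝ y v)) (hne : ¬ Disjoint G (tri y u v)) :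
    ∃ d t, IsCut G ({z ∈ G | t < det2 d z} ∩ tri y u v) d t ∧ det2 d u < t ∧ det2 d v < t := by
  obtain ⟨g, hgG, hgt⟩ := Set.not_disjoint_iff.1 hne
  have hg1 := Set.disjoint_left.1 h1 hgG
  have hg2 := Set.disjoint_left.1 h2 hgG
  have hdet : det2 (u - y) (v - y) ≠ 0 := fun h => (mem_segment_of_mem_tri h hgt).elim hg1 hg2
  obtain ⟨d, huv, hyu⟩ : ∃ d : Pt, det2 d v = det2 d u ∧ det2 d u < det2 d y := by
    have e : det2 (v - u) (y - u) = det2 (u - y) (v - y) := det2_rotate y u v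
    have e' : det2 (v - u) v = det2 (v - u) u := by
      rw [← sub_eq_zero, ← det2_sub_right, det2_self]
    rcases hdet.lt_or_gt with h | h
    · refine ⟨-(v - u), by rw [det2_neg_left, det2_neg_left, e'], ?_⟩
      rw [det2_sub_right] at e
      rw [det2_neg_left, det2_neg_left]
      linarith
    · refine ⟨v - u, e', ?_⟩
      rw [det2_sub_right] at e
      linarith
  have hd : d ≠ 0 := by
    rintro rfl
    simp at hyu
  have hge : ∀ z ∈ tri y u v, det2 d u ≤ det2 d z ∧ (det2 d z = det2 d u → z ∈ segment ℝ u v) := by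
    intro z hz
    obtain ⟨α, β, γ, hα, hβ, hγ, hs, rfl⟩ := mem_tri.1 hz
    have : det2 d (α • y + β • u + γ • v) = det2 d u + α * (det2 d y - det2 d u) := by
      rw [det2_add_right, det2_add_right, det2_smul_right, det2_smul_right, det2_smul_right, huv]
      linear_combination det2 d u * hs
    rw [this]
    refine ⟨by nlinarith, fun h => ?_⟩
    have hα0 : α = 0 := by
      rcases mul_eq_zero.1 (by linarith : α * (det2 d y - det2 d u) = 0) with h | h
      · exact h
      · linarith
    exact ⟨β, γ, hβ, hγ, by linarith, by simp [hα0]⟩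
  obtain ⟨g', hgG', hgt', hlt⟩ : ∃ g' ∈ G, g' ∈ tri y u v ∧ det2 d u < det2 d g' := by
    rcases (hge g hgt).1.lt_or_eq with h | h
    · exact ⟨g, hgG, hgt, h⟩
    · obtain ⟨s, hs, hs1, hm⟩ := exists_small_smul g (y - g) (hG.mem_nhds hgG)
      refine ⟨_, hm, ?_, ?_⟩
      · exact (convex_tri y u v).segment_subset hgt (left_mem_tri _ _ _)
          ⟨1 - s, s, by linarith, hs.le, by ring, by module⟩
      · rw [det2_add_right, det2_smul_right, det2_sub_right, ← h]
        nlinarith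
  obtain ⟨t, ht, ht'⟩ := exists_between hlt
  refine ⟨d, t, isCut_tri hG hd ⟨g', ⟨hgG', ht'⟩, hgt'⟩ (h1.mono_left fun z hz => hz.1)
    (h2.mono_left fun z hz => hz.1) ?_, ht, by rwa [huv]⟩
  rw [Set.disjoint_left]
  intro z hz hzs
  have := hz.2
  rw [det2_of_mem_segment huv.symm hzs] at this
  linarith

namespace TriPiece
variable {O B G : Set Pt} {x : Fin 3 → Pt}

/-- Two segments missing the piece span a triangle missing the piece. -/
lemma disjoint_tri (h : TriPiece O B G x) {y u v : Pt} (hy : y ∈ h.body) (hyx : ∀ i, x i ≠ y)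
    (hu : u ∈ h.body) (hv : v ∈ h.body) (h1 : Disjoint G (segment ℝ y u))
    (h2 : Disjoint G (segment ℝ y v)) : Disjoint G (tri y u v) := by
  by_contra hne
  obtain ⟨d, t, hc, hut, hvt⟩ := exists_ear h.piece.isOpen h1 h2 hne
  obtain ⟨V, hV, m, hm, -⟩ := h.piece.exists_outer_of_cut h.dom h.finite hc Set.finite_empty
  refine h.no_fourth hm (F := tri y u v ∩ {z | t ≤ det2 d z})
    ((isClosed_tri _ _ _).inter (isClosed_le continuous_const (by fun_prop)))
    (fun z hz => ⟨(hV hz).2, (hV hz).1.2.le⟩) ?_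
  rintro i ⟨hi, hit⟩
  simp only [Set.mem_ofPred_eq] at hit
  rcases h.corner_of_mem_tri hy hu hv hi with hi' | hi' | hi'
  · exact hyx i hi'
  · rw [hi'] at hit; linarith
  · rw [hi'] at hit; linarith

/-- The midpoint of the side opposite to the `k`-th corner. -/
abbrev mid (x : Fin 3 → Pt) (k : Fin 3) : Pt := midpoint ℝ (x (k + 1)) (x (k + 2))

/-- The points of the triangle seen from the middle of the `k`-th side. -/
def pocket (h : TriPiece O B G x) (k : Fin 3) : Set Pt :=
  {z ∈ h.body | Disjoint G (segment ℝ (mid x k) z)}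

end TriPiece

lemma fin_three_add (j : Fin 3) : j + 1 + 1 = j + 2 ∧ j + 1 + 2 = j ∧ j + 2 + 1 = j ∧
    j + 2 + 2 = j + 1 := by
  revert j; decide

lemma fin_three_cases (i j : Fin 3) : i = j ∨ i = j + 1 ∨ i = j + 2 := by
  revert i j; decide

lemma fin_three_ne (j : Fin 3) : j + 1 ≠ j ∧ j + 2 ≠ j ∧ j + 1 ≠ j + 2 := by
  revert j; decide

namespace TriPiece
variable {O B G : Set Pt} {x : Fin 3 → Pt} {z p : Pt} {k : Fin 3}

lemma body_eq (h : TriPiece O B G x) (k : Fin 3) : h.body = tri (x k) (x (k + 1)) (x (k + 2)) := by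
  fin_cases k
  · rfl
  · exact tri_rotate _ _ _
  · exact (tri_rotate _ _ _).trans (tri_rotate _ _ _)

lemma det2_pos_of_interior (h : TriPiece O B G x) (hz : z ∈ interior h.body) (k : Fin 3) :
    0 < det2 (x (k + 1) - x k) (z - x k) := by
  rw [h.body_eq k] at hz
  exact det2_pos_of_mem_interior_tri (h.det k) hz

lemma side_subset (h : TriPiece O B G x) (i j : Fin 3) : segment ℝ (x i) (x j) ⊆ h.body :=
  (convex_tri _ _ _).segment_subset (h.corner_mem i) (h.corner_mem j)

lemma side_notMem_interior (h : TriPiece O B G x) (hp : p ∈ segment ℝ (x k) (x (k + 1))) :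
    p ∉ interior h.body := fun hi => by
  have := h.det2_pos_of_interior hi k
  rw [det2_openSegment hp] at this
  exact lt_irrefl _ this

lemma disjoint_side (h : TriPiece O B G x) (k : Fin 3) :
    Disjoint G (segment ℝ (x k) (x (k + 1))) :=
  Set.disjoint_left.2 fun _ hz hzs => h.side_notMem_interior hzs (h.subset_interior hz)

lemma mid_mem_side (x : Fin 3 → Pt) (k : Fin 3) : mid x k ∈ segment ℝ (x (k + 1)) (x (k + 1 + 1)) := by
  rw [(fin_three_add k).1]
  exact midpoint_mem_segment _ _

lemma mid_mem (h : TriPiece O B G x) (k : Fin 3) : mid x k ∈ h.body :=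
  h.side_subset _ _ (mid_mem_side x k)

lemma corner_ne_mid (h : TriPiece O B G x) (i k : Fin 3) : x i ≠ mid x k := by
  intro hi
  have h1 : x i ∈ openSegment ℝ (x (k + 1)) (x (k + 2)) := by
    rw [hi]
    refine ⟨1 / 2, 1 / 2, by norm_num, by norm_num, by norm_num, ?_⟩
    rw [mid, midpoint_eq_smul_add, smul_add]
    norm_num
  have h2 := (mem_extremePoints.1 (h.extreme i)).2 _ (h.corner_mem _) _ (h.corner_mem _) h1
  exact (fin_three_ne k).2.2 (h.injective (h2.1.trans h2.2.symm))

lemma corner_mem_pocket (h : TriPiece O B G x) (k : Fin 3) :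
    x (k + 1) ∈ h.pocket k ∧ x (k + 2) ∈ h.pocket k := by
  have := mid_mem_side x k
  have hs := h.disjoint_side (k + 1)
  refine ⟨⟨h.corner_mem _, hs.mono_right ?_⟩, ⟨h.corner_mem _, hs.mono_right ?_⟩⟩
  · exact (convex_segment _ _).segment_subset this (left_mem_segment _ _ _)
  · rw [← (fin_three_add k).1]
    exact (convex_segment _ _).segment_subset this (right_mem_segment _ _ _)

lemma convex_pocket (h : TriPiece O B G x) (k : Fin 3) : Convex ℝ (h.pocket k) := by
  rw [convex_iff_segment_subset]
  intro z hz w hw p hp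
  have hd := h.disjoint_tri (h.mid_mem k) (fun i => h.corner_ne_mid i k) hz.1 hw.1 hz.2 hw.2
  refine ⟨(convex_tri _ _ _).segment_subset hz.1 hw.1 hp, hd.mono_right ?_⟩
  exact (convex_tri _ _ _).segment_subset (left_mem_tri _ _ _)
    ((convex_tri _ _ _).segment_subset (mid_mem_tri _ _ _) (right_mem_tri _ _ _) hp)

lemma disjoint_pocket (h : TriPiece O B G x) (k : Fin 3) : Disjoint G (h.pocket k) :=
  Set.disjoint_left.2 fun _ hz hp => Set.disjoint_left.1 hp.2 hz (right_mem_segment _ _ _)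

lemma isClosed_pocket (h : TriPiece O B G x) (k : Fin 3) : IsClosed (h.pocket k) := by
  refine isClosed_of_closure_subset fun z hz => ?_
  have hzb : z ∈ h.body := closure_minimal (fun w hw => hw.1) (isClosed_tri _ _ _) hz
  refine ⟨hzb, Set.disjoint_left.2 fun g hgG hg => ?_⟩
  obtain ⟨α, β, hα, hβ, hs, rfl⟩ := hg
  have hc : Continuous fun w : Pt => α • mid x k + β • w := by fun_prop
  obtain ⟨w, hw, hwp⟩ := mem_closure_iff_nhds.1 hz _
    ((h.piece.isOpen.preimage hc).mem_nhds hgG)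
  exact Set.disjoint_left.1 hwp.2 hw ⟨α, β, hα, hβ, hs, rfl⟩

/-- Following a polygonal line that leaves the triangle without meeting the piece, one finds a
boundary point of the triangle seen from the start. -/
lemma exists_seen_boundary (h : TriPiece O B G x) (hz : z ∈ interior h.body) (hzG : z ∉ G) (n : ℕ)
    (w : ℕ → Pt) (hw : w 0 = z) (hd : ∀ i, Disjoint G (segment ℝ (w i) (w (i + 1))))
    (hn : w n ∉ interior h.body) :
    ∃ p ∈ h.body, p ∉ interior h.body ∧ Disjoint G (segment ℝ z p) := by
  by_contra hcon
  push Not at hcon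
  have key : ∀ i, w i ∈ interior h.body ∧ Disjoint G (segment ℝ z (w i)) := by
    intro i
    induction i with
    | zero =>
      rw [hw, segment_same]
      exact ⟨hz, by simpa using hzG⟩
    | succ i ih =>
      obtain ⟨hi, hid⟩ := ih
      have see : ∀ p ∈ segment ℝ (w i) (w (i + 1)), p ∈ h.body → Disjoint G (segment ℝ z p) := by
        intro p hp hpb
        have hne : ∀ j, x j ≠ w i := fun j hj => h.corner_notMem_interior j (hj ▸ hi)
        have hwp : Disjoint G (segment ℝ (w i) p) := (hd i).mono_right
          ((convex_segment _ _).segment_subset (left_mem_segment _ _ _) hp)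
        refine (h.disjoint_tri (interior_subset hi) hne (interior_subset hz) hpb
          (by rwa [segment_symm]) hwp).mono_right ?_
        exact (convex_tri _ _ _).segment_subset (mid_mem_tri _ _ _) (right_mem_tri _ _ _)
      by_cases hi' : w (i + 1) ∈ interior h.body
      · exact ⟨hi', see _ (right_mem_segment _ _ _) (interior_subset hi')⟩
      · exfalso
        obtain ⟨p, hp, hpf⟩ : ∃ p ∈ segment ℝ (w i) (w (i + 1)), p ∈ frontier (interior h.body) := by
          by_contra hno
          push Not at hno
          obtain ⟨q, hq, hq1, hq2⟩ := (convex_segment (𝕜 := ℝ) (w i) (w (i + 1))).isPreconnected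
            (interior h.body) (closure (interior h.body))ᶜ isOpen_interior
            isClosed_closure.isOpen_compl
            (fun q hq => by
              by_cases hqi : q ∈ interior h.body
              · exact Or.inl hqi
              · exact Or.inr fun hqc => hno q hq ⟨hqc, by rwa [interior_interior]⟩)
            ⟨_, left_mem_segment _ _ _, hi⟩
            ⟨_, right_mem_segment _ _ _, fun hqc => hno _ (right_mem_segment _ _ _)
              ⟨hqc, by rwa [interior_interior]⟩⟩
          exact hq2 (subset_closure hq1)
        have hpb : p ∈ h.body := closure_minimal interior_subset (isClosed_tri _ _ _) hpf.1
        have hpi : p ∉ interior h.body := by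
          have := hpf.2
          rwa [interior_interior] at this
        exact hcon p hpb hpi (see p hp hpb)
  exact hn (key n).1

lemma exists_side (h : TriPiece O B G x) (hp : p ∈ h.body) (hpi : p ∉ interior h.body) :
    ∃ k, p ∈ segment ℝ (x (k + 1)) (x (k + 1 + 1)) := by
  by_contra hcon
  push Not at hcon
  refine hpi (mem_interior_tri_of_notMem hp (hcon 2) ?_ (hcon 0))
  rw [segment_symm]
  exact hcon 1

lemma mem_pocket_of_side (h : TriPiece O B G x) (hz : z ∈ h.body)
    (hp : p ∈ segment ℝ (x (k + 1)) (x (k + 1 + 1))) (hpc : ∀ i, x i ≠ p)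
    (hd : Disjoint G (segment ℝ z p)) : z ∈ h.pocket k := by
  refine ⟨hz, (h.disjoint_tri (h.side_subset _ _ hp) hpc (h.mid_mem k) hz ?_
    (by rwa [segment_symm])).mono_right ?_⟩
  · exact (h.disjoint_side (k + 1)).mono_right
      ((convex_segment _ _).segment_subset hp (mid_mem_side x k))
  · exact (convex_tri _ _ _).segment_subset (mid_mem_tri _ _ _) (right_mem_tri _ _ _)

end TriPiece

namespace TriPiece
variable {O B G : Set Pt} {x : Fin 3 → Pt} {z p q : Pt} {j k : Fin 3}

/-- A wedge at a corner which meets the piece has the corner as a limit point of the piece. -/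
lemma corner_mem_closure (h : TriPiece O B G x) (hz : z ∈ interior h.body)
    (hzj : Disjoint G (segment ℝ (x j) z)) (hp : p ∈ h.body) (hpc : ∀ i, x i ≠ p)
    (hpj : Disjoint G (segment ℝ (x j) p)) (hzp : ¬ Disjoint G (segment ℝ z p)) :
    x j ∈ closure (G ∩ tri (x j) z p) := by
  by_contra hx
  obtain ⟨d, t, hc, -, -⟩ := exists_ear h.piece.isOpen hzj hpj fun hd => hzp (hd.mono_right
    ((convex_tri _ _ _).segment_subset (mid_mem_tri _ _ _) (right_mem_tri _ _ _)))
  obtain ⟨V, hV, m, hm, -⟩ := h.piece.exists_outer_of_cut h.dom h.finite hc Set.finite_empty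
  refine h.no_fourth hm (F := closure (G ∩ tri (x j) z p)) isClosed_closure
    (fun w hw => subset_closure ⟨(hV hw).1.1, (hV hw).2⟩) ?_
  intro i hi
  have hit : x i ∈ tri (x j) z p := closure_minimal Set.inter_subset_right (isClosed_tri _ _ _) hi
  rcases h.corner_of_mem_tri (h.corner_mem j) (interior_subset hz) hp hit with h' | h' | h'
  · exact hx (h' ▸ hi)
  · exact h.corner_notMem_interior i (h' ▸ hz)
  · exact hpc i h'

/-- Near a corner, a wedge meeting the piece contains an outer chord close to the corner but not
through it. -/
lemma exists_wedge_outer (h : TriPiece O B G x) (hz : z ∈ interior h.body)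
    (hzj : Disjoint G (segment ℝ (x j) z)) (hp : p ∈ h.body) (hpc : ∀ i, x i ≠ p)
    (hpj : Disjoint G (segment ℝ (x j) p)) (hzp : ¬ Disjoint G (segment ℝ z p)) {U : Set Pt}
    (hU : U ∈ nhds (x j)) :
    ∃ V ⊆ U ∩ tri (x j) z p, ∃ m u, IsOuter O G V m u ∧
      x j ∉ closure (chord O m u ∩ G) := by
  have hU' : U ∩ (segment ℝ z p)ᶜ ∈ nhds (x j) := by
    refine Filter.inter_mem hU ((isClosed_segment _ _).isOpen_compl.mem_nhds fun hj => ?_)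
    have hj' : x j ∈ tri z z p :=
      (convex_tri _ _ _).segment_subset (left_mem_tri _ _ _) (right_mem_tri _ _ _) hj
    rcases h.corner_of_mem_tri (interior_subset hz) (interior_subset hz) hp hj' with h' | h' | h'
    · exact h.corner_notMem_interior j (h' ▸ hz)
    · exact h.corner_notMem_interior j (h' ▸ hz)
    · exact hpc j h'
  obtain ⟨u, t, ht, hc, hsub⟩ := h.piece.exists_isCut_cap h.dom (h.extreme' j) hU'
  have hsub' : ∀ w ∈ {w ∈ G | t < det2 u w}, w ∈ U ∩ (segment ℝ z p)ᶜ := fun w hw =>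
    hsub w (subset_convexHull ℝ _ (subset_closure hw.1)) hw.2
  have ho : IsOpen {w : Pt | t < det2 u w} := isOpen_lt continuous_const (by fun_prop)
  obtain ⟨w, hw, hwG⟩ := mem_closure_iff.1 (h.corner_mem_closure hz hzj hp hpc hpj hzp) _ ho ht
  have hcut := isCut_tri h.piece.isOpen (y := x j) (u := z) (v := p) hc.ne_zero
    ⟨w, ⟨hwG.1, hw⟩, hwG.2⟩ (hzj.mono_left fun w hw => hw.1) (hpj.mono_left fun w hw => hw.1)
    (Set.disjoint_left.2 fun w hw => (hsub' w hw).2)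
  obtain ⟨V, hV, m, hm, hav⟩ := h.piece.exists_outer_of_cut h.dom h.finite hcut
    (Set.finite_singleton (x j))
  refine ⟨V, fun w hw => ⟨(hsub' w (hV hw).1).1, (hV hw).2⟩, m, u, hm, fun hcl => ?_⟩
  exact hav _ rfl (IsOuter.det2_of_mem_closure hcl).symm

/-- A point cut off from the piece by a segment to a corner is seen from one of the two adjacent
sides. -/
lemma mem_pocket_of_corner (h : TriPiece O B G x) (hz : z ∈ interior h.body)
    (hzj : Disjoint G (segment ℝ z (x j))) : ∃ k, z ∈ h.pocket k := by
  obtain ⟨e1, e2, e3, e4⟩ := fin_three_add j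
  by_contra hcon
  push Not at hcon
  have hzj' : Disjoint G (segment ℝ (x j) z) := by rwa [segment_symm]
  have hno : ∀ k, ¬ Disjoint G (segment ℝ z (mid x k)) := fun k hd =>
    hcon k ⟨interior_subset hz, by rwa [segment_symm]⟩
  have s1 : Disjoint G (segment ℝ (x j) (mid x (j + 1))) := by
    refine (h.disjoint_side (j + 2)).mono_right ?_
    rw [e3, mid, e1, e2]
    refine (convex_segment _ _).segment_subset (right_mem_segment _ _ _) ?_
    exact midpoint_mem_segment _ _
  have s2 : Disjoint G (segment ℝ (x j) (mid x (j + 2))) := by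
    refine (h.disjoint_side j).mono_right ?_
    rw [mid, e3, e4]
    refine (convex_segment _ _).segment_subset (left_mem_segment _ _ _) ?_
    exact midpoint_mem_segment _ _
  obtain ⟨V, hV, m, u, hm, hxm⟩ := h.exists_wedge_outer hz hzj' (h.mid_mem (j + 1))
    (fun i => h.corner_ne_mid i _) s1 (hno _) Filter.univ_mem
  obtain ⟨U, hU, hUc, hUs⟩ := exists_mem_nhds_isClosed_subset
    (isClosed_closure.isOpen_compl.mem_nhds hxm)
  obtain ⟨V', hV', m', u', hm', -⟩ := h.exists_wedge_outer hz hzj' (h.mid_mem (j + 2))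
    (fun i => h.corner_ne_mid i _) s2 (hno _) hU
  have d1 : 0 < det2 (z - x j) (mid x (j + 1) - x j) := by
    have := h.det2_pos_of_interior hz (j + 2)
    rw [e3] at this
    rw [mid, e1, e2, midpoint_eq_smul_add]
    simp only [det2, PiLp.sub_apply, PiLp.smul_apply, PiLp.add_apply, smul_eq_mul,
      invOf_eq_inv] at this ⊢
    linarith
  have d2 : det2 (z - x j) (mid x (j + 2) - x j) < 0 := by
    have := h.det2_pos_of_interior hz j
    rw [mid, e3, e4, midpoint_eq_smul_add]
    simp only [det2, PiLp.sub_apply, PiLp.smul_apply, PiLp.add_apply, smul_eq_mul,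
      invOf_eq_inv] at this ⊢
    linarith
  have key : ∀ q w : Pt, w ∈ tri (x j) z q → ∃ γ, 0 ≤ γ ∧
      det2 (z - x j) (w - x j) = γ * det2 (z - x j) (q - x j) ∧
      (γ = 0 → w ∈ segment ℝ (x j) z) := by
    intro q w hw
    obtain ⟨α, β, γ, hα, hβ, hγ, hs, rfl⟩ := mem_tri.1 hw
    obtain rfl : α = 1 - β - γ := by linarith
    refine ⟨γ, hγ, ?_, ?_⟩
    · simp only [det2, PiLp.sub_apply, PiLp.smul_apply, PiLp.add_apply, smul_eq_mul]
      ring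
    · rintro rfl
      exact ⟨1 - β - 0, β, hα, hβ, by ring, by simp⟩
  have hVV : Disjoint V V' := by
    refine Set.disjoint_left.2 fun w hw hw' => ?_
    obtain ⟨γ, hγ, h1, h2⟩ := key _ _ (hV hw).2
    obtain ⟨γ', hγ', h1', h2'⟩ := key _ _ (hV' hw').2
    refine Set.disjoint_left.1 hzj' (hm.subset hw) (h2 ?_)
    nlinarith
  have hind := h.piece.indep hm hm' hVV (Set.disjoint_left.2 fun w hw hw' =>
    hUs (closure_minimal (fun y hy => (hV' (hm'.chord hy)).1) hUc hw') hw)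
  have hcorner : ∀ i, i ≠ j → x i ∉ tri (x j) z (mid x (j + 1)) ∪ tri (x j) z (mid x (j + 2)) := by
    have : ∀ i k, i ≠ j → x i ∉ tri (x j) z (mid x k) := by
      intro i k hi hit
      rcases h.corner_of_mem_tri (h.corner_mem j) (interior_subset hz) (h.mid_mem k) hit with
        h' | h' | h'
      · exact hi (h.injective h')
      · exact h.corner_notMem_interior i (h' ▸ hz)
      · exact h.corner_ne_mid i k h'
    rintro i hi (hit | hit)
    exacts [this _ _ hi hit, this _ _ hi hit]
  have hcard := h.piece.card_extreme_le h.dom h.finite (x := ![x (j + 1), x (j + 2)])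
    (l := [(m, u), (m', u')]) (C := ∅)
    (F := tri (x j) z (mid x (j + 1)) ∪ tri (x j) z (mid x (j + 2))) ?_ ?_ ?_ ?_
    ((isClosed_tri _ _ _).union (isClosed_tri _ _ _)) ?_ ?_ (by simp) (by simp) (by simp) (by simp)
  · have := h.card
    simp at hcard
    omega
  · intro a b hab
    have := (fin_three_ne j).2.2
    have h12 : x (j + 1) ≠ x (j + 2) := fun hx => this (h.injective hx)
    fin_cases a <;> fin_cases b <;> simp_all [h12.symm]
  · intro i
    fin_cases i
    exacts [h.extreme' _, h.extreme' _]
  · simpa using ⟨h.piece.outer_mem hm, h.piece.outer_mem hm'⟩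
  · simpa using hind
  · intro i
    fin_cases i
    exacts [hcorner _ (fin_three_ne j).1, hcorner _ (fin_three_ne j).2.1]
  · simp only [List.mem_cons, List.not_mem_nil, or_false, forall_eq_or_imp, forall_eq]
    exact ⟨⟨V, fun w hw => Or.inl (hV hw).2, hm⟩, ⟨V', fun w hw => Or.inr (hV' hw).2, hm'⟩⟩

/-- A point of the triangle from which one can walk along a polygonal line out of the triangle
without meeting the piece lies in a pocket. -/
lemma exists_pocket_of_walk (h : TriPiece O B G x) (hz : z ∈ interior h.body) (n : ℕ)
    (w : ℕ → Pt) (hw : w 0 = z) (hd : ∀ i, Disjoint G (segment ℝ (w i) (w (i + 1))))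
    (hn : w n ∉ interior h.body) : ∃ k, z ∈ h.pocket k := by
  have hzG : z ∉ G := fun hG => Set.disjoint_left.1 (hd 0) hG (hw ▸ left_mem_segment _ _ _)
  obtain ⟨p, hpb, hpi, hpd⟩ := h.exists_seen_boundary hz hzG n w hw hd hn
  by_cases hc : ∃ j, x j = p
  · obtain ⟨j, rfl⟩ := hc
    exact h.mem_pocket_of_corner hz hpd
  · push Not at hc
    obtain ⟨k, hk⟩ := exists_side h hpb hpi
    exact ⟨k, h.mem_pocket_of_side (interior_subset hz) hk hc hpd⟩

end TriPiece

namespace SimplePolygon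
variable {P : SimplePolygon} {B G : Set Pt} {x : Fin 3 → Pt} {z : Pt}

lemma isCompact_boundary (P : SimplePolygon) : IsCompact P.boundary :=
  Metric.isCompact_of_isClosed_isBounded P.isClosed_boundary P.isBounded_boundary

lemma interior_subset_convexHull (hP : P.Nondegenerate) :
    P.interior ⊆ convexHull ℝ P.boundary := by
  intro p hp
  by_contra hpK
  obtain ⟨u, hu⟩ := exists_det2_pos (convex_convexHull ℝ P.boundary)
    (isCompact_convexHull P.isCompact_boundary).isClosed hpK
  have hu0 : u ≠ 0 := by
    rintro rfl
    have := hu _ (subset_convexHull ℝ _ (P.edge_subset_boundary 0 (P.vtx_mem_edge 0)))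
    simp at this
  obtain ⟨s, -, hs, -⟩ := SimplePolygon.exists_chord_end hP hp hu0
  have := hu _ (subset_convexHull ℝ _ hs)
  rw [add_sub_cancel_left, det2_smul_right, det2_self, mul_zero] at this
  exact lt_irrefl _ this

lemma exists_vtx_notMem (hP : P.Nondegenerate) {K : Set Pt} (hK : Convex ℝ K)
    (hO : ¬ closure P.interior ⊆ K) : ∃ i, P.vtx i ∉ K := by
  by_contra! hcon
  refine hO ((closure_minimal (interior_subset_convexHull hP)
    (isCompact_convexHull P.isCompact_boundary).isClosed).trans (convexHull_min ?_ hK))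
  intro p hp
  obtain ⟨i, -, hi⟩ := P.mem_boundary.1 hp
  exact hK.segment_subset (hcon i) (hcon (i + 1)) hi

/-- A point of the polygon in the triangle spanned by a piece which is outside the kernel lies in a
pocket. -/
lemma exists_pocket_of_notMem (hP : P.Nondegenerate) (h : TriPiece P.interior B G x)
    (hz : z ∈ _root_.interior h.body) (hzO : z ∈ P.interior)
    (hzN : z ∉ kernelSet P.interior B) : ∃ k, z ∈ h.pocket k := by
  obtain ⟨u, hu, hB⟩ : ∃ u ≠ 0, ¬ (leftSide P.interior z u ∩ B).Nonempty := by
    by_contra! hcon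
    exact hzN ⟨hzO, hcon⟩
  obtain ⟨s, hs, hsb, hso⟩ := SimplePolygon.exists_chord_end hP hzO hu
  obtain ⟨j, -, hj⟩ := P.mem_boundary.1 hsb
  have hGO : G ⊆ P.interior := h.piece.subset_domain
  have hbd : ∀ K ⊆ P.boundary, Disjoint G K := fun K hK =>
    (P.disjoint_interior_boundary.mono_left hGO).mono_right hK
  obtain ⟨i, hi⟩ : ∃ i, P.vtx i ∉ _root_.interior h.body := by
    refine P.exists_vtx_notMem hP (convex_tri _ _ _).interior fun hsub => ?_
    refine h.corner_notMem_interior 0 (hsub (closure_mono hGO ?_))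
    exact extremePoints_convexHull_subset (h.extreme' 0)
  set w : ℕ → Pt := fun k => match k with
    | 0 => z
    | 1 => z + s • u
    | k + 2 => P.vtx (j + 1 + k) with hw
  obtain ⟨k, hk⟩ : ∃ k, P.vtx (j + 1 + k) = P.vtx i := by
    refine ⟨i + P.n * (j + 1) - (j + 1), ?_⟩
    have : j + 1 ≤ P.n * (j + 1) := Nat.le_mul_of_pos_left _ P.n_pos
    rw [show j + 1 + (i + P.n * (j + 1) - (j + 1)) = i + P.n * (j + 1) by omega,
      ← P.vtx_mod, Nat.add_mul_mod_self_left, P.vtx_mod]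
  refine h.exists_pocket_of_walk hz (k + 2) w rfl ?_ (by simpa [hw, hk] using hi)
  rintro (_ | _ | m)
  · refine Set.disjoint_left.2 fun g hg hgs => ?_
    simp only [hw] at hgs
    rw [segment_eq_image'] at hgs
    obtain ⟨θ, ⟨h0, h1⟩, rfl⟩ := hgs
    simp only [add_sub_cancel_left, smul_smul] at hg
    rcases h1.lt_or_eq with h1 | rfl
    · refine (chordDomain_interior hP).notMem_kernelSet_chord hu hB hzO
        (q := z + (θ * s) • u) ⟨θ * s, rfl, ?_⟩ (h.piece.subset_kernelSet hg)
      rw [segment_eq_image']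
      rintro _ ⟨τ, ⟨h2, h3⟩, rfl⟩
      simp only [add_sub_cancel_left, smul_smul]
      refine hso _ (by positivity) ?_
      calc τ * (θ * s) ≤ 1 * (θ * s) := by gcongr
        _ < s := by nlinarith
    · rw [one_mul] at hg
      exact Set.disjoint_left.1 P.disjoint_interior_boundary (hGO hg) hsb
  · refine hbd _ (((convex_segment _ _).segment_subset hj (right_mem_segment _ _ _)).trans ?_)
    exact P.edge_subset_boundary j
  · exact hbd _ (P.edge_subset_boundary _)

/-- A point of the blocking set in the triangle spanned by a piece lies in a pocket. -/
lemma exists_pocket_of_mem (hP : P.Nondegenerate) (h : TriPiece P.interior B G x)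
    (hz : z ∈ _root_.interior h.body) (hzO : z ∈ P.interior) (hzB : z ∈ B) :
    ∃ k, z ∈ h.pocket k := by
  have hzN : z ∉ _root_.interior (kernelSet P.interior B) := by
    intro hzN
    obtain ⟨y, hy⟩ := (IsPiece.of_component h.dom z).exists_triPiece h.dom h.finite h.card
      ⟨z, mem_connectedComponentIn hzN⟩
    exact Set.disjoint_left.1 hy.disjoint_finite (mem_connectedComponentIn hzN) hzB
  rw [← Set.mem_iUnion, ← (isClosed_iUnion_of_finite fun k => h.isClosed_pocket k).closure_eq]
  refine mem_closure_iff.2 fun U hU hzU => ?_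
  by_contra hno
  refine hzN (mem_interior.2 ⟨U ∩ (_root_.interior h.body ∩ P.interior), fun y hy => ?_,
    hU.inter (_root_.isOpen_interior.inter P.isOpen_interior), hzU, hz, hzO⟩)
  by_contra hyN
  obtain ⟨k, hk⟩ := exists_pocket_of_notMem hP h hy.2.1 hy.2.2 hyN
  exact hno ⟨y, hy.1, Set.mem_iUnion.2 ⟨k, hk⟩⟩

end SimplePolygon

lemma exists_pair_of_subsingleton {p : Fin 3 → Prop} (h : ∀ i j, p i → p j → i = j) :
    ∃ i j, i ≠ j ∧ ¬ p i ∧ ¬ p j := by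
  by_cases h0 : p 0
  · exact ⟨1, 2, by decide, fun h1 => by simpa using h _ _ h0 h1, fun h1 => by simpa using h _ _ h0 h1⟩
  by_cases h1 : p 1
  · exact ⟨0, 2, by decide, h0, fun h2 => by simpa using h _ _ h1 h2⟩
  · exact ⟨0, 1, by decide, h0, h1⟩

namespace TriPiece
variable {O B G G' : Set Pt} {x x' : Fin 3 → Pt}

/-- Pairwise independent outer chords near the corners of a piece, away from a closed set. -/
lemma exists_corner_outer (h : TriPiece O B G x) {F E : Set Pt} (hF : IsClosed F)
    (hxF : ∀ i, x i ∉ F) (hE : E.Finite) : ∃ V : Fin 3 → Set Pt, ∃ m u : Fin 3 → Pt,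
      (∀ i, IsOuter O G (V i) (m i) (u i)) ∧
      (∀ i j, i ≠ j → Indep O B (m i, u i) (m j, u j)) ∧
      (∀ i, Disjoint (closure (V i)) F) ∧ ∀ i, ∀ e ∈ E, det2 (u i) (m i) ≠ det2 (u i) e := by
  obtain ⟨δ, hδ, hd, hdF⟩ := exists_radius h.injective hF hxF
  choose V hV m u hm hav using fun i =>
    h.piece.exists_cap_outer h.dom h.finite (h.extreme' i) (Metric.closedBall_mem_nhds (x i) hδ) hE
  have hVc : ∀ i, closure (V i) ⊆ Metric.closedBall (x i) δ := fun i =>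
    closure_minimal (hV i) Metric.isClosed_closedBall
  exact ⟨V, m, u, hm, fun i j hij => h.piece.indep_of_closure (hm i) (hm j)
    ((hd i j hij).mono (hVc i) (hVc j)), fun i => (hdF i).mono_left (hVc i), hav⟩

/-- At most one of several independent outer chords of a piece has a disjoint piece to its left. -/
lemma exists_pair_outer (hO : ChordDomain O) (hG : IsPiece O B G) (hG' : IsPiece O B G')
    (hd : Disjoint G G') (hne : G'.Nonempty) {V : Fin 3 → Set Pt} {m u : Fin 3 → Pt}
    (hV : ∀ i, IsOuter O G (V i) (m i) (u i))
    (hi : ∀ i j, i ≠ j → Indep O B (m i, u i) (m j, u j)) :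
    ∃ i j, i ≠ j ∧ Disjoint G' (leftSide O (m i) (u i)) ∧
      Disjoint G' (leftSide O (m j) (u j)) := by
  obtain ⟨y, hy⟩ := hne
  have hm := fun i => hG.outer_mem (hV i)
  have hc : ∀ i, Disjoint G' (chord O (m i) (u i)) := fun i => by
    refine Set.disjoint_left.2 fun z hz hzc => ?_
    obtain ⟨w, hw, hwG⟩ := mem_closure_iff.1
      (hG.mem_closure_chord (hV i) hzc (hG'.subset_kernelSet hz)) _ hG'.isOpen hz
    exact Set.disjoint_left.1 hd hwG.2 hw
  have hL : ∀ i, y ∉ leftSide O (m i) (u i) → Disjoint G' (leftSide O (m i) (u i)) :=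
    fun i hyi => Set.disjoint_left.2 fun z hz hzl => hyi (subset_leftSide hO.isOpen
      (hm i).1.1 (hm i).2 hG'.subset_domain (hc i) hG'.isPreconnected hz hzl hy)
  obtain ⟨i, j, hij, h1, h2⟩ := exists_pair_of_subsingleton
    (p := fun i => y ∈ leftSide O (m i) (u i)) fun i j h1 h2 => by
      by_contra hij
      have h := hi i j hij
      exact (hO.sides_disjoint (hm i).2 (hm j).2 (hm i).1 (hm j).1 h.left h.right h.chord h1 h2).2
        (hG'.subset_kernelSet hy)
  exact ⟨i, j, hij, hL i h1, hL j h2⟩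

/-- Two pieces intersect. -/
lemma not_disjoint (h : TriPiece O B G x) (h' : TriPiece O B G' x') : ¬ Disjoint G G' := by
  intro hd
  have hne : ∀ {G x}, TriPiece O B G x → G.Nonempty := fun {G x} h =>
    closure_nonempty_iff.1 ⟨_, extremePoints_convexHull_subset (h.extreme' 0)⟩
  obtain ⟨V, m, u, hV, hi, -, hav⟩ := h.exists_corner_outer isClosed_empty (by simp)
    (Set.finite_range x')
  have hF : IsClosed (⋃ i, closure (chord O (m i) (u i) ∩ G)) :=
    isClosed_iUnion_of_finite fun i => isClosed_closure
  obtain ⟨V', m', u', hV', hi', hVF, -⟩ := h'.exists_corner_outer hF (fun j hj => by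
    obtain ⟨i, hij⟩ := Set.mem_iUnion.1 hj
    exact hav i _ (Set.mem_range_self j) (IsOuter.det2_of_mem_closure hij).symm) Set.finite_empty
  obtain ⟨i, j, hij, hGi, hGj⟩ := exists_pair_outer h.dom h.piece h'.piece hd (hne h') hV hi
  obtain ⟨k, l, hkl, hGk, hGl⟩ := exists_pair_outer h.dom h'.piece h.piece hd.symm (hne h) hV' hi'
  have key : ∀ a b, Disjoint G' (leftSide O (m a) (u a)) → Disjoint G (leftSide O (m' b) (u' b)) →
      Indep O B (m a, u a) (m' b, u' b) := fun a b ha hb =>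
    ⟨Set.disjoint_left.1 ha ((hV' b).subset (hV' b).mem),
      Set.disjoint_left.1 hb ((hV a).subset (hV a).mem), fun z hz hz' hzN =>
      Set.disjoint_left.1 (hVF b)
        (closure_mono (hV' b).chord (h'.piece.mem_closure_chord (hV' b) hz' hzN))
        (Set.mem_iUnion.2 ⟨a, h.piece.mem_closure_chord (hV a) hz hzN⟩)⟩
  have := h.dom.length_add_le (l := [(m i, u i), (m j, u j), (m' k, u' k), (m' l, u' l)]) (C := ∅)
    h.finite (by simp) ?_ ?_ (by simp)
  · have hB := h.card
    simp at this
    omega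
  · simpa using ⟨h.piece.outer_mem (hV i), h.piece.outer_mem (hV j), h'.piece.outer_mem (hV' k),
      h'.piece.outer_mem (hV' l)⟩
  · simp only [List.pairwise_cons, List.mem_cons, List.not_mem_nil, or_false, forall_eq_or_imp,
      forall_eq, false_implies, implies_true, List.Pairwise.nil, and_true]
    exact ⟨⟨hi i j hij, key _ _ hGi hGk, key _ _ hGi hGl⟩, ⟨key _ _ hGj hGk, key _ _ hGj hGl⟩,
      hi' k l hkl⟩

end TriPiece

/-- All interior points of the kernel set belong to one piece. -/
lemma ChordDomain.mem_component {O B : Set Pt} (hO : ChordDomain O) (hB : B.Finite)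
    (hBc : B.ncard ≤ 3) {x y : Pt} (hx : x ∈ interior (kernelSet O B))
    (hy : y ∈ interior (kernelSet O B)) :
    y ∈ connectedComponentIn (interior (kernelSet O B)) x := by
  obtain ⟨X, hX⟩ := (IsPiece.of_component hO x).exists_triPiece hO hB hBc
    ⟨x, mem_connectedComponentIn hx⟩
  obtain ⟨Y, hY⟩ := (IsPiece.of_component hO y).exists_triPiece hO hB hBc
    ⟨y, mem_connectedComponentIn hy⟩
  obtain ⟨z, hz, hz'⟩ := Set.not_disjoint_iff.1 (hX.not_disjoint hY)
  rw [connectedComponentIn_eq hz, ← connectedComponentIn_eq hz']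
  exact mem_connectedComponentIn hy

namespace TriPiece
variable {O B G : Set Pt} {x : Fin 3 → Pt} {b b' : Pt} {j : Fin 3}

/-- At a corner, the blocking points of the two adjacent pockets appear in the right order. -/
lemma det2_pos_of_mem_pocket (h : TriPiece O B G x) (hb : b ∈ interior h.body)
    (hbp : b ∈ h.pocket (j + 2)) (hb' : b' ∈ interior h.body) (hbp' : b' ∈ h.pocket (j + 1)) :
    0 < det2 (b - x j) (b' - x j) := by
  obtain ⟨e1, e2, e3, e4⟩ := fin_three_add j
  by_contra! hcon
  have t1 : Disjoint G (tri (x j) (x (j + 1)) b) := by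
    have := h.corner_mem_pocket (j + 2)
    rw [e3, e4] at this
    exact (h.disjoint_pocket (j + 2)).mono_right
      (tri_subset (h.convex_pocket _) this.1 this.2 hbp)
  have t2 : Disjoint G (tri (x j) b' (x (j + 2))) := by
    have := h.corner_mem_pocket (j + 1)
    rw [e1, e2] at this
    exact (h.disjoint_pocket (j + 1)).mono_right
      (tri_subset (h.convex_pocket _) this.2 hbp' this.1)
  have pos1 : ∀ z ∈ interior h.body, 0 < det2 (x (j + 1) - x j) (z - x j) :=
    fun z hz => h.det2_pos_of_interior hz j
  have pos2 : ∀ z ∈ interior h.body, 0 < det2 (z - x j) (x (j + 2) - x j) := fun z hz => by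
    have := h.det2_pos_of_interior hz (j + 2)
    rw [e3] at this
    simp only [det2, PiLp.sub_apply] at this ⊢
    linarith
  have p1 := pos1 b hb
  have p2 := pos2 b' hb'
  have hcl : x j ∈ closure G := extremePoints_convexHull_subset (h.extreme' j)
  have ho : ∀ (a c d e : Pt) (t : ℝ),
      IsOpen {z : Pt | det2 (z - a) c + det2 d (z - e) < t} := fun a c d e t =>
    isOpen_lt (by fun_prop) continuous_const
  obtain ⟨z, ⟨hz1, hz2⟩, hzG⟩ :=
    mem_closure_iff.1 hcl _
    ((ho (x j) (b - x j) (x (j + 1) - x j) (x j) (det2 (x (j + 1) - x j) (b - x j))).inter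
      (ho (x j) (x (j + 2) - x j) (b' - x j) (x j) (det2 (b' - x j) (x (j + 2) - x j))))
    ⟨by simpa using p1, by simpa using p2⟩
  rw [Set.mem_ofPred_eq] at hz1 hz2
  have hzi := h.subset_interior hzG
  have q1 := pos1 z hzi
  have q2 := pos2 z hzi
  rcases le_or_gt 0 (det2 (z - x j) (b - x j)) with hc | hc
  · refine Set.disjoint_left.1 t1 hzG (mem_tri_of_det2 p1 ?_ ?_ ?_)
    all_goals simp only [det2, PiLp.sub_apply] at q1 q2 hz1 hz2 hc ⊢
    all_goals linarith
  · have r1 := pos1 b' hb'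
    have pl : det2 (x (j + 1) - x j) (b - x j) * det2 (b' - x j) (z - x j) =
        det2 (x (j + 1) - x j) (b' - x j) * -det2 (z - x j) (b - x j) +
        det2 (x (j + 1) - x j) (z - x j) * -det2 (b - x j) (b' - x j) := by
      simp only [det2]; ring
    have hpos : 0 < det2 (b' - x j) (z - x j) := by
      refine pos_of_mul_pos_right (a := det2 (x (j + 1) - x j) (b - x j)) ?_ p1.le
      rw [pl]
      have := mul_pos r1 (neg_pos.2 hc)
      have := mul_nonneg q1.le (neg_nonneg.2 hcon)
      linarith
    refine Set.disjoint_left.1 t2 hzG (mem_tri_of_det2 p2 ?_ ?_ ?_)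
    all_goals simp only [det2, PiLp.sub_apply] at q2 hz2 hpos ⊢
    all_goals linarith

end TriPiece

/-- `z` lies strictly inside the counterclockwise triangle with corners `x`. -/
def Inside (x : Fin 3 → Pt) (z : Pt) : Prop := ∀ k, 0 < det2 (x (k + 1) - x k) (z - x k)

/-- A triangle around `R` such that the points of `B` inside it are distributed to its sides
without enclosing points of `R`. -/
structure Blocked (R B : Finset Pt) (x : Fin 3 → Pt) (β : Fin 3 → Finset Pt) : Prop where
  det : ∀ k, 0 < det2 (x (k + 1) - x k) (x (k + 2) - x k)
  inside_mem : ∀ r ∈ R, Inside x r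
  cover : ∀ b ∈ B, Inside x b → ∃ k, b ∈ β k
  inner : ∀ k, ∀ b ∈ β k, Inside x b
  sep : ∀ r ∈ R, ∀ k, r ∉ convexHull ℝ (insert (x (k + 1)) (insert (x (k + 2)) (β k : Set Pt)))
  angle : ∀ j, ∀ b ∈ β (j + 2), ∀ b' ∈ β (j + 1), 0 < det2 (b - x j) (b' - x j)

namespace TriPiece
variable {O G : Set Pt} {B : Finset Pt} {x : Fin 3 → Pt}

lemma mem_interior_iff_inside {O G B : Set Pt} (h : TriPiece O B G x) {z : Pt} :
    z ∈ interior h.body ↔ Inside x z := by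
  refine ⟨fun hz => h.det2_pos_of_interior hz, fun hz => ?_⟩
  exact mem_interior_tri_of_det2 (h.det 0) (hz 1) (hz 2) (hz 0)

lemma blocked (h : TriPiece O (B : Set Pt) G x) {R : Finset Pt} (hR : ↑R ⊆ G)
    (hB : ∀ b ∈ B, b ∈ interior h.body → ∃ k, b ∈ h.pocket k) :
    ∃ β, Blocked R B x β := by
  refine ⟨fun k => B.filter fun b => b ∈ interior h.body ∧ b ∈ h.pocket k, h.det, ?_, ?_, ?_, ?_, ?_⟩
  · exact fun r hr => h.mem_interior_iff_inside.1 (h.subset_interior (hR hr))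
  · intro b hb hbi
    have hbi' := h.mem_interior_iff_inside.2 hbi
    obtain ⟨k, hk⟩ := hB b hb hbi'
    exact ⟨k, Finset.mem_filter.2 ⟨hb, hbi', hk⟩⟩
  · exact fun k b hb => h.mem_interior_iff_inside.1 (Finset.mem_filter.1 hb).2.1
  · intro r hr k hrk
    refine Set.disjoint_left.1 (h.disjoint_pocket k) (hR hr)
      (convexHull_min ?_ (h.convex_pocket k) hrk)
    rintro z (rfl | rfl | hz)
    · exact (h.corner_mem_pocket k).1
    · exact (h.corner_mem_pocket k).2
    · exact (Finset.mem_filter.1 hz).2.2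
  · intro j b hb b' hb'
    have h1 := (Finset.mem_filter.1 hb).2
    have h2 := (Finset.mem_filter.1 hb').2
    exact h.det2_pos_of_mem_pocket h1.1 h1.2 h2.1 h2.2

end TriPiece

lemma SimplePolygon.nondegenerate_of_noThreeCollinear {P : SimplePolygon} {S : Set Pt}
    (hS : NoThreeCollinear S) (hP : P.vertexSet ⊆ S) : P.Nondegenerate := by
  intro i
  have hmem : ∀ j, P.vtx j ∈ S := fun j => hP ⟨j % P.n, Nat.mod_lt _ P.n_pos, (P.vtx_mod j).symm⟩
  have hne : P.vtx i ≠ P.vtx (i + 2) := by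
    rw [Ne, P.vtx_eq_iff]
    intro h
    have hd := (Nat.modEq_iff_dvd' (by omega)).1 h
    have := Nat.le_of_dvd (by omega) hd
    have := P.three_le
    omega
  have h := hS _ (hmem i) _ (hmem (i + 1)) _ (hmem (i + 2)) (P.vtx_ne_succ i) hne
    (P.vtx_ne_succ (i + 1))
  simp only [det2, PiLp.sub_apply] at h ⊢
  contrapose! h
  linarith

/-- If three points span the geodesic hull of `S`, there is a blocked triangle. -/
lemma exists_blocked {S B : Finset Pt} (hB : B.card = 3) (hR : (S \ B).Nonempty)
    {P : SimplePolygon} (hP : P.Nondegenerate) (hBS : B ⊆ S) (hS : (↑S : Set Pt) ⊆ P.interior)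
    (hext : extremeSet P (↑S : Set Pt) = (↑B : Set Pt)) : ∃ x β, Blocked (S \ B) B x β := by
  obtain ⟨r₀, hr₀⟩ := hR
  have hO := P.chordDomain_interior hP
  have hint : ∀ s ∈ S, s ∉ B → s ∈ P.interior ∩ interior (geodesicHull P S) := by
    intro s hs hsB
    refine ⟨hS hs, ?_⟩
    by_contra hn
    refine hsB (Finset.mem_coe.1 (hext ▸ ⟨hs, subset_closure ?_, hn⟩))
    exact Set.mem_sInter.2 fun C hC => hC.2 hs
  have hA : P.interior ∩ interior (geodesicHull P S) ⊆ kernelSet P.interior B := fun p hp =>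
    ⟨hp.1, hO.leftSide_inter_nonempty Set.inter_subset_left hint
      (fun p hp u hu => SimplePolygon.leftSide_inter_nonempty_of_hull hP hS hp.1 hp.2 hu) p hp⟩
  have hR : ∀ r ∈ S \ B, r ∈ interior (kernelSet P.interior B) := fun r hr =>
    interior_maximal hA (P.isOpen_interior.inter isOpen_interior)
      (hint r (Finset.mem_sdiff.1 hr).1 (Finset.mem_sdiff.1 hr).2)
  have hc : (B : Set Pt).ncard ≤ 3 := by rw [Set.ncard_coe_finset, hB]
  obtain ⟨x, hx⟩ := (IsPiece.of_component hO r₀).exists_triPiece hO B.finite_toSet hc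
    ⟨r₀, mem_connectedComponentIn (hR r₀ hr₀)⟩
  exact ⟨x, hx.blocked (fun r hr => hO.mem_component B.finite_toSet hc (hR r₀ hr₀) (hR r hr))
    fun b hb hbi => SimplePolygon.exists_pocket_of_mem hP hx hbi (hS (hBS hb)) hb⟩

/-- The direction from the `k`-th corner towards the middle of the opposite side. -/
def sideDir (x : Fin 3 → Pt) (k : Fin 3) : Pt := x (k + 1) + x (k + 2) - (2 : ℝ) • x k

/-- A triangle around `R` with marks inside, distributed to its sides without enclosing points of
`R`, such that each point of `B` is either outside the triangle or lies on the ray which starts at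
a mark and points towards its side. -/
structure Marked (R B : Finset Pt) (x : Fin 3 → Pt) (C : Fin 3 → Finset Pt) : Prop where
  det : ∀ k, 0 < det2 (x (k + 1) - x k) (x (k + 2) - x k)
  inside_mem : ∀ r ∈ R, Inside x r
  inner : ∀ k, ∀ c ∈ C k, Inside x c
  sep : ∀ r ∈ R, ∀ k, r ∉ convexHull ℝ (insert (x (k + 1)) (insert (x (k + 2)) (C k : Set Pt)))
  angle : ∀ j, ∀ c ∈ C (j + 2), ∀ c' ∈ C (j + 1), 0 < det2 (c - x j) (c' - x j)
  block : ∀ b ∈ B, (∃ k, det2 (x (k + 1) - x k) (b - x k) < 0) ∨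
    ∃ k, ∃ c ∈ C k, ∃ s : ℝ, 0 < s ∧ b = c + s • sideDir x k

lemma eventually_pos_of_continuous {f : ℝ → ℝ} (hf : Continuous f) (h : 0 < f 0) :
    ∀ᶠ ε in nhdsWithin (0 : ℝ) (Set.Ioi 0), 0 < f ε :=
  nhdsWithin_le_nhds (hf.tendsto 0 (lt_mem_nhds h))

lemma Blocked.exists_marked {R B : Finset Pt} {x : Fin 3 → Pt} {β : Fin 3 → Finset Pt}
    (h : Blocked R B x β) : ∃ x C, Marked R B x C := by
  set o : Pt := (3⁻¹ : ℝ) • (x 0 + x 1 + x 2) with ho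
  set X : ℝ → Fin 3 → Pt := fun ε k => x k + ε • (o - x k) with hX
  set Y : ℝ → Fin 3 → Pt → Pt := fun ε k b => b - ε • sideDir (X ε) k with hY
  have X0 : ∀ k, X 0 k = x k := fun k => by simp [hX]
  have Y0 : ∀ k b, Y 0 k b = b := fun k b => by simp [hY]
  have cX : ∀ k, Continuous fun ε => X ε k := fun k => by simp only [hX]; fun_prop
  have cY : ∀ k b, Continuous fun ε => Y ε k b := fun k b => by
    simp only [hY, sideDir]; fun_prop
  have hoi : Inside x o := by
    intro k
    have h0 := h.det k
    have e : o = (3⁻¹ : ℝ) • (x k + x (k + 1) + x (k + 2)) := by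
      rw [ho]; congr 1; fin_cases k
      · rfl
      · show x 0 + x 1 + x 2 = x 1 + x 2 + x 0; abel
      · show x 0 + x 1 + x 2 = x 2 + x 0 + x 1; abel
    rw [e]
    simp only [det2, PiLp.sub_apply, PiLp.add_apply, PiLp.smul_apply, smul_eq_mul] at h0 ⊢
    linarith
  have A : ∀ᶠ ε in nhdsWithin (0 : ℝ) (Set.Ioi 0),
      ∀ k, 0 < det2 (X ε (k + 1) - X ε k) (X ε (k + 2) - X ε k) :=
    Filter.eventually_all.2 fun k => eventually_pos_of_continuous (by fun_prop)
      (by simpa only [X0] using h.det k)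
  have A' : ∀ᶠ ε in nhdsWithin (0 : ℝ) (Set.Ioi 0), ∀ r ∈ R, Inside (X ε) r :=
    (Filter.eventually_all_finset R).2 fun r hr => Filter.eventually_all.2 fun k =>
      eventually_pos_of_continuous (by fun_prop) (by simpa only [X0] using h.inside_mem r hr k)
  have A'' : ∀ᶠ ε in nhdsWithin (0 : ℝ) (Set.Ioi 0), ∀ k, ∀ b ∈ β k, Inside (X ε) (Y ε k b) :=
    Filter.eventually_all.2 fun k => (Filter.eventually_all_finset _).2 fun b hb =>
      Filter.eventually_all.2 fun l => eventually_pos_of_continuous (by fun_prop)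
        (by simpa only [X0, Y0] using h.inner k b hb l)
  have D : ∀ᶠ ε in nhdsWithin (0 : ℝ) (Set.Ioi 0), ∀ r ∈ R, ∀ k,
      r ∉ convexHull ℝ (insert (X ε (k + 1)) (insert (X ε (k + 2)) (Y ε k '' (β k : Set Pt)))) := by
    refine (Filter.eventually_all_finset R).2 fun r hr => Filter.eventually_all.2 fun k => ?_
    obtain ⟨u, hu⟩ := exists_det2_pos (convex_convexHull ℝ _) (isCompact_convexHull
      ((((β k).finite_toSet.insert _).insert _).isCompact)).isClosed (h.sep r hr k)
    have hu' := fun z hz => hu z (subset_convexHull ℝ _ hz)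
    have e1 : ∀ᶠ ε in nhdsWithin (0 : ℝ) (Set.Ioi 0), 0 < det2 u (X ε (k + 1) - r) :=
      eventually_pos_of_continuous (by fun_prop) (by rw [X0]; exact hu' _ (by simp))
    have e2 : ∀ᶠ ε in nhdsWithin (0 : ℝ) (Set.Ioi 0), 0 < det2 u (X ε (k + 2) - r) :=
      eventually_pos_of_continuous (by fun_prop) (by rw [X0]; exact hu' _ (by simp))
    have e3 : ∀ᶠ ε in nhdsWithin (0 : ℝ) (Set.Ioi 0), ∀ b ∈ β k, 0 < det2 u (Y ε k b - r) :=
      (Filter.eventually_all_finset _).2 fun b hb => eventually_pos_of_continuous (by fun_prop)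
        (by rw [Y0]; exact hu' _ (by simp [hb]))
    filter_upwards [e1, e2, e3] with ε h1 h2 h3 hmem
    have := convexHull_min (s := _) (t := {z | 0 < det2 u (z - r)}) ?_ (det2_pos_convex u r) hmem
    · simp at this
    · rintro z (rfl | rfl | ⟨b, hb, rfl⟩)
      exacts [h1, h2, h3 b hb]
  have E : ∀ᶠ ε in nhdsWithin (0 : ℝ) (Set.Ioi 0), ∀ j, ∀ b ∈ β (j + 2), ∀ b' ∈ β (j + 1),
      0 < det2 (Y ε (j + 2) b - X ε j) (Y ε (j + 1) b' - X ε j) :=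
    Filter.eventually_all.2 fun j => (Filter.eventually_all_finset _).2 fun b hb =>
      (Filter.eventually_all_finset _).2 fun b' hb' => eventually_pos_of_continuous (by fun_prop)
        (by simpa only [X0, Y0] using h.angle j b hb b' hb')
  have h1 : ∀ᶠ ε in nhdsWithin (0 : ℝ) (Set.Ioi 0), ε < 1 :=
    nhdsWithin_le_nhds (gt_mem_nhds one_pos)
  obtain ⟨ε, hA, hA', hA'', hD, hE, hε1, hε⟩ := (A.and (A'.and (A''.and (D.and (E.and
    (h1.and self_mem_nhdsWithin)))))).exists
  refine ⟨X ε, fun k => (β k).image (Y ε k), hA, hA', ?_, ?_, ?_, ?_⟩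
  · intro k c hc
    obtain ⟨b, hb, rfl⟩ := Finset.mem_image.1 hc
    exact hA'' k b hb
  · intro r hr k
    simpa using hD r hr k
  · intro j c hc c' hc'
    obtain ⟨b, hb, rfl⟩ := Finset.mem_image.1 hc
    obtain ⟨b', hb', rfl⟩ := Finset.mem_image.1 hc'
    exact hE j b hb b' hb'
  · intro b hb
    by_cases hbi : Inside x b
    · obtain ⟨k, hk⟩ := h.cover b hb hbi
      exact Or.inr ⟨k, _, Finset.mem_image_of_mem _ hk, ε, hε, by simp [hY]⟩
    · left
      simp only [Inside, not_forall, not_lt] at hbi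
      obtain ⟨k, hk⟩ := hbi
      refine ⟨k, ?_⟩
      have hk' := hoi k
      have e : det2 (X ε (k + 1) - X ε k) (b - X ε k) = (1 - ε) *
          (det2 (x (k + 1) - x k) (b - x k) - ε * det2 (x (k + 1) - x k) (o - x k)) := by
        simp only [hX, det2, PiLp.sub_apply, PiLp.add_apply, PiLp.smul_apply, smul_eq_mul]
        ring
      rw [e]
      have := mul_pos (show 0 < ε from hε) hk'
      exact mul_neg_of_pos_of_neg (by linarith) (by linarith)

/-- The sequence following `v` up to the index `m` and `w` afterwards. -/
def glue (m : ℕ) (v w : ℕ → Pt) (i : ℕ) : Pt := if i ≤ m then v i else w (i - m)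

lemma glue_of_le {m : ℕ} {v w : ℕ → Pt} {i : ℕ} (h : i ≤ m) : glue m v w i = v i := if_pos h

lemma glue_add {m : ℕ} {v w : ℕ → Pt} (h : w 0 = v m) (i : ℕ) : glue m v w (m + i) = w i := by
  unfold glue
  split_ifs with h'
  · obtain rfl : i = 0 := by omega
    simpa using h.symm
  · congr 1
    omega

lemma sum_glue {M : Type*} [AddCommMonoid M] {m : ℕ} {v w : ℕ → Pt} (h : w 0 = v m) (n : ℕ)
    (f : Pt → Pt → M) :
    ∑ i ∈ Finset.range (m + n), f (glue m v w i) (glue m v w (i + 1)) =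
      ∑ i ∈ Finset.range m, f (v i) (v (i + 1)) + ∑ i ∈ Finset.range n, f (w i) (w (i + 1)) := by
  rw [Finset.sum_range_add]
  congr 1
  · refine Finset.sum_congr rfl fun i hi => ?_
    have hi := Finset.mem_range.1 hi
    rw [glue_of_le hi.le, glue_of_le (by omega)]
  · refine Finset.sum_congr rfl fun i _ => ?_
    rw [add_assoc, glue_add h, glue_add h]

/-- `v 0, …, v n` is a simple polygonal path inside `H` from `p` to `q`, which turns right, or does
not turn, at each intermediate vertex outside `X`. -/
structure Arc (X : Set Pt) (p q : Pt) (H : Set Pt) (n : ℕ) (v : ℕ → Pt) : Prop where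
  pos : 0 < n
  start : v 0 = p
  finish : v n = q
  inj : ∀ i ≤ n, ∀ j ≤ n, v i = v j → i = j
  seg : ∀ i < n, segment ℝ (v i) (v (i + 1)) ⊆ H
  simple : ∀ i j z, i < j → j < n → z ∈ segment ℝ (v i) (v (i + 1)) →
    z ∈ segment ℝ (v j) (v (j + 1)) → j = i + 1 ∧ z = v j
  turn : ∀ i, i + 1 < n → v (i + 1) ∈ X ∨ det2 (v (i + 1) - v i) (v (i + 2) - v (i + 1)) ≤ 0

namespace Arc

variable {X : Set Pt} {p q r : Pt} {H H' : Set Pt} {m n : ℕ} {v w : ℕ → Pt}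

lemma mem (h : Arc X p q H n v) {i : ℕ} (hi : i ≤ n) : v i ∈ H := by
  rcases Nat.lt_or_ge i n with hi' | hi'
  · exact h.seg i hi' (left_mem_segment ℝ _ _)
  · obtain ⟨k, rfl⟩ : ∃ k, i = k + 1 := ⟨i - 1, by have := h.pos; omega⟩
    exact h.seg k (by omega) (right_mem_segment ℝ _ _)

lemma mono (h : Arc X p q H n v) (hH : H ⊆ H') : Arc X p q H' n v :=
  { h with seg := fun i hi => (h.seg i hi).trans hH }

lemma stop_mem_segment (h : Arc X p q H n v) {i : ℕ} (hi : i < n)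
    (hq : q ∈ segment ℝ (v i) (v (i + 1))) : i + 1 = n := by
  by_contra hne
  have hn : n - 1 + 1 = n := by have := h.pos; omega
  have hz : q ∈ segment ℝ (v (n - 1)) (v (n - 1 + 1)) := by
    rw [hn, h.finish]; exact right_mem_segment ℝ _ _
  have := (h.simple i (n - 1) q (by omega) (by omega) hq hz).2
  rw [← h.finish] at this
  have := h.inj n le_rfl (n - 1) (by omega) this
  omega

lemma start_mem_segment (h : Arc X p q H n v) {i : ℕ} (hi : i < n)
    (hp : p ∈ segment ℝ (v i) (v (i + 1))) : i = 0 := by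
  by_contra hne
  have hz : p ∈ segment ℝ (v 0) (v (0 + 1)) := by
    rw [h.start]; exact left_mem_segment ℝ _ _
  have := (h.simple 0 i p (by omega) hi hz hp).2
  rw [← h.start] at this
  have := h.inj 0 (by omega) i hi.le this
  omega

lemma single (hpq : p ≠ q) (hH : Convex ℝ H) (hp : p ∈ H) (hq : q ∈ H) :
    Arc X p q H 1 (fun i => if i = 0 then p else q) where
  pos := one_pos
  start := rfl
  finish := rfl
  inj i hi j hj hij := by
    have h1 : i = 0 ∨ i = 1 := by omega
    have h2 : j = 0 ∨ j = 1 := by omega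
    rcases h1 with rfl | rfl <;> rcases h2 with rfl | rfl <;> simp_all
  seg i hi := by
    obtain rfl : i = 0 := by omega
    simpa using hH.segment_subset hp hq
  simple i j z hij hj := by omega
  turn i hi := by omega

lemma append (hv : Arc X p q H m v) (hw : Arc X q r H' n w) (hHH : H ∩ H' ⊆ {q})
    (hq : q ∈ X ∨ ∀ y ∈ H, ∀ y' ∈ H', det2 (q - y) (y' - q) ≤ 0) :
    Arc X p r (H ∪ H') (m + n) (glue m v w) := by
  have h0 : w 0 = v m := by rw [hw.start, hv.finish]
  have hcross : ∀ i < m, ∀ j < n, ∀ z, z ∈ segment ℝ (v i) (v (i + 1)) →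
      z ∈ segment ℝ (w j) (w (j + 1)) → i + 1 = m ∧ j = 0 ∧ z = q := by
    intro i hi j hj z hz hz'
    obtain rfl : z = q := hHH ⟨hv.seg i hi hz, hw.seg j hj hz'⟩
    exact ⟨hv.stop_mem_segment hi hz, hw.start_mem_segment hj hz', rfl⟩
  have hinj : ∀ i ≤ m, ∀ j ≤ n, v i = w j → i = m ∧ j = 0 := by
    intro i hi j hj hij
    have hiq : v i = q := hHH ⟨hv.mem hi, hij ▸ hw.mem hj⟩
    exact ⟨hv.inj i hi m le_rfl (hiq.trans hv.finish.symm),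
      hw.inj j hj 0 (by omega) (hij.symm.trans (hiq.trans hw.start.symm))⟩
  constructor
  · have := hv.pos; omega
  · rw [glue_of_le (by omega), hv.start]
  · rw [glue_add h0, hw.finish]
  · intro i hi j hj hij
    rcases le_or_gt i m with him | him <;> rcases le_or_gt j m with hjm | hjm
    · rw [glue_of_le him, glue_of_le hjm] at hij
      exact hv.inj i him j hjm hij
    · obtain ⟨j, rfl⟩ := Nat.exists_eq_add_of_lt hjm
      rw [glue_of_le him, add_assoc, glue_add h0] at hij
      have := hinj i him (j + 1) (by omega) hij
      omega
    · obtain ⟨i, rfl⟩ := Nat.exists_eq_add_of_lt him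
      rw [glue_of_le hjm, add_assoc, glue_add h0] at hij
      have := hinj j hjm (i + 1) (by omega) hij.symm
      omega
    · obtain ⟨i, rfl⟩ := Nat.exists_eq_add_of_lt him
      obtain ⟨j, rfl⟩ := Nat.exists_eq_add_of_lt hjm
      rw [add_assoc, add_assoc, glue_add h0, glue_add h0] at hij
      have := hw.inj (i + 1) (by omega) (j + 1) (by omega) hij
      omega
  · intro i hi
    rcases Nat.lt_or_ge i m with him | him
    · rw [glue_of_le him.le, glue_of_le (by omega)]
      exact (hv.seg i him).trans Set.subset_union_left
    · obtain ⟨i, rfl⟩ := Nat.exists_eq_add_of_le him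
      rw [add_assoc, glue_add h0, glue_add h0]
      exact (hw.seg i (by omega)).trans Set.subset_union_right
  · intro i j z hij hj hz hz'
    rcases Nat.lt_or_ge j m with hjm | hjm
    · rw [glue_of_le (by omega), glue_of_le (by omega)] at hz hz'
      rw [glue_of_le hjm.le]
      exact hv.simple i j z hij hjm hz hz'
    · obtain ⟨j, rfl⟩ := Nat.exists_eq_add_of_le hjm
      rw [add_assoc, glue_add h0, glue_add h0] at hz'
      rw [glue_add h0]
      rcases Nat.lt_or_ge i m with him | him
      · rw [glue_of_le him.le, glue_of_le (by omega)] at hz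
        obtain ⟨h1, rfl, rfl⟩ := hcross i him j (by omega) z hz hz'
        exact ⟨by omega, hw.start.symm⟩
      · obtain ⟨i, rfl⟩ := Nat.exists_eq_add_of_le him
        rw [add_assoc, glue_add h0, glue_add h0] at hz
        have := hw.simple i j z (by omega) (by omega) hz hz'
        exact ⟨by omega, this.2⟩
  · intro i hi
    rcases lt_trichotomy (i + 1) m with him | him | him
    · rw [glue_of_le (by omega), glue_of_le (by omega), glue_of_le (by omega)]
      exact hv.turn i him
    · have h1 : glue m v w (i + 1) = q := by rw [him, glue_of_le le_rfl, hv.finish]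
      rw [h1]
      refine hq.imp id fun h => h _ ?_ _ ?_
      · rw [glue_of_le (by omega)]; exact hv.mem (by omega)
      · rw [show i + 2 = m + 1 by omega, glue_add h0]; exact hw.mem (by omega)
    · obtain ⟨i, rfl⟩ := Nat.exists_eq_add_of_le (Nat.lt_succ_iff.1 him)
      rw [add_assoc, add_assoc, glue_add h0, glue_add h0, glue_add h0]
      exact hw.turn i (by omega)

end Arc

open MeasureTheory in
lemma measureReal_add_three_le {A B C H : Set Pt} (hB : MeasurableSet B)
    (hC : MeasurableSet C) (hH : IsCompact H) (hAH : A ⊆ H) (hBH : B ⊆ H) (hCH : C ⊆ H)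
    (hAB : Disjoint A B) (hAC : Disjoint A C) (c : Pt) (hBC : B ∩ C ⊆ {c}) :
    volume.real A + volume.real B + volume.real C ≤ volume.real H := by
  have hfin : ∀ {T : Set Pt}, T ⊆ H → volume T ≠ ⊤ := fun hT =>
    ((measure_mono hT).trans_lt hH.measure_lt_top).ne
  have hnull : volume (B ∩ C) = 0 :=
    measure_mono_null hBC (measure_singleton c)
  have h1 : volume.real (B ∪ C) = volume.real B + volume.real C := by
    refine measureReal_union₀ hC.nullMeasurableSet hnull (hfin hBH) (hfin hCH)
  have h2 : volume.real (A ∪ (B ∪ C)) = volume.real A + volume.real (B ∪ C) :=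
    measureReal_union (Set.disjoint_union_right.2 ⟨hAB, hAC⟩) (hB.union hC) (hfin hAH)
      (hfin (Set.union_subset hBH hCH))
  have h3 : volume.real (A ∪ (B ∪ C)) ≤ volume.real H :=
    measureReal_mono (Set.union_subset hAH (Set.union_subset hBH hCH)) hH.measure_lt_top.ne
  linarith

open MeasureTheory in
lemma measureReal_interior_tri (a b c : Pt) :
    volume.real (interior (tri a b c)) = volume.real (tri a b c) := by
  have h := (convex_tri a b c).addHaar_frontier volume
  rw [frontier, (isClosed_tri a b c).closure_eq] at h
  simp only [measureReal_def]
  congr 1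
  refine le_antisymm (measure_mono interior_subset) ?_
  calc volume (tri a b c) ≤ volume (tri a b c \ interior (tri a b c) ∪ interior (tri a b c)) :=
        measure_mono (by rw [Set.sdiff_union_self]; exact Set.subset_union_left)
    _ ≤ _ := measure_union_le _ _
    _ = _ := by rw [h, zero_add]

lemma exists_nonneg_combination {u w y : Pt} (h : 0 < det2 u w) (hu : 0 ≤ det2 u y)
    (hw : 0 ≤ det2 y w) : ∃ a b : ℝ, 0 ≤ a ∧ 0 ≤ b ∧ y = a • u + b • w := by
  refine ⟨det2 y w / det2 u w, det2 u y / det2 u w, by positivity, by positivity, ?_⟩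
  have h' := h.ne'
  refine pt_ext ?_ ?_ <;> simp only [PiLp.add_apply, PiLp.smul_apply, smul_eq_mul] <;>
    field_simp <;> unfold det2 <;> ring

/-- The part of `H` between the line through `p` and `c` and the parallel to `p q` through `c`. -/
def leftPocket (p q c : Pt) (H : Set Pt) : Set Pt :=
  {z | z ∈ H ∧ 0 ≤ det2 (c - p) (z - p) ∧ det2 (q - p) (z - c) ≤ 0}

/-- The part of `H` between the line through `c` and `q` and the parallel to `p q` through `c`. -/
def rightPocket (p q c : Pt) (H : Set Pt) : Set Pt :=
  {z | z ∈ H ∧ 0 ≤ det2 (q - c) (z - c) ∧ det2 (q - p) (z - c) ≤ 0}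

section Pocket

variable {p q c z : Pt} {H : Set Pt}

lemma Convex.leftPocket (hH : Convex ℝ H) : Convex ℝ (leftPocket p q c H) := by
  intro y hy z hz a b ha hb hab
  refine ⟨hH hy.1 hz.1 ha hb hab, ?_, ?_⟩
  · have : det2 (c - p) (a • y + b • z - p) = a * det2 (c - p) (y - p) + b * det2 (c - p) (z - p) := by
      obtain rfl : b = 1 - a := by linarith
      unfold det2; simp; ring
    rw [this]
    exact add_nonneg (mul_nonneg ha hy.2.1) (mul_nonneg hb hz.2.1)
  · have : det2 (q - p) (a • y + b • z - c) = a * det2 (q - p) (y - c) + b * det2 (q - p) (z - c) := by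
      obtain rfl : b = 1 - a := by linarith
      unfold det2; simp; ring
    rw [this]
    exact add_nonpos (mul_nonpos_of_nonneg_of_nonpos ha hy.2.2) (mul_nonpos_of_nonneg_of_nonpos hb hz.2.2)

lemma Convex.rightPocket (hH : Convex ℝ H) : Convex ℝ (rightPocket p q c H) := by
  intro y hy z hz a b ha hb hab
  refine ⟨hH hy.1 hz.1 ha hb hab, ?_, ?_⟩
  · have : det2 (q - c) (a • y + b • z - c) = a * det2 (q - c) (y - c) + b * det2 (q - c) (z - c) := by
      obtain rfl : b = 1 - a := by linarith
      unfold det2; simp; ring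
    rw [this]
    exact add_nonneg (mul_nonneg ha hy.2.1) (mul_nonneg hb hz.2.1)
  · have : det2 (q - p) (a • y + b • z - c) = a * det2 (q - p) (y - c) + b * det2 (q - p) (z - c) := by
      obtain rfl : b = 1 - a := by linarith
      unfold det2; simp; ring
    rw [this]
    exact add_nonpos (mul_nonpos_of_nonneg_of_nonpos ha hy.2.2) (mul_nonpos_of_nonneg_of_nonpos hb hz.2.2)

lemma IsCompact.leftPocket (hH : IsCompact H) : IsCompact (leftPocket p q c H) := by
  have h1 : IsClosed {z : Pt | 0 ≤ det2 (c - p) (z - p)} :=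
    isClosed_le continuous_const (by unfold det2; fun_prop)
  have h2 : IsClosed {z : Pt | det2 (q - p) (z - c) ≤ 0} :=
    isClosed_le (by unfold det2; fun_prop) continuous_const
  exact hH.inter_right (h1.inter h2)

lemma IsCompact.rightPocket (hH : IsCompact H) : IsCompact (rightPocket p q c H) := by
  have h1 : IsClosed {z : Pt | 0 ≤ det2 (q - c) (z - c)} :=
    isClosed_le continuous_const (by unfold det2; fun_prop)
  have h2 : IsClosed {z : Pt | det2 (q - p) (z - c) ≤ 0} :=
    isClosed_le (by unfold det2; fun_prop) continuous_const
  exact hH.inter_right (h1.inter h2)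

lemma left_mem_leftPocket (hp : p ∈ H) (hc : 0 < det2 (q - p) (c - p)) : p ∈ leftPocket p q c H := by
  refine ⟨hp, by simp, ?_⟩
  rw [← neg_sub c p, det2_neg_right]; linarith

lemma right_mem_rightPocket (hq : q ∈ H) (hc : 0 < det2 (q - p) (c - p)) :
    q ∈ rightPocket p q c H := by
  refine ⟨hq, by simp [det2_self], ?_⟩
  have : det2 (q - p) (q - c) = - det2 (q - p) (c - p) := by unfold det2; simp; ring
  linarith

lemma apex_mem_leftPocket (hc : c ∈ H) : c ∈ leftPocket p q c H :=
  ⟨hc, by simp [det2_self], by simp⟩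

lemma apex_mem_rightPocket (hc : c ∈ H) : c ∈ rightPocket p q c H :=
  ⟨hc, by simp, by simp⟩

lemma sub_of_mem_leftPocket (hc : 0 < det2 (q - p) (c - p)) (hz : z ∈ leftPocket p q c H) :
    ∃ a b : ℝ, 0 ≤ a ∧ 0 ≤ b ∧ c - z = a • (q - p) + b • (c - p) := by
  refine exists_nonneg_combination hc ?_ ?_
  · rw [← neg_sub z c, det2_neg_right]; linarith [hz.2.2]
  · have : det2 (c - z) (c - p) = det2 (c - p) (z - p) := by unfold det2; simp; ring
    rw [this]; exact hz.2.1

lemma sub_of_mem_rightPocket (hc : 0 < det2 (q - p) (c - p)) (hz : z ∈ rightPocket p q c H) :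
    ∃ a b : ℝ, 0 ≤ a ∧ 0 ≤ b ∧ z - c = a • (q - c) + b • (q - p) := by
  have h : 0 < det2 (q - c) (q - p) := by
    have : det2 (q - c) (q - p) = det2 (q - p) (c - p) := by unfold det2; simp; ring
    rwa [this]
  refine exists_nonneg_combination h hz.2.1 ?_
  rw [det2_swap]; linarith [hz.2.2]

lemma turn_of_mem_pockets (hc : 0 < det2 (q - p) (c - p)) {y z : Pt}
    (hy : y ∈ leftPocket p q c H) (hz : z ∈ rightPocket p q c H) : det2 (c - y) (z - c) ≤ 0 := by
  obtain ⟨a, b, ha, hb, h1⟩ := sub_of_mem_leftPocket hc hy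
  obtain ⟨a', b', ha', hb', h2⟩ := sub_of_mem_rightPocket hc hz
  have : det2 (c - y) (z - c) = -((a * a' + b * a' + b * b') * det2 (q - p) (c - p)) := by
    rw [h1, h2]; unfold det2; simp; ring
  rw [this]
  have : 0 ≤ (a * a' + b * a' + b * b') * det2 (q - p) (c - p) := by positivity
  linarith

variable {D : Pt}

lemma det2_le_of_mem_leftPocket (hc : 0 < det2 (q - p) (c - p)) (hpc : det2 D p < det2 D c)
    (hcq : det2 D c < det2 D q) (hz : z ∈ leftPocket p q c H) :
    det2 D z ≤ det2 D c ∧ (det2 D z = det2 D c → z = c) := by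
  obtain ⟨a, b, ha, hb, h1⟩ := sub_of_mem_leftPocket hc hz
  have h : det2 D c - det2 D z = a * (det2 D q - det2 D p) + b * (det2 D c - det2 D p) := by
    rw [← det2_sub_right, h1]; simp only [det2_add_right, det2_smul_right, det2_sub_right]
  have e1 : 0 ≤ a * (det2 D q - det2 D p) := mul_nonneg ha (by linarith)
  have e2 : 0 ≤ b * (det2 D c - det2 D p) := mul_nonneg hb (by linarith)
  refine ⟨by linarith, fun he => ?_⟩
  have ha0 : a = 0 := by
    rcases mul_eq_zero.1 (by linarith : a * (det2 D q - det2 D p) = 0) with h | h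
    · exact h
    · linarith
  have hb0 : b = 0 := by
    rcases mul_eq_zero.1 (by linarith : b * (det2 D c - det2 D p) = 0) with h | h
    · exact h
    · linarith
  rw [ha0, hb0, zero_smul, zero_smul, add_zero, sub_eq_zero] at h1
  exact h1.symm

lemma le_det2_of_mem_rightPocket (hc : 0 < det2 (q - p) (c - p)) (hpc : det2 D p < det2 D c)
    (hcq : det2 D c < det2 D q) (hz : z ∈ rightPocket p q c H) :
    det2 D c ≤ det2 D z ∧ (det2 D z = det2 D c → z = c) := by
  obtain ⟨a, b, ha, hb, h1⟩ := sub_of_mem_rightPocket hc hz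
  have h : det2 D z - det2 D c = a * (det2 D q - det2 D c) + b * (det2 D q - det2 D p) := by
    rw [← det2_sub_right, h1]; simp only [det2_add_right, det2_smul_right, det2_sub_right]
  have e1 : 0 ≤ a * (det2 D q - det2 D c) := mul_nonneg ha (by linarith)
  have e2 : 0 ≤ b * (det2 D q - det2 D p) := mul_nonneg hb (by linarith)
  refine ⟨by linarith, fun he => ?_⟩
  have ha0 : a = 0 := by
    rcases mul_eq_zero.1 (by linarith : a * (det2 D q - det2 D c) = 0) with h | h
    · exact h
    · linarith
  have hb0 : b = 0 := by
    rcases mul_eq_zero.1 (by linarith : b * (det2 D q - det2 D p) = 0) with h | h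
    · exact h
    · linarith
  rw [ha0, hb0, zero_smul, zero_smul, add_zero, sub_eq_zero] at h1
  exact h1

lemma pockets_inter_subset (hc : 0 < det2 (q - p) (c - p)) (hpc : det2 D p < det2 D c)
    (hcq : det2 D c < det2 D q) : leftPocket p q c H ∩ rightPocket p q c H ⊆ {c} := fun _ hz =>
  (le_det2_of_mem_rightPocket hc hpc hcq hz.2).2
    (le_antisymm (det2_le_of_mem_leftPocket hc hpc hcq hz.1).1
      (le_det2_of_mem_rightPocket hc hpc hcq hz.2).1)

end Pocket

open MeasureTheory in
lemma measureReal_pockets_le {p q c D : Pt} {H : Set Pt} {κ : ℝ}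
    (hκ : ∀ a b c : Pt, volume.real (tri a b c) = κ * |det2 (b - a) (c - a)|)
    (hH : IsCompact H) (hconv : Convex ℝ H) (hp : p ∈ H) (hq : q ∈ H) (hcH : c ∈ H)
    (hc : 0 < det2 (q - p) (c - p)) (hpc : det2 D p < det2 D c) (hcq : det2 D c < det2 D q) :
    κ * det2 (q - p) (c - p) + volume.real (leftPocket p q c H) +
      volume.real (rightPocket p q c H) ≤ volume.real H := by
  have h1 : κ * det2 (q - p) (c - p) = volume.real (interior (tri p q c)) := by
    rw [measureReal_interior_tri, hκ, abs_of_pos hc]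
  rw [h1]
  refine measureReal_add_three_le hH.leftPocket.measurableSet hH.rightPocket.measurableSet hH
    (interior_subset.trans (tri_subset hconv hp hq hcH)) (fun z hz => hz.1) (fun z hz => hz.1)
    ?_ ?_ c (pockets_inter_subset hc hpc hcq)
  · refine Set.disjoint_left.2 fun z hz hz' => ?_
    have h2 := ((mem_interior_tri_iff hc).1 hz).2.1
    have h3 := hz'.2.1
    have : det2 (p - c) (z - c) = - det2 (c - p) (z - p) := by unfold det2; simp; ring
    linarith
  · refine Set.disjoint_left.2 fun z hz hz' => ?_
    have h2 := ((mem_interior_tri_iff hc).1 hz).1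
    have h3 := hz'.2.1
    have : det2 (c - q) (z - q) = - det2 (q - c) (z - c) := by unfold det2; simp; ring
    linarith

open MeasureTheory in
lemma exists_arc {κ : ℝ} (hκ : ∀ a b c : Pt, volume.real (tri a b c) = κ * |det2 (b - a) (c - a)|)
    (X : Set Pt) (D : Pt) (N : ℕ) : ∀ (p q : Pt) (H : Set Pt) (C : Finset Pt), C.card ≤ N →
      IsCompact H → Convex ℝ H → p ∈ H → q ∈ H → det2 D p < det2 D q →
      (∀ c ∈ C, c ∈ H ∧ 0 < det2 (q - p) (c - p) ∧ det2 D p < det2 D c ∧ det2 D c < det2 D q) →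
      ∃ n v, Arc X p q H n v ∧
        κ * (det2 p q - ∑ i ∈ Finset.range n, det2 (v i) (v (i + 1))) ≤ volume.real H ∧
        ∀ c ∈ C, ∀ s : ℝ, 0 < s → ∀ i < n, c + s • D ∉ segment ℝ (v i) (v (i + 1)) := by
  induction N with
  | zero =>
    intro p q H C hC hcomp hconv hp hq hpq _
    have hC : C = ∅ := Finset.card_eq_zero.1 (by omega)
    subst hC
    refine ⟨1, _, Arc.single (by rintro rfl; exact lt_irrefl _ hpq) hconv hp hq, by simp, by simp⟩
  | succ N ih =>
    intro p q H C hC hcomp hconv hp hq hpq hmark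
    rcases C.eq_empty_or_nonempty with rfl | hne
    · refine ⟨1, _, Arc.single (by rintro rfl; exact lt_irrefl _ hpq) hconv hp hq, by simp, by simp⟩
    obtain ⟨c, hcC, hmax⟩ := C.exists_max_image (fun c => det2 (q - p) (c - p)) hne
    obtain ⟨hcH, hc, hpc, hcq⟩ := hmark c hcC
    have hmax' : ∀ c' ∈ C, det2 (q - p) (c' - c) ≤ 0 := by
      intro c' hc'
      have := hmax c' hc'
      simp only [det2_sub_right] at this ⊢
      linarith
    set C₁ := C.filter fun c' => det2 D c' < det2 D c ∧ 0 < det2 (c - p) (c' - p) with hC₁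
    set C₂ := C.filter fun c' => det2 D c < det2 D c' ∧ 0 < det2 (q - c) (c' - c) with hC₂
    have hcard : ∀ T ⊆ C, c ∉ T → T.card ≤ N := by
      intro T hT hcT
      have : T ⊂ C := (Finset.ssubset_iff_of_subset hT).2 ⟨c, hcC, hcT⟩
      have := Finset.card_lt_card this
      omega
    obtain ⟨m, v, hv, hva, hvr⟩ := ih p c (leftPocket p q c H) C₁
      (hcard _ (Finset.filter_subset _ _) (by simp [hC₁]))
      hcomp.leftPocket hconv.leftPocket (left_mem_leftPocket hp hc) (apex_mem_leftPocket hcH) hpc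
      (by
        intro c' hc'
        obtain ⟨hc'C, h1, h2⟩ := Finset.mem_filter.1 hc'
        obtain ⟨h3, h4, h5, h6⟩ := hmark c' hc'C
        exact ⟨⟨h3, h2.le, hmax' c' hc'C⟩, h2, h5, h1⟩)
    obtain ⟨n, w, hw, hwa, hwr⟩ := ih c q (rightPocket p q c H) C₂
      (hcard _ (Finset.filter_subset _ _) (by simp [hC₂]))
      hcomp.rightPocket hconv.rightPocket (apex_mem_rightPocket hcH) (right_mem_rightPocket hq hc)
      hcq
      (by
        intro c' hc'
        obtain ⟨hc'C, h1, h2⟩ := Finset.mem_filter.1 hc'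
        obtain ⟨h3, h4, h5, h6⟩ := hmark c' hc'C
        exact ⟨⟨h3, h2.le, hmax' c' hc'C⟩, h2, h1, h6⟩)
    have h0 : w 0 = v m := by rw [hw.start, hv.finish]
    refine ⟨m + n, glue m v w, (hv.append hw (pockets_inter_subset hc hpc hcq)
      (Or.inr fun y hy y' hy' => turn_of_mem_pockets hc hy hy')).mono ?_, ?_, ?_⟩
    · exact Set.union_subset (fun z hz => hz.1) fun z hz => hz.1
    · have h1 := measureReal_pockets_le hκ hcomp hconv hp hq hcH hc hpc hcq
      have h2 : det2 (q - p) (c - p) = det2 p q - det2 p c - det2 c q := by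
        unfold det2; simp; ring
      rw [h2] at h1
      rw [sum_glue h0]
      linarith
    · intro c' hc' s hs
      have hD : ∀ y, det2 D (y + s • D) = det2 D y := by
        intro y; simp [det2_add_right, det2_smul_right, det2_self]
      have hqp : det2 (q - p) D < 0 := by
        rw [det2_swap, det2_sub_right]; linarith
      have hcp : det2 (c - p) D < 0 := by
        rw [det2_swap, det2_sub_right]; linarith
      have hqc : det2 (q - c) D < 0 := by
        rw [det2_swap, det2_sub_right]; linarith
      have hbelow : c' + s • D ≠ c := by
        intro he
        have h1 := hmax' c' hc'
        have h2 : c' - c = -(s • D) := by rw [← he]; abel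
        rw [h2, det2_neg_right, det2_smul_right] at h1
        nlinarith
      suffices h : (∀ i < m, c' + s • D ∉ segment ℝ (v i) (v (i + 1))) ∧
          ∀ i < n, c' + s • D ∉ segment ℝ (w i) (w (i + 1)) by
        intro i hi
        rcases Nat.lt_or_ge i m with him | him
        · rw [glue_of_le him.le, glue_of_le (by omega)]
          exact h.1 i him
        · obtain ⟨i, rfl⟩ := Nat.exists_eq_add_of_le him
          rw [add_assoc, glue_add h0, glue_add h0]
          exact h.2 i (by omega)
      have hleft : c' + s • D ∈ leftPocket p q c H → det2 D c' < det2 D c := by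
        intro hz
        obtain ⟨h1, h2⟩ := det2_le_of_mem_leftPocket hc hpc hcq hz
        rw [hD] at h1 h2
        exact lt_of_le_of_ne h1 fun he => hbelow (h2 he)
      have hright : c' + s • D ∈ rightPocket p q c H → det2 D c < det2 D c' := by
        intro hz
        obtain ⟨h1, h2⟩ := le_det2_of_mem_rightPocket hc hpc hcq hz
        rw [hD] at h1 h2
        exact lt_of_le_of_ne h1 fun he => hbelow (h2 he.symm)
      constructor
      · intro i hi hz
        have hz' := hv.seg i hi hz
        refine hvr c' (Finset.mem_filter.2 ⟨hc', hleft hz', ?_⟩) s hs i hi hz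
        have := hz'.2.1
        rw [add_sub_right_comm, det2_add_right, det2_smul_right] at this
        nlinarith
      · intro i hi hz
        have hz' := hw.seg i hi hz
        refine hwr c' (Finset.mem_filter.2 ⟨hc', hright hz', ?_⟩) s hs i hi hz
        have := hz'.2.1
        rw [add_sub_right_comm, det2_add_right, det2_smul_right] at this
        nlinarith

open MeasureTheory in
lemma exists_measureReal_tri :
    ∃ κ : ℝ, 0 < κ ∧ ∀ a b c : Pt, volume.real (tri a b c) = κ * |det2 (b - a) (c - a)| := by
  set e₀ : Pt := !₂[1, 0] with he₀
  set e₁ : Pt := !₂[0, 1] with he₁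
  refine ⟨volume.real (tri 0 e₀ e₁), ?_, fun a b c => ?_⟩
  · have hpos : 0 < volume (interior (tri 0 e₀ e₁)) := by
      refine isOpen_interior.measure_pos volume ⟨(1 / 3 : ℝ) • e₀ + (1 / 3 : ℝ) • e₁, ?_⟩
      apply mem_interior_tri_of_det2 <;> simp [he₀, he₁, det2] <;> norm_num
    have := hpos.trans_le (measure_mono interior_subset)
    rw [measureReal_def]
    exact ENNReal.toReal_pos this.ne' (isCompact_tri 0 e₀ e₁).measure_lt_top.ne
  · let f : Pt →ₗ[ℝ] Pt :=
      { toFun := fun z => z 0 • (b - a) + z 1 • (c - a)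
        map_add' := fun y z => by simp only [PiLp.add_apply, add_smul]; abel
        map_smul' := fun t z => by
          simp only [PiLp.smul_apply, smul_eq_mul, RingHom.id_apply, smul_add, smul_smul] }
    have hf : ∀ z, f z = z 0 • (b - a) + z 1 • (c - a) := fun z => rfl
    have hdet : LinearMap.det f = det2 (b - a) (c - a) := by
      rw [← LinearMap.det_toMatrix (EuclideanSpace.basisFun (Fin 2) ℝ).toBasis, Matrix.det_fin_two]
      simp [LinearMap.toMatrix_apply, hf, det2]
      ring
    have himage : tri a b c = (fun z => a + z) '' (f '' tri 0 e₀ e₁) := by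
      ext z
      simp only [Set.mem_image, exists_exists_and_eq_and, mem_tri]
      constructor
      · rintro ⟨α, β, γ, hα, hβ, hγ, hsum, rfl⟩
        refine ⟨_, ⟨α, β, γ, hα, hβ, hγ, hsum, rfl⟩, ?_⟩
        obtain rfl : α = 1 - β - γ := by linarith
        rw [hf]
        refine pt_ext ?_ ?_ <;> simp [he₀, he₁] <;> ring
      · rintro ⟨_, ⟨α, β, γ, hα, hβ, hγ, hsum, rfl⟩, rfl⟩
        refine ⟨α, β, γ, hα, hβ, hγ, hsum, ?_⟩
        obtain rfl : α = 1 - β - γ := by linarith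
        rw [hf]
        refine pt_ext ?_ ?_ <;> simp [he₀, he₁] <;> ring
    rw [himage, measureReal_def, Set.image_add_left, measure_preimage_add, Measure.addHaar_image_linearMap, hdet,
      ENNReal.toReal_mul, ENNReal.toReal_ofReal (abs_nonneg _), measureReal_def, mul_comm]

lemma exists_simplePolygon {N : ℕ} (hN : 3 ≤ N) {u : ℕ → Pt} (hu : u N = u 0)
    (hinj : ∀ i < N, ∀ j < N, u i = u j → i = j)
    (hsimple : ∀ i j z, i < j → j < N → z ∈ segment ℝ (u i) (u (i + 1)) →
      z ∈ segment ℝ (u j) (u (j + 1)) → (j = i + 1 ∧ z = u j) ∨ (i = 0 ∧ j + 1 = N ∧ z = u 0)) :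
    ∃ P : SimplePolygon, P.n = N ∧ ∀ i ≤ N, P.vtx i = u i := by
  have hmod : ∀ i ≤ N, u (i % N) = u i := by
    intro i hi
    rcases hi.lt_or_eq with hi | rfl
    · rw [Nat.mod_eq_of_lt hi]
    · rw [Nat.mod_self, hu]
  have hseg : ∀ x, {i | i < N ∧ x ∈ segment ℝ (u (i % N)) (u ((i + 1) % N))} =
      {i | i < N ∧ x ∈ segment ℝ (u i) (u (i + 1))} := by
    intro x
    ext i
    simp only [Set.mem_ofPred_eq]
    refine and_congr_right fun hi => ?_
    rw [hmod i hi.le, hmod (i + 1) hi]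
  have hthree : ∀ i j k z, i < j → j < k → k < N → z ∈ segment ℝ (u i) (u (i + 1)) →
      z ∈ segment ℝ (u j) (u (j + 1)) → z ∈ segment ℝ (u k) (u (k + 1)) → False := by
    intro i j k z hij hjk hk h1 h2 h3
    rcases hsimple i j z hij (by omega) h1 h2 with ⟨_, h4⟩ | ⟨_, h4, _⟩
    · rcases hsimple j k z hjk hk h2 h3 with ⟨_, h5⟩ | ⟨h5, _⟩
      · have := hinj j (by omega) k hk (h4.symm.trans h5)
        omega
      · omega
    · omega
  refine ⟨⟨N, hN, fun i => u (i % N), fun i => by simp, ?_, ?_, ?_⟩, rfl, hmod⟩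
  · intro i hi j hj hij
    refine hinj i hi j hj ?_
    simpa [Nat.mod_eq_of_lt hi, Nat.mod_eq_of_lt hj] using hij
  · intro x
    rw [hseg x]
    by_contra! hlt
    have hfin : {i | i < N ∧ x ∈ segment ℝ (u i) (u (i + 1))}.Finite :=
      (Set.finite_lt_nat N).subset fun i hi => hi.1
    obtain ⟨a, b, c, ha, hb, hc, hab, hac, hbc⟩ := (Set.two_lt_ncard_iff hfin).1 hlt
    rcases lt_or_gt_of_ne hab with h1 | h1 <;> rcases lt_or_gt_of_ne hac with h2 | h2 <;>
      rcases lt_or_gt_of_ne hbc with h3 | h3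
    · exact hthree a b c x h1 h3 hc.1 ha.2 hb.2 hc.2
    · exact hthree a c b x h2 h3 hb.1 ha.2 hc.2 hb.2
    · omega
    · exact hthree c a b x h2 h1 hb.1 hc.2 ha.2 hb.2
    · exact hthree b a c x h1 h2 hc.1 hb.2 ha.2 hc.2
    · omega
    · exact hthree b c a x h3 h2 ha.1 hb.2 hc.2 ha.2
    · exact hthree c b a x h3 h1 ha.1 hc.2 hb.2 ha.2
  · intro x hx
    rw [hseg x] at hx
    obtain ⟨a, b, hab, hset⟩ := Set.ncard_eq_two.1 hx
    have key : ∀ i j, i < j → i ∈ {i | i < N ∧ x ∈ segment ℝ (u i) (u (i + 1))} →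
        j ∈ {i | i < N ∧ x ∈ segment ℝ (u i) (u (i + 1))} → ∃ i < N, x = u (i % N) := by
      intro i j hij hi hj
      rcases hsimple i j x hij hj.1 hi.2 hj.2 with ⟨_, h⟩ | ⟨_, _, h⟩
      · exact ⟨j, hj.1, by rw [hmod j hj.1.le, h]⟩
      · exact ⟨0, by omega, by rw [hmod 0 (by omega), h]⟩
    have ha : a ∈ {i | i < N ∧ x ∈ segment ℝ (u i) (u (i + 1))} := by rw [hset]; simp
    have hb : b ∈ {i | i < N ∧ x ∈ segment ℝ (u i) (u (i + 1))} := by rw [hset]; simp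
    rcases lt_or_gt_of_ne hab with h | h
    · exact key a b h ha hb
    · exact key b a h hb ha

lemma Arc.exists_polygon {X : Set Pt} {p q : Pt} {H H' : Set Pt} {m n : ℕ} {v w : ℕ → Pt}
    (hv : Arc X p q H m v) (hw : Arc X q p H' n w) (hHH : H ∩ H' ⊆ {p, q}) (hp : p ∈ X)
    (hq : q ∈ X) (hmn : 3 ≤ m + n) :
    ∃ P : SimplePolygon, P.n = m + n ∧ (∀ i ≤ m + n, P.vtx i = glue m v w i) ∧
      ∀ i < m + n, P.ConvexAt i → P.vtx (i + 1) ∈ X := by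
  have h0 : w 0 = v m := by rw [hw.start, hv.finish]
  have hm := hv.pos
  have hn := hw.pos
  have hclose : glue m v w (m + n) = glue m v w 0 := by
    rw [glue_add h0, glue_of_le (Nat.zero_le _), hw.finish, hv.start]
  obtain ⟨P, hPn, hPv⟩ := exists_simplePolygon (u := glue m v w) hmn hclose
    (by
      have hmixed : ∀ i < m, ∀ j < n, v i ≠ w j := by
        intro i hi j hj hij
        rcases hHH ⟨hv.mem hi.le, hij ▸ hw.mem hj.le⟩ with h | h
        · have := hw.inj j hj.le n le_rfl (hij.symm.trans (h.trans hw.finish.symm))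
          omega
        · have := hv.inj i hi.le m le_rfl (h.trans hv.finish.symm)
          omega
      intro i hi j hj hij
      rcases Nat.lt_or_ge i m with him | him <;> rcases Nat.lt_or_ge j m with hjm | hjm
      · rw [glue_of_le him.le, glue_of_le hjm.le] at hij
        exact hv.inj i him.le j hjm.le hij
      · obtain ⟨j, rfl⟩ := Nat.exists_eq_add_of_le hjm
        rw [glue_of_le him.le, glue_add h0] at hij
        exact absurd hij (hmixed i him j (by omega))
      · obtain ⟨i, rfl⟩ := Nat.exists_eq_add_of_le him
        rw [glue_of_le hjm.le, glue_add h0] at hij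
        exact absurd hij.symm (hmixed j hjm i (by omega))
      · obtain ⟨i, rfl⟩ := Nat.exists_eq_add_of_le him
        obtain ⟨j, rfl⟩ := Nat.exists_eq_add_of_le hjm
        rw [glue_add h0, glue_add h0] at hij
        rw [hw.inj i (by omega) j (by omega) hij])
    (by
      intro i j z hij hj hz hz'
      rcases Nat.lt_or_ge j m with hjm | hjm
      · rw [glue_of_le (by omega), glue_of_le (by omega)] at hz hz'
        rw [glue_of_le hjm.le]
        exact Or.inl (hv.simple i j z hij hjm hz hz')
      · obtain ⟨j, rfl⟩ := Nat.exists_eq_add_of_le hjm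
        rw [add_assoc, glue_add h0, glue_add h0] at hz'
        rw [glue_add h0, glue_of_le (Nat.zero_le _)]
        rcases Nat.lt_or_ge i m with him | him
        · rw [glue_of_le him.le, glue_of_le (by omega)] at hz
          rcases hHH ⟨hv.seg i him hz, hw.seg j (by omega) hz'⟩ with h | h
          · subst h
            right
            exact ⟨hv.start_mem_segment him hz, by have := hw.stop_mem_segment (by omega) hz'; omega,
              hv.start.symm⟩
          · rw [Set.mem_singleton_iff] at h
            subst h
            left
            have h1 := hv.stop_mem_segment him hz
            have h2 := hw.start_mem_segment (by omega) hz'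
            subst h2
            exact ⟨by omega, hw.start.symm⟩
        · obtain ⟨i, rfl⟩ := Nat.exists_eq_add_of_le him
          rw [add_assoc, glue_add h0, glue_add h0] at hz
          obtain ⟨h1, h2⟩ := hw.simple i j z (by omega) (by omega) hz hz'
          exact Or.inl ⟨by omega, h2⟩)
  refine ⟨P, hPn, hPv, fun i hi hconv => ?_⟩
  rw [hPv (i + 1) hi]
  unfold SimplePolygon.ConvexAt at hconv
  rcases lt_trichotomy (i + 1) m with him | him | him
  · rw [hPv i hi.le, hPv (i + 1) hi, hPv (i + 2) (by omega), glue_of_le (by omega),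
      glue_of_le (by omega), glue_of_le (by omega)] at hconv
    rw [glue_of_le him.le]
    exact (hv.turn i him).resolve_right (not_le.2 hconv)
  · rw [him, glue_of_le le_rfl, hv.finish]
    exact hq
  · obtain ⟨i, rfl⟩ := Nat.exists_eq_add_of_le (Nat.lt_succ_iff.1 him)
    rcases Nat.lt_or_ge (i + 1) n with hin | hin
    · have e : ∀ k, i + k ≤ n → P.vtx (m + i + k) = w (i + k) := fun k hk => by
        rw [hPv _ (by omega), add_assoc, glue_add h0]
      have e0 := e 0 (by omega)
      rw [add_zero, add_zero] at e0
      rw [e0, e 1 (by omega), e 2 (by omega)] at hconv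
      rw [add_assoc, glue_add h0]
      exact (hw.turn i hin).resolve_right (not_le.2 hconv)
    · obtain rfl : n = i + 1 := by omega
      rw [add_assoc, glue_add h0, hw.finish]
      exact hp

namespace SimplePolygon

variable {P : SimplePolygon}

lemma mem_interior_of_wind_ne_zero {r : Pt} (hr : r ∉ P.boundary) (hw : wind P.vtx P.n r ≠ 0) :
    r ∈ P.interior := by
  refine ⟨hr, ?_⟩
  obtain ⟨ρ, hρ⟩ := P.isBounded_boundary.subset_closedBall 0
  refine (Metric.isBounded_closedBall (x := (0 : Pt)) (r := ρ)).subset fun y hy => ?_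
  by_contra hyK
  have hclosed : P.vtx P.n = P.vtx 0 := by simpa using P.periodic 0
  have hyb : wind P.vtx P.n y = 0 := by
    refine wind_eq_zero_of_convex hclosed (convex_closedBall 0 ρ) Metric.isClosed_closedBall ?_ hyK
    intro i hi
    exact hρ (P.edge_subset_boundary i (left_mem_segment ℝ _ _))
  refine hw ((wind_const P.n_pos hclosed isPreconnected_connectedComponentIn ?_
    (mem_connectedComponentIn hr) hy).trans hyb)
  intro z hz i hi hzi
  exact connectedComponentIn_subset _ _ hz (P.edge_subset_boundary i hzi)

lemma not_mem_region_of_ray {b d : Pt} (hd : d ≠ 0)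
    (h : ∀ t : ℝ, 0 ≤ t → b + t • d ∉ P.boundary) : b ∉ P.region := by
  have hb : b ∉ P.boundary := by simpa using h 0 le_rfl
  rintro (hb' | hb')
  · exact hb hb'
  have hray : (fun t : ℝ => b + t • d) '' Set.Ici 0 ⊆ connectedComponentIn P.boundaryᶜ b := by
    refine IsPreconnected.subset_connectedComponentIn ?_ ⟨0, by simp, by simp⟩ ?_
    · exact isPreconnected_Ici.image _ (by fun_prop)
    · rintro _ ⟨t, ht, rfl⟩
      exact h t ht
  obtain ⟨ρ, hρ⟩ := (hb'.2.subset hray).subset_closedBall b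
  have hd' : 0 < ‖d‖ := norm_pos_iff.2 hd
  have := hρ ⟨(|ρ| + 1) / ‖d‖, by simp only [Set.mem_Ici]; positivity, rfl⟩
  rw [Metric.mem_closedBall, dist_eq_norm, add_sub_cancel_left, norm_smul, Real.norm_eq_abs,
    abs_of_pos (by positivity), div_mul_cancel₀ _ hd'.ne'] at this
  linarith [le_abs_self ρ]

end SimplePolygon

lemma convexHull_insert_inter_subset {x : Pt} {A B : Set Pt} (hA : A.Nonempty) (hB : B.Nonempty)
    (h : ∀ a ∈ A, ∀ b ∈ B, 0 < det2 (a - x) (b - x)) :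
    convexHull ℝ (insert x A) ∩ convexHull ℝ (insert x B) ⊆ {x} := by
  have h1 : ∀ a ∈ A, ∀ b ∈ convexHull ℝ B, 0 < det2 (a - x) (b - x) := fun a ha b hb =>
    convexHull_min (fun b hb => h a ha b hb) (det2_pos_convex (a - x) x) hb
  have h2 : ∀ b ∈ convexHull ℝ B, ∀ a ∈ convexHull ℝ A, 0 < det2 (a - x) (b - x) := by
    intro b hb a ha
    have := convexHull_min (s := A) (t := {z | 0 < det2 (-(b - x)) (z - x)})
      (fun a ha => by
        rw [Set.mem_ofPred_eq, det2_neg_left, det2_swap, neg_neg]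
        exact h1 a ha b hb)
      (det2_pos_convex (-(b - x)) x) ha
    rwa [Set.mem_ofPred_eq, det2_neg_left, det2_swap, neg_neg] at this
  rw [convexHull_insert hA, convexHull_insert hB]
  rintro z ⟨hz, hz'⟩
  rw [convexJoin_singleton_left, Set.mem_iUnion₂] at hz hz'
  obtain ⟨a, ha, hz⟩ := hz
  obtain ⟨b, hb, hz'⟩ := hz'
  rw [segment_eq_image'] at hz hz'
  obtain ⟨s, hs, rfl⟩ := hz
  obtain ⟨t, ht, he⟩ := hz'
  have he' : t • (b - x) = s • (a - x) := add_left_cancel he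
  have h3 : s * t * det2 (a - x) (b - x) = 0 := by
    have : det2 (s • (a - x)) (t • (b - x)) = 0 := by rw [he', det2_self]
    rwa [det2_smul_left, det2_smul_right, ← mul_assoc] at this
  rcases mul_eq_zero.1 ((mul_eq_zero.1 h3).resolve_right (h2 b hb a ha).ne') with h0 | h0
  · simp [h0]
  · rw [h0, zero_smul] at he'
    simp [← he']

lemma det2_median_pos {a b d z : Pt} (h1 : 0 ≤ det2 (b - a) (z - a)) (h2 : 0 < det2 (d - b) (z - b))
    (h3 : 0 ≤ det2 (a - d) (z - d)) :
    0 < det2 (z - d) (b + d - (2 : ℝ) • a) ∧ 0 < det2 (b + d - (2 : ℝ) • a) (z - b) := by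
  have e1 : det2 (z - d) (b + d - (2 : ℝ) • a) =
      det2 (d - b) (z - b) + 2 * det2 (a - d) (z - d) := by unfold det2; simp; ring
  have e2 : det2 (b + d - (2 : ℝ) • a) (z - b) =
      det2 (d - b) (z - b) + 2 * det2 (b - a) (z - a) := by unfold det2; simp; ring
  rw [e1, e2]
  constructor <;> linarith

/-- The hull of the side of the triangle `x` opposite to `x k` and of the marks `C k`. -/
def pocketHull (x : Fin 3 → Pt) (C : Fin 3 → Finset Pt) (k : Fin 3) : Set Pt :=
  convexHull ℝ (insert (x (k + 1)) (insert (x (k + 2)) (C k : Set Pt)))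

namespace Marked

variable {R B : Finset Pt} {x : Fin 3 → Pt} {C : Fin 3 → Finset Pt}

lemma isCompact_pocketHull (k : Fin 3) : IsCompact (pocketHull x C k) :=
  isCompact_convexHull (((C k).finite_toSet.insert _).insert _).isCompact

lemma left_mem_pocketHull (k : Fin 3) : x (k + 1) ∈ pocketHull x C k :=
  subset_convexHull ℝ _ (Set.mem_insert _ _)

lemma right_mem_pocketHull (k : Fin 3) : x (k + 2) ∈ pocketHull x C k :=
  subset_convexHull ℝ _ (Set.mem_insert_of_mem _ (Set.mem_insert _ _))

lemma mark_mem_pocketHull {k : Fin 3} {c : Pt} (hc : c ∈ C k) : c ∈ pocketHull x C k :=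
  subset_convexHull ℝ _ (Set.mem_insert_of_mem _ (Set.mem_insert_of_mem _ hc))

lemma corner_nonneg (h : Marked R B x C) (i j : Fin 3) : 0 ≤ det2 (x (j + 1) - x j) (x i - x j) := by
  obtain ⟨e1, e2, e3, e4⟩ := fin_three_add j
  rcases fin_three_cases i j with rfl | rfl | rfl
  · simp
  · simp [det2_self]
  · exact (h.det j).le

lemma pocketHull_nonneg (h : Marked R B x C) {k : Fin 3} {z : Pt} (hz : z ∈ pocketHull x C k)
    (j : Fin 3) : 0 ≤ det2 (x (j + 1) - x j) (z - x j) := by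
  have hconv : Convex ℝ {z : Pt | 0 ≤ det2 (x (j + 1) - x j) (z - x j)} := by
    intro y hy z hz a b ha hb hab
    have : det2 (x (j + 1) - x j) (a • y + b • z - x j) =
        a * det2 (x (j + 1) - x j) (y - x j) + b * det2 (x (j + 1) - x j) (z - x j) := by
      obtain rfl : b = 1 - a := by linarith
      unfold det2; simp; ring
    rw [Set.mem_ofPred_eq, this]
    exact add_nonneg (mul_nonneg ha hy) (mul_nonneg hb hz)
  refine convexHull_min ?_ hconv hz
  rintro z (rfl | rfl | hz)
  · exact h.corner_nonneg _ _
  · exact h.corner_nonneg _ _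
  · exact (h.inner k z hz j).le

lemma corner_pos (h : Marked R B x C) (j : Fin 3) :
    ∀ a ∈ insert (x (j + 1)) (C (j + 2) : Set Pt), ∀ b ∈ insert (x (j + 2)) (C (j + 1) : Set Pt),
      0 < det2 (a - x j) (b - x j) := by
  obtain ⟨e1, e2, e3, e4⟩ := fin_three_add j
  rintro a (rfl | ha) b (rfl | hb)
  · exact h.det j
  · exact h.inner _ b hb j
  · have := h.inner _ a ha (j + 2)
    rw [e3] at this
    have e : det2 (a - x j) (x (j + 2) - x j) = det2 (x j - x (j + 2)) (a - x (j + 2)) := by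
      unfold det2; simp; ring
    rwa [e]
  · exact h.angle j a ha b hb

lemma pocketHull_add_two (j : Fin 3) :
    pocketHull x C (j + 2) = convexHull ℝ (insert (x j) (insert (x (j + 1)) (C (j + 2) : Set Pt))) := by
  obtain ⟨e1, e2, e3, e4⟩ := fin_three_add j
  rw [pocketHull, e3, e4]

lemma pocketHull_add_one (j : Fin 3) :
    pocketHull x C (j + 1) = convexHull ℝ (insert (x j) (insert (x (j + 2)) (C (j + 1) : Set Pt))) := by
  obtain ⟨e1, e2, e3, e4⟩ := fin_three_add j
  rw [pocketHull, e1, e2, Set.insert_comm]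

lemma pocketHull_inter_subset (h : Marked R B x C) (j : Fin 3) :
    pocketHull x C (j + 2) ∩ pocketHull x C (j + 1) ⊆ {x j} := by
  rw [pocketHull_add_two, pocketHull_add_one]
  exact convexHull_insert_inter_subset (Set.insert_nonempty _ _) (Set.insert_nonempty _ _)
    (h.corner_pos j)

/-- The signs of the sides at a point of the triangle off the side opposite to `x k`. -/
lemma sideDir_pos (h : Marked R B x C) {k : Fin 3} {z : Pt} (hz : z = x k ∨ Inside x z) :
    0 < det2 (z - x (k + 2)) (sideDir x k) ∧ 0 < det2 (sideDir x k) (z - x (k + 1)) := by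
  obtain ⟨e1, e2, e3, e4⟩ := fin_three_add k
  refine det2_median_pos ?_ ?_ ?_
  · rcases hz with rfl | hz
    · simp
    · exact (hz k).le
  · rcases hz with rfl | hz
    · have := h.det (k + 1)
      rwa [e1, e2] at this
    · have := hz (k + 1)
      rwa [e1] at this
  · rcases hz with rfl | hz
    · simp [det2_self]
    · have := hz (k + 2)
      rw [e3] at this
      exact this.le

lemma ray_notMem_pocketHull (h : Marked R B x C) {k j : Fin 3} (hjk : j ≠ k) {c : Pt} (hc : c ∈ C k)
    {s : ℝ} (hs : 0 < s) : c + s • sideDir x k ∉ pocketHull x C j := by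
  obtain ⟨e1, e2, e3, e4⟩ := fin_three_add k
  intro hw
  rcases fin_three_cases j k with rfl | rfl | rfl
  · exact hjk rfl
  · have hcorner := h.corner_pos (k + 2)
    rw [e3, e4] at hcorner
    have hpos : ∀ a ∈ insert (x k) (C (k + 1) : Set Pt), ∀ b ∈ ({c + s • sideDir x k} : Set Pt),
        0 < det2 (a - x (k + 2)) (b - x (k + 2)) := by
      rintro a ha b rfl
      have h1 := hcorner a ha c (Set.mem_insert_of_mem _ hc)
      have h2 := (h.sideDir_pos (k := k) (z := a) (by
        rcases ha with rfl | ha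
        · exact Or.inl rfl
        · exact Or.inr (h.inner _ a ha))).1
      rw [add_sub_right_comm, det2_add_right, det2_smul_right]
      positivity
    have := convexHull_insert_inter_subset (Set.insert_nonempty _ _) (Set.singleton_nonempty _) hpos
      ⟨by rwa [pocketHull, e1, e2] at hw,
        subset_convexHull ℝ _ (Set.mem_insert_of_mem _ rfl)⟩
    have h3 := hpos _ (Set.mem_insert _ _) _ rfl
    rw [Set.mem_singleton_iff.1 this, sub_self, det2_zero_right] at h3
    exact lt_irrefl _ h3
  · have hcorner := h.corner_pos (k + 1)
    rw [e1, e2] at hcorner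
    have hpos : ∀ a ∈ ({c + s • sideDir x k} : Set Pt), ∀ b ∈ insert (x k) (C (k + 2) : Set Pt),
        0 < det2 (a - x (k + 1)) (b - x (k + 1)) := by
      rintro a rfl b hb
      have h1 := hcorner c (Set.mem_insert_of_mem _ hc) b hb
      have h2 := (h.sideDir_pos (k := k) (z := b) (by
        rcases hb with rfl | hb
        · exact Or.inl rfl
        · exact Or.inr (h.inner _ b hb))).2
      rw [add_sub_right_comm, det2_add_left, det2_smul_left]
      positivity
    have := convexHull_insert_inter_subset (Set.singleton_nonempty _) (Set.insert_nonempty _ _) hpos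
      ⟨subset_convexHull ℝ _ (Set.mem_insert_of_mem _ rfl),
        by rwa [pocketHull, e3, e4, Set.insert_comm] at hw⟩
    have h3 := hpos _ rfl _ (Set.mem_insert _ _)
    rw [Set.mem_singleton_iff.1 this, sub_self, det2_zero_left] at h3
    exact lt_irrefl _ h3

end Marked

lemma Arc.sum_ang {X : Set Pt} {p q : Pt} {H : Set Pt} {n : ℕ} {v : ℕ → Pt}
    (h : Arc X p q H n v) (hconv : Convex ℝ H) (hclosed : IsClosed H) {r : Pt} (hr : r ∉ H) :
    ∑ i ∈ Finset.range n, ang r (v i) (v (i + 1)) = ang r p q := by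
  have key : ∀ k ≤ n, ∑ i ∈ Finset.range k, ang r (v i) (v (i + 1)) = ang r p (v k) := by
    intro k
    induction k with
    | zero =>
      intro _
      rw [Finset.sum_range_zero, h.start, ang_self]
      rintro rfl
      exact hr (h.start ▸ h.mem (Nat.zero_le _))
    | succ k ih =>
      intro hk
      rw [Finset.sum_range_succ, ih (by omega)]
      exact ang_add hconv hclosed hr (h.start ▸ h.mem (Nat.zero_le _)) (h.mem hk) (h.mem (by omega))
  rw [key n le_rfl, h.finish]

lemma SimplePolygon.numConvex_le_of_vtx_mem {P : SimplePolygon} {x : Fin 3 → Pt}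
    (h : ∀ i < P.n, P.ConvexAt i → P.vtx (i + 1) ∈ Set.range x) : P.numConvex ≤ 3 := by
  calc P.numConvex ≤ (Set.range x).ncard := by
        refine Set.ncard_le_ncard_of_injOn (fun i => P.vtx (i + 1)) (fun i hi => h i hi.1 hi.2) ?_
          (Set.finite_range x)
        intro i hi j hj hij
        have h1 : (i + 1) % P.n = (j + 1) % P.n := P.vtx_eq_iff.1 hij
        have h2 : i % P.n = j % P.n := Nat.ModEq.add_right_cancel' 1 h1
        rwa [Nat.mod_eq_of_lt hi.1, Nat.mod_eq_of_lt hj.1] at h2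
    _ ≤ 3 := by
        rw [← Set.image_univ]
        refine (Set.ncard_image_le Set.finite_univ).trans ?_
        simp [Set.ncard_univ]

namespace Marked

variable {R B : Finset Pt} {x : Fin 3 → Pt} {C : Fin 3 → Finset Pt}

lemma exists_polygon_of_arcs (h : Marked R B x C) {n : Fin 3 → ℕ} {v : Fin 3 → ℕ → Pt}
    (hv : ∀ k, Arc (Set.range x) (x (k + 1)) (x (k + 2)) (pocketHull x C k) (n k) (v k)) :
    ∃ P : SimplePolygon, P.numConvex ≤ 3 ∧
      (∀ f : Pt → Pt → ℝ, ∑ i ∈ Finset.range P.n, f (P.vtx i) (P.vtx (i + 1)) =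
        ∑ k, ∑ i ∈ Finset.range (n k), f (v k i) (v k (i + 1))) ∧
      ∀ z ∈ P.boundary, ∃ k, ∃ i < n k, z ∈ segment ℝ (v k i) (v k (i + 1)) := by
  have hX : ∀ i, x i ∈ Set.range x := Set.mem_range_self
  have h2 : Arc (Set.range x) (x 0) (x 1) (pocketHull x C 2) (n 2) (v 2) := hv 2
  have h0 : Arc (Set.range x) (x 1) (x 2) (pocketHull x C 0) (n 0) (v 0) := hv 0
  have h1 : Arc (Set.range x) (x 2) (x 0) (pocketHull x C 1) (n 1) (v 1) := hv 1
  have i0 : pocketHull x C 2 ∩ pocketHull x C 1 ⊆ {x 0} := h.pocketHull_inter_subset 0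
  have i1 : pocketHull x C 0 ∩ pocketHull x C 2 ⊆ {x 1} := h.pocketHull_inter_subset 1
  have i2 : pocketHull x C 1 ∩ pocketHull x C 0 ⊆ {x 2} := h.pocketHull_inter_subset 2
  have h20 := h2.append h0 (by rwa [Set.inter_comm]) (Or.inl (hX 1))
  have e20 : v 0 0 = v 2 (n 2) := by rw [h0.start, h2.finish]
  have e1 : v 1 0 = glue (n 2) (v 2) (v 0) (n 2 + n 0) := by rw [h1.start, h20.finish]
  obtain ⟨P, hPn, hPv, hPc⟩ := h20.exists_polygon h1 (by
      rintro z ⟨hz | hz, hz'⟩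
      · exact Or.inl (i0 ⟨hz, hz'⟩)
      · exact Or.inr (i2 ⟨hz', hz⟩)) (hX 0) (hX 2)
      (by have := h0.pos; have := h1.pos; have := h2.pos; omega)
  refine ⟨P, P.numConvex_le_of_vtx_mem (by rwa [hPn]), fun f => ?_, fun z hz => ?_⟩
  · have : ∑ i ∈ Finset.range P.n, f (P.vtx i) (P.vtx (i + 1)) =
        ∑ i ∈ Finset.range (n 2 + n 0 + n 1), f (glue (n 2 + n 0) (glue (n 2) (v 2) (v 0)) (v 1) i)
          (glue (n 2 + n 0) (glue (n 2) (v 2) (v 0)) (v 1) (i + 1)) := by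
      rw [hPn]
      refine Finset.sum_congr rfl fun i hi => ?_
      have hi := Finset.mem_range.1 hi
      rw [hPv i hi.le, hPv (i + 1) hi]
    rw [this, sum_glue e1, sum_glue e20, Fin.sum_univ_three]
    ring
  · obtain ⟨i, hi, hz⟩ := P.mem_boundary.1 hz
    rw [hPn] at hi
    rw [SimplePolygon.edge, hPv i hi.le, hPv (i + 1) hi] at hz
    rcases Nat.lt_or_ge i (n 2 + n 0) with hi' | hi'
    · rw [glue_of_le hi'.le, glue_of_le (i := i + 1) hi'] at hz
      rcases Nat.lt_or_ge i (n 2) with hi'' | hi''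
      · rw [glue_of_le hi''.le, glue_of_le (i := i + 1) hi''] at hz
        exact ⟨2, i, hi'', hz⟩
      · obtain ⟨i, rfl⟩ := Nat.exists_eq_add_of_le hi''
        rw [add_assoc, glue_add e20, glue_add e20] at hz
        exact ⟨0, i, by omega, hz⟩
    · obtain ⟨i, rfl⟩ := Nat.exists_eq_add_of_le hi'
      rw [add_assoc (n 2 + n 0), glue_add e1, glue_add e1] at hz
      exact ⟨1, i, by omega, hz⟩

open MeasureTheory in
lemma sum_measureReal_pocketHull_lt (h : Marked R B x C) {r : Pt} (hr : r ∈ R) :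
    ∑ k, volume.real (pocketHull x C k) < volume.real (tri (x 0) (x 1) (x 2)) := by
  have i0 : pocketHull x C 2 ∩ pocketHull x C 1 ⊆ {x 0} := h.pocketHull_inter_subset 0
  have i1 : pocketHull x C 0 ∩ pocketHull x C 2 ⊆ {x 1} := h.pocketHull_inter_subset 1
  have i2 : pocketHull x C 1 ∩ pocketHull x C 0 ⊆ {x 2} := h.pocketHull_inter_subset 2
  have hdet : 0 < det2 (x 1 - x 0) (x 2 - x 0) := h.det 0
  have hcomp : ∀ k, IsCompact (pocketHull x C k) := isCompact_pocketHull
  have hfin : ∀ k, volume (pocketHull x C k) ≠ ⊤ := fun k => (hcomp k).measure_lt_top.ne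
  set K := pocketHull x C 0 ∪ pocketHull x C 1 ∪ pocketHull x C 2 with hK
  have hKc : IsCompact K := ((hcomp 0).union (hcomp 1)).union (hcomp 2)
  have hKvol : volume.real K = volume.real (pocketHull x C 0) + volume.real (pocketHull x C 1) +
      volume.real (pocketHull x C 2) := by
    rw [hK, measureReal_union₀ (hcomp 2).measurableSet.nullMeasurableSet ?_
      ((hcomp 0).union (hcomp 1)).measure_lt_top.ne (hfin 2),
      measureReal_union₀ (hcomp 1).measurableSet.nullMeasurableSet ?_ (hfin 0) (hfin 1)]
    · exact measure_mono_null (by rw [Set.inter_comm]; exact i2) (measure_singleton (x 2))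
    · refine measure_mono_null (t := {x 1, x 0}) ?_ ((Set.toFinite _).measure_zero _)
      rintro z ⟨hz | hz, hz'⟩
      · exact Or.inl (i1 ⟨hz, hz'⟩)
      · exact Or.inr (i0 ⟨hz', hz⟩)
  set U := interior (tri (x 0) (x 1) (x 2)) \ K with hU
  have hUo : IsOpen U := isOpen_interior.sdiff hKc.isClosed
  have hrU : r ∈ U := by
    refine ⟨mem_interior_tri_of_det2 hdet (h.inside_mem r hr 1) (h.inside_mem r hr 2)
      (h.inside_mem r hr 0), ?_⟩
    rintro ((h' | h') | h')
    · exact h.sep r hr 0 h'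
    · exact h.sep r hr 1 h'
    · exact h.sep r hr 2 h'
  have hUt : U ⊆ tri (x 0) (x 1) (x 2) := Set.sdiff_subset.trans interior_subset
  have htfin := (isCompact_tri (x 0) (x 1) (x 2)).measure_lt_top (μ := volume)
  have hUfin : volume U ≠ ⊤ := ((measure_mono hUt).trans_lt htfin).ne
  have hUpos : 0 < volume.real U :=
    ENNReal.toReal_pos (hUo.measure_pos volume ⟨r, hrU⟩).ne' hUfin
  have hKt : K ⊆ tri (x 0) (x 1) (x 2) := by
    have : ∀ k, pocketHull x C k ⊆ tri (x 0) (x 1) (x 2) := fun k z hz =>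
      mem_tri_of_det2 hdet (h.pocketHull_nonneg hz 1) (h.pocketHull_nonneg hz 2)
        (h.pocketHull_nonneg hz 0)
    exact Set.union_subset (Set.union_subset (this 0) (this 1)) (this 2)
  have hsum : volume.real (U ∪ K) = volume.real U + volume.real K :=
    measureReal_union Set.disjoint_sdiff_left hKc.measurableSet hUfin hKc.measure_lt_top.ne
  have hle : volume.real (U ∪ K) ≤ volume.real (tri (x 0) (x 1) (x 2)) :=
    measureReal_mono (Set.union_subset hUt hKt) htfin.ne
  rw [Fin.sum_univ_three]
  linarith

lemma separable (h : Marked R B x C) (hB : B.card = 3) (hR : R.Nonempty) : Separable B R := by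
  obtain ⟨κ, hκpos, hκ⟩ := exists_measureReal_tri
  have harc := fun k => exists_arc hκ (Set.range x) (sideDir x k) (C k).card (x (k + 1)) (x (k + 2))
    (pocketHull x C k) (C k) le_rfl (isCompact_pocketHull k) (convex_convexHull ℝ _)
    (left_mem_pocketHull k) (right_mem_pocketHull k)
    (by
      have h1 := (h.sideDir_pos (k := k) (Or.inl rfl))
      have h2 : det2 (x k - x (k + 2)) (sideDir x k) = det2 (sideDir x k) (x (k + 2) - x k) := by
        unfold det2; simp; ring
      rw [h2] at h1
      simp only [det2_sub_right] at h1
      linarith [h1.1, h1.2])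
    (by
      intro c hc
      have h1 := h.sideDir_pos (k := k) (Or.inr (h.inner k c hc))
      have h2 : det2 (c - x (k + 2)) (sideDir x k) = det2 (sideDir x k) (x (k + 2) - c) := by
        unfold det2; simp; ring
      rw [h2] at h1
      simp only [det2_sub_right] at h1
      have h3 := h.inner k c hc (k + 1)
      rw [(fin_three_add k).1] at h3
      exact ⟨mark_mem_pocketHull hc, h3, by linarith [h1.2], by linarith [h1.1]⟩)
  choose n v hv harea hray using harc
  obtain ⟨P, hPc, hPsum, hPb⟩ := h.exists_polygon_of_arcs hv
  have hPb' : ∀ z ∈ P.boundary, ∃ k, z ∈ pocketHull x C k := by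
    intro z hz
    obtain ⟨k, i, hi, hz⟩ := hPb z hz
    exact ⟨k, (hv k).seg i hi hz⟩
  refine ⟨P, ?_, by rwa [hB], fun r hr => ?_, fun b hb => ?_⟩
  · obtain ⟨r, hr⟩ := hR
    have hlt := h.sum_measureReal_pocketHull_lt hr
    have hdet : 0 < det2 (x 1 - x 0) (x 2 - x 0) := h.det 0
    rw [hκ, abs_of_pos hdet] at hlt
    have hle := (Finset.sum_le_sum fun k (_ : k ∈ Finset.univ) => harea k).trans_lt hlt
    have hsum := hPsum det2
    rw [Fin.sum_univ_three] at hle hsum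
    have e : det2 (x 1 - x 0) (x 2 - x 0) =
        det2 (x (0 + 1)) (x (0 + 2)) + det2 (x (1 + 1)) (x (1 + 2)) +
          det2 (x (2 + 1)) (x (2 + 2)) := by
      change _ = det2 (x 1) (x 2) + det2 (x 2) (x 0) + det2 (x 0) (x 1)
      unfold det2; simp; ring
    rw [e] at hle
    have hpos : 0 < κ * P.shoelace := by
      rw [SimplePolygon.shoelace, hsum]
      linarith
    exact pos_of_mul_pos_right hpos hκpos.le
  · refine P.mem_interior_of_wind_ne_zero (fun hb => ?_) ?_
    · obtain ⟨k, hk⟩ := hPb' r hb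
      exact h.sep r hr k hk
    · rw [wind, hPsum, Finset.sum_congr rfl fun k _ =>
        (hv k).sum_ang (convex_convexHull ℝ _) (isCompact_pocketHull k).isClosed (h.sep r hr k),
        Fin.sum_univ_three]
      have := ang_triangle_inside (h.inside_mem r hr 0) (h.inside_mem r hr 1) (h.inside_mem r hr 2)
      change ang r (x 1) (x 2) + ang r (x 2) (x 0) + ang r (x 0) (x 1) ≠ 0
      change ang r (x 0) (x 1) + ang r (x 1) (x 2) + ang r (x 2) (x 0) = _ at this
      have := Real.pi_pos
      intro h0
      linarith
  · rcases h.block b hb with ⟨k, hk⟩ | ⟨k, c, hc, s, hs, rfl⟩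
    · have hu : x (k + 1) - x k ≠ 0 := by
        intro h0
        rw [h0, det2_zero_left] at hk
        exact lt_irrefl _ hk
      have hJ := det2_rotJ_pos hu
      refine P.not_mem_region_of_ray (d := -rotJ (x (k + 1) - x k)) ?_ fun t ht hz => ?_
      · intro h0
        rw [neg_eq_zero.1 h0, det2_zero_right] at hJ
        exact lt_irrefl _ hJ
      · obtain ⟨j, hj⟩ := hPb' _ hz
        have h1 := h.pocketHull_nonneg hj k
        rw [add_sub_right_comm, det2_add_right, det2_smul_right, det2_neg_right] at h1
        nlinarith
    · refine P.not_mem_region_of_ray (d := sideDir x k) ?_ fun t ht hz => ?_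
      · intro h0
        have h1 := (h.sideDir_pos (k := k) (Or.inr (h.inner k c hc))).1
        rw [h0, det2_zero_right] at h1
        exact lt_irrefl _ h1
      · obtain ⟨j, i, hi, hz⟩ := hPb _ hz
        rw [add_assoc, ← add_smul] at hz
        by_cases hjk : j = k
        · subst hjk
          exact hray j c hc (s + t) (by linarith) i hi hz
        · exact h.ray_notMem_pocketHull hjk hc (by linarith) ((hv j).seg i hi hz)

end Marked

/-- A triangle beyond a side of which all points of `B` lie is marked by the empty sets. -/
lemma Marked.of_triangle {B : Finset Pt} {x : Fin 3 → Pt} {g : Pt}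
    (hdet : ∀ k, 0 < det2 (x (k + 1) - x k) (x (k + 2) - x k)) (hg : Inside x g) {k : Fin 3}
    (hB : ∀ b ∈ B, det2 (x (k + 1) - x k) (b - x k) < 0) : Marked {g} B x fun _ => ∅ where
  det := hdet
  inside_mem r hr := by rwa [Finset.mem_singleton.1 hr]
  inner _ _ h := absurd h (Finset.notMem_empty _)
  sep r hr j := by
    rw [Finset.mem_singleton.1 hr, Finset.coe_empty, insert_empty_eq, convexHull_pair]
    intro h
    have h1 := hg (j + 1)
    rw [(fin_three_add j).1, det2_openSegment h] at h1
    exact lt_irrefl _ h1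
  angle _ _ h := absurd h (Finset.notMem_empty _)
  block b hb := Or.inl ⟨k, hB b hb⟩

lemma separable_empty {B : Finset Pt} (hB : B.card = 3) : Separable B ∅ := by
  obtain ⟨M, hM⟩ := (B.finite_toSet.image fun b : Pt => b 1).bddAbove
  have hmark : Marked {!₂[1 / 3, M + 1 + 1 / 3]} B ![!₂[0, M + 1], !₂[1, M + 1], !₂[0, M + 2]]
      fun _ => ∅ := by
    refine Marked.of_triangle (k := 0) (fun k => ?_) (fun k => ?_) fun b hb => ?_
    · fin_cases k <;> simp [det2]
    · fin_cases k <;> simp [det2] <;> norm_num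
    · have h2 : b 1 ≤ M := hM (Set.mem_image_of_mem _ hb)
      simp [det2]
      linarith
  obtain ⟨P, h1, h2, -, h3⟩ := hmark.separable hB (Finset.singleton_nonempty _)
  exact ⟨P, h1, h2, fun r hr => absurd hr (Finset.notMem_empty r), h3⟩

/-- If a set `B ⊆ S` of three points spans the geodesic hull of `S` for some
polygon, then `B` is separable from `S \ B`. -/
theorem three_extreme_points_separable
    (S B : Finset Pt) (hBS : B ⊆ S) (hB : B.card = 3)
    (P : SimplePolygon) (hS : (↑S : Set Pt) ⊆ P.interior)
    (hgp : StrongGenPos ((↑S : Set Pt) ∪ P.vertexSet))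
    (hext : extremeSet P (↑S : Set Pt) = (↑B : Set Pt)) :
    Separable B (S \ B) := by
  rcases (S \ B).eq_empty_or_nonempty with hR | hR
  · rw [hR]
    exact separable_empty hB
  have hP := SimplePolygon.nondegenerate_of_noThreeCollinear hgp.1 Set.subset_union_right
  obtain ⟨x, β, hx⟩ := exists_blocked hB hR hP hBS hS hext
  obtain ⟨x', C, hC⟩ := hx.exists_marked
  exact hC.separable hB hR
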